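/- arXiv:1801.00737 — 4 statements merged into one kernel-verified Lean document; each statement's English description precedes it below -/
import Mathlib

section
/- For every integer k ≥ 2 and every ε > 0 there exists N such that for every n ≥ N for which 2n/k is an even integer, H(n,2k) ≤ n^{(1 − 1/k + ε)n} · M(2n/k, 2k). -/
open SimpleGraph

/-- `G` contains a cycle of length `k` as a subgraph. -/
def ContainsCycleLen {V : Type*} (G : SimpleGraph V) (k : ℕ) : Prop :=
  ∃ (u : V) (w : G.Walk u u), w.IsCycle ∧ w.length = k

/-- `H` is a Hamiltonian path of the complete graph on `Fin n`:
it is the path graph on `n` vertices up to a relabeling of the vertices. -/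
def IsHamPathGraph {n : ℕ} (H : SimpleGraph (Fin n)) : Prop :=
  ∃ σ : Equiv.Perm (Fin n), ∀ a b, H.Adj a b ↔ (pathGraph n).Adj (σ a) (σ b)

/-- The maximum size of a family of Hamiltonian paths of `K_n` that are
pairwise `C_k`-creating. -/
noncomputable def Hnum (n k : ℕ) : ℕ :=
  sSup {m | ∃ F : Finset (SimpleGraph (Fin n)), F.card = m ∧
    (∀ G ∈ F, IsHamPathGraph G) ∧
    ∀ G₁ ∈ F, ∀ G₂ ∈ F, G₁ ≠ G₂ → ContainsCycleLen (G₁ ⊔ G₂) k}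

/-- `H` is a perfect matching (as a graph): every vertex has a unique neighbor. -/
def IsPMGraph {V : Type*} (H : SimpleGraph V) : Prop :=
  ∀ v : V, ∃! w : V, H.Adj v w

/-- The maximum size of a family of perfect matchings of `K_n` that are
pairwise `C_k`-creating. -/
noncomputable def Mnum (n k : ℕ) : ℕ :=
  sSup {m | ∃ F : Finset (SimpleGraph (Fin n)), F.card = m ∧
    (∀ G ∈ F, IsPMGraph G) ∧
    ∀ G₁ ∈ F, ∀ G₂ ∈ F, G₁ ≠ G₂ → ContainsCycleLen (G₁ ⊔ G₂) k}

lemma int_dvd_congr {a b c : ℤ} (h : a ∣ b) (e : c = b) : a ∣ c := e ▸ h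

/-- A cycle yields a periodic sequence of vertices. -/
lemma cycle_seq {V : Type*} {G : SimpleGraph V} {u : V} (w : G.Walk u u) (hw : w.IsCycle) :
    (∀ i, G.Adj (w.getVert (i % w.length)) (w.getVert ((i + 1) % w.length))) ∧
    (∀ i, w.getVert (i % w.length) ≠ w.getVert ((i + 2) % w.length)) := by
  have h3 := hw.three_le_length
  constructor
  · intro i
    have hlt : i % w.length < w.length := Nat.mod_lt _ (by omega)
    have hadj := w.adj_getVert_succ hlt
    by_cases h : i % w.length + 1 = w.length
    · have h0 : (i + 1) % w.length = 0 := by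
        rw [Nat.add_mod, Nat.mod_eq_of_lt (show 1 < w.length by omega), h, Nat.mod_self]
      rw [h0, Walk.getVert_zero]
      rw [h, Walk.getVert_length] at hadj
      exact hadj
    · have h0 : (i + 1) % w.length = i % w.length + 1 := by
        rw [Nat.add_mod, Nat.mod_eq_of_lt (show 1 < w.length by omega), Nat.mod_eq_of_lt]
        omega
      rw [h0]; exact hadj
  · intro i h
    have hlt : i % w.length < w.length := Nat.mod_lt _ (by omega)
    have hlt2 : (i + 2) % w.length < w.length := Nat.mod_lt _ (by omega)
    have := hw.getVert_injOn' (by simp only [Set.mem_ofPred_eq]; omega)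
      (by simp only [Set.mem_ofPred_eq]; omega) h
    have h2 : i ≡ i + 2 [MOD w.length] := this
    have h4 : i + 0 ≡ i + 2 [MOD w.length] := h2
    have h5 := Nat.ModEq.add_left_cancel' i h4
    unfold Nat.ModEq at h5
    rw [Nat.mod_eq_of_lt (show 2 < w.length by omega), Nat.zero_mod] at h5
    omega

lemma cycle_transfer {V : Type*} {G H : SimpleGraph V} {u : V} (w : G.Walk u u) (hw : w.IsCycle)
    (h : ∀ i, H.Adj (w.getVert (i % w.length)) (w.getVert ((i + 1) % w.length))) :
    ContainsCycleLen H w.length := by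
  have h3 := hw.three_le_length
  have key : ∀ e ∈ w.edges, e ∈ H.edgeSet := by
    intro e he
    induction e with
    | h a b =>
      rw [Walk.mk_mem_edges_iff_exists] at he
      obtain ⟨i, hi, hab⟩ := he
      rw [← hab, SimpleGraph.mem_edgeSet]
      have := h i
      rw [Nat.mod_eq_of_lt hi] at this
      by_cases h' : i + 1 = w.length
      · rw [h', Nat.mod_self, Walk.getVert_zero] at this
        rw [h', Walk.getVert_length]; exact this
      · rwa [Nat.mod_eq_of_lt (show i + 1 < w.length by omega)] at this
  exact ⟨u, w.transfer H key, hw.transfer key, by simp⟩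

/-- The combinatorial heart: in a graph mapped homomorphically onto a cycle of length `3k`,
a cycle of length `2k` only uses the branching levels. -/
lemma key_comb {V : Type*} (A : V → V → Prop) (φ : V → ℤ) (k : ℕ) (hk : 2 ≤ k)
    (hφ : ∀ a b, A a b → (3 * k : ℤ) ∣ φ b - φ a - 1)
    (hin : ∀ a a' b, A a b → A a' b → ¬ (k : ℤ) ∣ φ b → a = a')
    (hout : ∀ a b b', A a b → A a b' → ¬ (k : ℤ) ∣ φ a + 1 → b = b')
    (x : ℕ → V) (hper : ∀ i, x (i + 2 * k) = x i)
    (hadj : ∀ i, A (x i) (x (i + 1)) ∨ A (x (i + 1)) (x i))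
    (hne : ∀ i, x i ≠ x (i + 2)) (i : ℕ) :
    (A (x i) (x (i + 1)) ∧ (k : ℤ) ∣ φ (x i) + 1) ∨
      (A (x (i + 1)) (x i) ∧ (k : ℤ) ∣ φ (x (i + 1)) + 1) := by
  classical
  obtain ⟨h, hh0, hstep⟩ : ∃ h : ℕ → ℤ, h 0 = φ (x 0) ∧
      ∀ i, (h (i + 1) = h i + 1 ∧ A (x i) (x (i + 1))) ∨
        (h (i + 1) = h i - 1 ∧ A (x (i + 1)) (x i)) := by
    refine ⟨fun i => Nat.rec (φ (x 0)) (fun i r => if A (x i) (x (i + 1)) then r + 1 else r - 1) i,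
      rfl, ?_⟩
    intro i
    by_cases hA : A (x i) (x (i + 1))
    · left; simp [hA]
    · right; simp [hA, (hadj i).resolve_left hA]
  have hmod : ∀ i, (3 * k : ℤ) ∣ h i - φ (x i) := by
    intro i
    induction i with
    | zero => simp [hh0]
    | succ i ih =>
      rcases hstep i with ⟨h1, h2⟩ | ⟨h1, h2⟩
      · have := dvd_sub ih (hφ _ _ h2)
        rw [h1]; refine int_dvd_congr this ?_; ring
      · have := dvd_add ih (hφ _ _ h2)
        rw [h1]; refine int_dvd_congr this ?_; ring
  have hlip : ∀ i j, |h (i + j) - h i| ≤ j := by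
    intro i j
    induction j with
    | zero => simp
    | succ j ih =>
      rw [abs_le] at ih ⊢
      have := hstep (i + j)
      rw [show i + (j + 1) = i + j + 1 by ring]
      push_cast
      rcases this with ⟨h1, -⟩ | ⟨h1, -⟩ <;> constructor <;> linarith [ih.1, ih.2]
  have hperh : ∀ i, h (i + 2 * k) = h i := by
    intro i
    have h1 := hmod (i + 2 * k)
    rw [hper] at h1
    have h2 := dvd_sub h1 (hmod i)
    have h3 : (3 * k : ℤ) ∣ h (i + 2 * k) - h i := by refine int_dvd_congr h2 ?_; ring
    have h4 := hlip i (2 * k)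
    have h5 := Int.eq_zero_of_abs_lt_dvd h3 (by push_cast at h4; omega)
    omega
  have hperm : ∀ q i, h (i + 2 * k * q) = h i := by
    intro q
    induction q with
    | zero => simp
    | succ q ih =>
      intro i
      rw [show i + 2 * k * (q + 1) = (i + 2 * k * q) + 2 * k by ring, hperh, ih]
  have hmodh : ∀ i, h (i % (2 * k)) = h i := by
    intro i
    conv_rhs => rw [← Nat.mod_add_div i (2 * k)]
    rw [hperm]
  have hdiff : ∀ i j, i < 2 * k → j < 2 * k → i ≤ j → |h j - h i| ≤ k := by
    intro i j hi hj hij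
    by_cases hc : j - i ≤ k
    · have := hlip i (j - i)
      rw [show i + (j - i) = j by omega] at this
      exact this.trans (by exact_mod_cast hc)
    · have := hlip j (i + 2 * k - j)
      rw [show j + (i + 2 * k - j) = i + 2 * k by omega, hperh, abs_sub_comm] at this
      exact this.trans (by exact_mod_cast (by omega : i + 2 * k - j ≤ k))
  have hne2 : (Finset.range (2 * k)).Nonempty := ⟨0, by simp; omega⟩
  obtain ⟨p, hp, hpmax⟩ := Finset.exists_max_image (Finset.range (2 * k)) h hne2
  obtain ⟨q, hq, hqmin⟩ := Finset.exists_min_image (Finset.range (2 * k)) h hne2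
  rw [Finset.mem_range] at hp hq
  have hmax : ∀ i, h i ≤ h p := by
    intro i
    rw [← hmodh i]
    exact hpmax _ (Finset.mem_range.2 (Nat.mod_lt _ (by omega)))
  have hmin : ∀ i, h q ≤ h i := by
    intro i
    rw [← hmodh i]
    exact hqmin _ (Finset.mem_range.2 (Nat.mod_lt _ (by omega)))
  have hle : h p - h q ≤ k := by
    rcases le_total q p with hqp | hqp
    · exact (le_abs_self _).trans (hdiff q p hq hp hqp)
    · have := hdiff p q hp hq hqp
      rw [abs_sub_comm] at this
      exact (le_abs_self _).trans this
  have hkdvd : ∀ i, (k : ℤ) ∣ h i - φ (x i) := fun i => (Dvd.intro_left 3 rfl).trans (hmod i)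
  have hpk : (k : ℤ) ∣ h p := by
    by_contra hcon
    have e1 := hstep (p + 2 * k - 1)
    have e2 := hstep (p + 2 * k)
    have e3 := hne (p + 2 * k - 1)
    have m1 := hmax (p + 2 * k - 1)
    have m2 := hmax (p + 2 * k + 1)
    rw [show p + 2 * k - 1 + 1 = p + 2 * k by omega] at e1
    rw [show p + 2 * k - 1 + 2 = p + 2 * k + 1 by omega] at e3
    have hpp := hperh p
    have a1 : A (x (p + 2 * k - 1)) (x (p + 2 * k)) := by
      rcases e1 with ⟨_, h2⟩ | ⟨h1, _⟩
      · exact h2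
      · omega
    have a2 : A (x (p + 2 * k + 1)) (x (p + 2 * k)) := by
      rcases e2 with ⟨h1, _⟩ | ⟨_, h2⟩
      · omega
      · exact h2
    refine e3 (hin _ _ _ a1 a2 ?_)
    intro hd
    have := dvd_add (hkdvd (p + 2 * k)) hd
    rw [hpp] at this
    exact hcon (by simpa using this)
  have hqk : (k : ℤ) ∣ h q + 1 := by
    by_contra hcon
    have e1 := hstep (q + 2 * k - 1)
    have e2 := hstep (q + 2 * k)
    have e3 := hne (q + 2 * k - 1)
    have m1 := hmin (q + 2 * k - 1)
    have m2 := hmin (q + 2 * k + 1)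
    rw [show q + 2 * k - 1 + 1 = q + 2 * k by omega] at e1
    rw [show q + 2 * k - 1 + 2 = q + 2 * k + 1 by omega] at e3
    have hpp := hperh q
    have a1 : A (x (q + 2 * k)) (x (q + 2 * k - 1)) := by
      rcases e1 with ⟨h1, _⟩ | ⟨_, h2⟩
      · omega
      · exact h2
    have a2 : A (x (q + 2 * k)) (x (q + 2 * k + 1)) := by
      rcases e2 with ⟨_, h2⟩ | ⟨h1, _⟩
      · exact h2
      · omega
    refine e3 (hout _ _ _ a1 a2 ?_)
    intro hd
    have := dvd_add (hkdvd (q + 2 * k)) hd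
    rw [hpp] at this
    exact hcon (by refine int_dvd_congr this ?_; ring)
  have hpq : h p - h q = 1 := by
    have hd : (k : ℤ) ∣ h p - h q - 1 := by
      have := dvd_sub hpk hqk
      refine int_dvd_congr this ?_; ring
    have hge : h q + 1 ≤ h p := by
      have m1 := hmax (q + 1)
      have m2 := hmin (q + 1)
      rcases hstep q with ⟨h1, _⟩ | ⟨h1, _⟩ <;> omega
    have := Int.eq_zero_of_abs_lt_dvd hd (by rw [abs_lt]; constructor <;> omega)
    omega
  have hfin : ∀ j, h j = h q → (k : ℤ) ∣ φ (x j) + 1 := by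
    intro j hj
    have := dvd_sub hqk (hkdvd j)
    rw [hj] at this
    refine int_dvd_congr this ?_; ring
  have b1 := hmax i
  have b2 := hmin i
  have b3 := hmax (i + 1)
  have b4 := hmin (i + 1)
  rcases hstep i with ⟨h1, h2⟩ | ⟨h1, h2⟩
  · left; exact ⟨h2, hfin _ (by omega)⟩
  · right; exact ⟨h2, hfin _ (by omega)⟩

/-- The cyclic successor along the Hamiltonian path. -/
def rotP {n : ℕ} (σ : Equiv.Perm (Fin n)) : Equiv.Perm (Fin n) :=
  (σ.trans (finRotate n)).trans σ.symm

lemma rotP_val {n : ℕ} (σ : Equiv.Perm (Fin n)) (v : Fin n) :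
    (σ (rotP σ v)).val = if (σ v).val + 1 = n then 0 else (σ v).val + 1 := by
  cases n with
  | zero => exact v.elim0
  | succ n =>
    have h : σ (rotP σ v) = σ v + 1 := by simp [rotP]
    rw [h, Fin.val_add_one]
    by_cases hc : σ v = Fin.last n
    · simp [hc]
    · have : (σ v).val ≠ n := fun h => hc (Fin.ext (by simpa using h))
      simp [hc, this]

lemma rotP_of_succ {n : ℕ} (σ : Equiv.Perm (Fin n)) (a b : Fin n)
    (h : (σ a).val + 1 = (σ b).val) : rotP σ a = b := by
  apply σ.injective
  apply Fin.ext
  rw [rotP_val, if_neg, h]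
  have := (σ b).isLt
  omega

lemma succ_of_rotP {n k : ℕ} (hkn : k ∣ n) (σ : Equiv.Perm (Fin n)) (a b : Fin n)
    (h : rotP σ a = b) (hk : ¬ k ∣ (σ a).val + 1) : (σ a).val + 1 = (σ b).val := by
  rw [← h, rotP_val, if_neg]
  intro h'
  rw [h'] at hk
  exact hk hkn

lemma rotP_dvd {n k : ℕ} (hkn : k ∣ n) (σ : Equiv.Perm (Fin n)) (a : Fin n) :
    k ∣ (σ (rotP σ a)).val ↔ k ∣ (σ a).val + 1 := by
  rw [rotP_val]
  split_ifs with h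
  · rw [h]; simp [hkn]
  · rfl

/-- The matching formed by the edges leaving a block (cyclically). -/
def Bg {n : ℕ} (k : ℕ) (σ : Equiv.Perm (Fin n)) : SimpleGraph (Fin n) :=
  SimpleGraph.fromRel (fun a b => k ∣ (σ a).val + 1 ∧ rotP σ a = b)

lemma not_both {k a : ℕ} (hk : 2 ≤ k) (h1 : k ∣ a) (h2 : k ∣ a + 1) : False := by
  have := (Nat.dvd_add_right h1).1 h2
  have := Nat.le_of_dvd one_pos this
  omega

lemma Bg_adj {n k : ℕ} (hk : 2 ≤ k) (hkn : k ∣ n) (σ : Equiv.Perm (Fin n)) (a b : Fin n) :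
    (Bg k σ).Adj a b ↔
      (k ∣ (σ a).val + 1 ∧ rotP σ a = b) ∨ (k ∣ (σ b).val + 1 ∧ rotP σ b = a) := by
  unfold Bg
  rw [SimpleGraph.fromRel_adj]
  constructor
  · exact fun h => h.2
  · intro h
    refine ⟨?_, h⟩
    rintro rfl
    have h' : k ∣ (σ a).val + 1 ∧ rotP σ a = a := by tauto
    have := (rotP_dvd hkn σ a).2 h'.1
    rw [h'.2] at this
    exact not_both hk this h'.1

lemma Bg_mem {n k : ℕ} (hk : 2 ≤ k) (hkn : k ∣ n) (σ : Equiv.Perm (Fin n)) (a b : Fin n)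
    (h : (Bg k σ).Adj a b) : k ∣ (σ a).val ∨ k ∣ (σ a).val + 1 := by
  rw [Bg_adj hk hkn] at h
  rcases h with h | ⟨h1, h2⟩
  · exact Or.inr h.1
  · left; rw [← h2, rotP_dvd hkn]; exact h1

lemma Bg_pm {n k : ℕ} (hk : 2 ≤ k) (hkn : k ∣ n) (σ : Equiv.Perm (Fin n)) (a : Fin n)
    (h : k ∣ (σ a).val ∨ k ∣ (σ a).val + 1) : ∃! b, (Bg k σ).Adj a b := by
  rcases h with h | h
  · refine ⟨(rotP σ).symm a, ?_, ?_⟩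
    · simp only [Bg_adj hk hkn]
      right
      rw [← rotP_dvd hkn]; simpa using h
    · intro y hy
      simp only [Bg_adj hk hkn] at hy
      rcases hy with hy | hy
      · exact (not_both hk h hy.1).elim
      · rw [← hy.2]; simp
  · refine ⟨rotP σ a, ?_, ?_⟩
    · simp only [Bg_adj hk hkn]
      exact Or.inl ⟨h, by simp⟩
    · intro y hy
      simp only [Bg_adj hk hkn] at hy
      rcases hy with hy | hy
      · exact hy.2.symm
      · exfalso
        refine not_both hk ?_ h
        rw [← hy.2, rotP_dvd hkn]; exact hy.1

lemma dvd_of_mod_eq {k a b : ℕ} (h : a % (3 * k) = b % (3 * k)) (c : ℕ) :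
    k ∣ a + c ↔ k ∣ b + c := by
  have h1 : a ≡ b [MOD k] := Nat.ModEq.of_mul_left 3 h
  exact (h1.add_right c).dvd_iff dvd_rfl

lemma cycle_to_matching {n k : ℕ} (hk : 2 ≤ k) (hkn : k ∣ n) (G₁ G₂ : SimpleGraph (Fin n))
    (σ₁ σ₂ : Equiv.Perm (Fin n))
    (h₁ : ∀ a b, G₁.Adj a b ↔ (pathGraph n).Adj (σ₁ a) (σ₁ b))
    (h₂ : ∀ a b, G₂.Adj a b ↔ (pathGraph n).Adj (σ₂ a) (σ₂ b))
    (hmod : ∀ v, (σ₁ v).val % (3 * k) = (σ₂ v).val % (3 * k))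
    (hrot : ∀ v, ¬ k ∣ (σ₁ v).val + 1 → rotP σ₁ v = rotP σ₂ v)
    (hc : ContainsCycleLen (G₁ ⊔ G₂) (2 * k)) :
    ContainsCycleLen (Bg k σ₁ ⊔ Bg k σ₂) (2 * k) := by
  obtain ⟨u, w, hw, hl⟩ := hc
  obtain ⟨c1, c2⟩ := cycle_seq w hw
  rw [← hl]
  apply cycle_transfer w hw
  let A : Fin n → Fin n → Prop := fun a b =>
    (σ₁ a).val + 1 = (σ₁ b).val ∨ (σ₂ a).val + 1 = (σ₂ b).val
  have hmodZ : ∀ v, (3 * k : ℤ) ∣ (σ₁ v).val - (σ₂ v).val := by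
    intro v
    have := (Nat.modEq_iff_dvd.1 (hmod v).symm)
    exact_mod_cast this
  -- common arcs away from the block ends
  have arcs : ∀ a b, A a b → ¬ k ∣ (σ₁ a).val + 1 → (σ₁ a).val + 1 = (σ₁ b).val := by
    intro a b hA hna
    rcases hA with hA | hA
    · exact hA
    · have := rotP_of_succ σ₂ a b hA
      rw [← hrot a hna] at this
      exact succ_of_rotP hkn σ₁ a b this hna
  have Adv : ∀ a b, A a b → (k ∣ (σ₁ b).val ↔ k ∣ (σ₁ a).val + 1) := by
    intro a b hA
    rcases hA with hA | hA
    · rw [hA]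
    · rw [dvd_of_mod_eq (hmod a) 1, hA]
      exact dvd_of_mod_eq (hmod b) 0
  have key := key_comb A (fun v => ((σ₁ v).val : ℤ)) k hk
    (by
      intro a b hA
      rcases hA with hA | hA
      · rw [← hA]; push_cast; simp
      · have := dvd_sub (hmodZ b) (hmodZ a)
        rw [← hA] at this
        refine int_dvd_congr this ?_; push_cast; ring)
    (by
      intro a a' b hA hA' hnd
      have hnd' : ¬ k ∣ (σ₁ b).val := by exact_mod_cast hnd
      have e1 := arcs a b hA (by rwa [← Adv a b hA])
      have e2 := arcs a' b hA' (by rwa [← Adv a' b hA'])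
      exact σ₁.injective (Fin.ext (by omega)))
    (by
      intro a b b' hA hA' hnd
      have hnd' : ¬ k ∣ (σ₁ a).val + 1 := by exact_mod_cast hnd
      have e1 := arcs a b hA hnd'
      have e2 := arcs a b' hA' hnd'
      exact σ₁.injective (Fin.ext (by omega)))
    (fun i => w.getVert (i % w.length))
    (by intro i; simp [hl])
    (by
      intro i
      have := c1 i
      rw [SimpleGraph.sup_adj, h₁, h₂, pathGraph_adj, pathGraph_adj] at this
      simp only [A]
      tauto)
    c2
  have fin : ∀ a b, A a b → k ∣ (σ₁ a).val + 1 → (Bg k σ₁ ⊔ Bg k σ₂).Adj a b := by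
    intro a b hA hd
    rw [SimpleGraph.sup_adj, Bg_adj hk hkn, Bg_adj hk hkn]
    rcases hA with hA | hA
    · exact Or.inl (Or.inl ⟨hd, rotP_of_succ _ _ _ hA⟩)
    · exact Or.inr (Or.inl ⟨(dvd_of_mod_eq (hmod a) 1).1 hd, rotP_of_succ _ _ _ hA⟩)
  intro i
  rcases key i with ⟨ha, hd⟩ | ⟨ha, hd⟩
  · exact fin _ _ ha (by exact_mod_cast hd)
  · exact (fin _ _ ha (by exact_mod_cast hd)).symm

lemma pm_no_cycle {V : Type*} (H : SimpleGraph V) (h : ∀ a b c, H.Adj a b → H.Adj a c → b = c)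
    (L : ℕ) : ¬ ContainsCycleLen H L := by
  rintro ⟨u, w, hw, -⟩
  obtain ⟨c1, c2⟩ := cycle_seq w hw
  exact c2 0 (h _ _ _ (c1 0).symm (c1 1))

lemma cycle_comap {V W : Type*} (H : SimpleGraph W) (f : V → W) (hf : Function.Injective f)
    (hr : ∀ a b, H.Adj a b → a ∈ Set.range f) (L : ℕ) (hc : ContainsCycleLen H L) :
    ContainsCycleLen (H.comap f) L := by
  obtain ⟨u, w, hw, hl⟩ := hc
  have hs : ∀ x ∈ w.support, x ∈ Set.range f := by
    intro x hx
    rw [Walk.mem_support_iff_exists_mem_edges_of_not_nil hw.not_nil] at hx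
    obtain ⟨e, he, hxe⟩ := hx
    have := w.edges_subset_edgeSet he
    induction e with
    | h a b =>
      rw [SimpleGraph.mem_edgeSet] at this
      rcases Sym2.mem_iff.1 hxe with rfl | rfl
      · exact hr _ _ this
      · exact hr _ _ this.symm
  let e := Equiv.ofInjective f hf
  have he : ∀ y : Set.range f, f (e.symm y) = y := fun y => by
    have := e.apply_symm_apply y
    exact congrArg Subtype.val this
  let g : H.induce (Set.range f) →g H.comap f :=
    ⟨e.symm, by
      intro a b hab
      simp only [SimpleGraph.comap_adj] at hab ⊢
      rw [he, he]; exact hab⟩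
  refine ⟨_, (w.induce _ hs).map g, ?_, ?_⟩
  · refine Walk.IsCycle.map (f := g) e.symm.injective ?_
    have h1 := Walk.map_induce w hs
    rw [← Walk.isCycle_map_iff_of_injective (f := (Embedding.induce (Set.range f)).toHom) Subtype.val_injective, h1]
    exact hw
  · have h1 := congrArg Walk.length (Walk.map_induce w hs)
    rw [Walk.length_map] at h1 ⊢
    exact h1.trans hl

lemma le_Mnum {m L : ℕ} (F : Finset (SimpleGraph (Fin m))) (h1 : ∀ G ∈ F, IsPMGraph G)
    (h2 : ∀ G₁ ∈ F, ∀ G₂ ∈ F, G₁ ≠ G₂ → ContainsCycleLen (G₁ ⊔ G₂) L) :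
    F.card ≤ Mnum m L := by
  classical
  apply le_csSup
  · refine ⟨Fintype.card (SimpleGraph (Fin m)), ?_⟩
    rintro _ ⟨F, rfl, -⟩
    exact Finset.card_le_univ F
  · exact ⟨F, rfl, h1, h2⟩

lemma card_ends {n k t : ℕ} (hk : 2 ≤ k) (hn : n = k * t) (σ : Equiv.Perm (Fin n)) :
    (Finset.univ.filter (fun v : Fin n => k ∣ (σ v).val + 1)).card = t := by
  have h1 : (Finset.univ.filter (fun v : Fin n => k ∣ (σ v).val + 1)).card =
      ((Finset.range n).filter (fun e => k ∣ e + 1)).card := by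
    refine Finset.card_bij (fun v _ => (σ v).val) ?_ ?_ ?_
    · intro a ha; simpa using ha
    · intro a _ b _ h; exact σ.injective (Fin.ext h)
    · intro b hb
      simp only [Finset.mem_filter, Finset.mem_range] at hb
      exact ⟨σ.symm ⟨b, hb.1⟩, by simpa using hb.2, by simp⟩
  rw [h1, Nat.card_multiples, hn, Nat.mul_div_cancel_left _ (by omega)]

lemma card_starts {n k t : ℕ} (hk : 2 ≤ k) (hn : n = k * t) (σ : Equiv.Perm (Fin n)) :
    (Finset.univ.filter (fun v : Fin n => k ∣ (σ v).val)).card = t := by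
  rw [← card_ends hk hn σ]
  symm
  have hkn : k ∣ n := ⟨t, hn⟩
  refine Finset.card_bij (fun v _ => rotP σ v) ?_ ?_ ?_
  · intro a ha
    simp only [Finset.mem_filter, Finset.mem_univ, true_and] at ha ⊢
    rwa [rotP_dvd hkn]
  · intro a _ b _ h; exact (rotP σ).injective h
  · intro b hb
    simp only [Finset.mem_filter, Finset.mem_univ, true_and] at hb
    refine ⟨(rotP σ).symm b, ?_, by simp⟩
    simp only [Finset.mem_filter, Finset.mem_univ, true_and]
    rw [← rotP_dvd hkn]; simpa using hb

lemma card_S {n k t : ℕ} (hk : 2 ≤ k) (hn : n = k * t) (σ : Equiv.Perm (Fin n)) :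
    Fintype.card {v : Fin n // k ∣ (σ v).val ∨ k ∣ (σ v).val + 1} = 2 * t := by
  rw [Fintype.card_subtype, Finset.filter_or, Finset.card_union_of_disjoint, card_ends hk hn,
    card_starts hk hn]
  · ring
  · rw [Finset.disjoint_filter]
    exact fun x _ h1 h2 => not_both hk h1 h2

lemma fiber_bound {n k t : ℕ} (hk : 2 ≤ k) (hn : n = k * t)
    (s : SimpleGraph (Fin n) → Equiv.Perm (Fin n)) (F : Finset (SimpleGraph (Fin n)))
    (hs : ∀ G ∈ F, ∀ a b, G.Adj a b ↔ (pathGraph n).Adj (s G a) (s G b))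
    (hF : ∀ G₁ ∈ F, ∀ G₂ ∈ F, G₁ ≠ G₂ → ContainsCycleLen (G₁ ⊔ G₂) (2 * k))
    (σ : Equiv.Perm (Fin n))
    (hmod : ∀ G ∈ F, ∀ v, (s G v).val % (3 * k) = (σ v).val % (3 * k))
    (hrot : ∀ G ∈ F, ∀ v, ¬ k ∣ (σ v).val + 1 → rotP (s G) v = rotP σ v) :
    F.card ≤ Mnum (2 * t) (2 * k) := by
  classical
  have hkn : k ∣ n := ⟨t, hn⟩
  let e := (Fintype.equivFinOfCardEq (card_S hk hn σ)).symm
  let f : Fin (2 * t) → Fin n := fun i => (e i).val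
  have hf : Function.Injective f := Subtype.val_injective.comp e.injective
  have hrange : ∀ v, (k ∣ (σ v).val ∨ k ∣ (σ v).val + 1) → v ∈ Set.range f := by
    intro v hv
    exact ⟨e.symm ⟨v, hv⟩, by simp [f]⟩
  have hmem : ∀ G ∈ F, ∀ v, (k ∣ (s G v).val ∨ k ∣ (s G v).val + 1) ↔
      (k ∣ (σ v).val ∨ k ∣ (σ v).val + 1) := by
    intro G hG v
    have a := dvd_of_mod_eq (hmod G hG v) 0
    have b := dvd_of_mod_eq (hmod G hG v) 1
    simp only [add_zero] at a
    rw [a, b]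
  have hpm : ∀ G ∈ F, IsPMGraph ((Bg k (s G)).comap f) := by
    intro G hG i
    have hi : k ∣ (s G (f i)).val ∨ k ∣ (s G (f i)).val + 1 := (hmem G hG _).2 (e i).2
    obtain ⟨b, hb, hu⟩ := Bg_pm hk hkn (s G) (f i) hi
    obtain ⟨j, rfl⟩ := hrange b ((hmem G hG _).1 (Bg_mem hk hkn _ _ _ hb.symm))
    exact ⟨j, hb, fun y hy => hf (hu _ hy)⟩
  have hcyc : ∀ G₁ ∈ F, ∀ G₂ ∈ F, G₁ ≠ G₂ →
      ContainsCycleLen ((Bg k (s G₁)).comap f ⊔ (Bg k (s G₂)).comap f) (2 * k) := by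
    intro G₁ hG₁ G₂ hG₂ hne
    have h1 := cycle_to_matching hk hkn G₁ G₂ (s G₁) (s G₂) (hs _ hG₁) (hs _ hG₂)
      (fun v => (hmod _ hG₁ v).trans (hmod _ hG₂ v).symm)
      (fun v hv => by
        have hv' : ¬ k ∣ (σ v).val + 1 := by rwa [← dvd_of_mod_eq (hmod _ hG₁ v) 1]
        rw [hrot _ hG₁ v hv', hrot _ hG₂ v hv'])
      (hF _ hG₁ _ hG₂ hne)
    have h2 := cycle_comap _ f hf ?_ _ h1
    · exact h2
    · intro a b hab
      apply hrange
      rcases hab with hab | hab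
      · exact (hmem _ hG₁ _).1 (Bg_mem hk hkn _ _ _ hab)
      · exact (hmem _ hG₂ _).1 (Bg_mem hk hkn _ _ _ hab)
  have hinj : Set.InjOn (fun G => (Bg k (s G)).comap f) (F : Set (SimpleGraph (Fin n))) := by
    intro G₁ hG₁ G₂ hG₂ heq
    by_contra hne
    have h1 := hcyc G₁ hG₁ G₂ hG₂ hne
    simp only at heq
    rw [heq, sup_idem] at h1
    refine pm_no_cycle _ ?_ _ h1
    intro a b c hb hc
    exact (hpm G₂ hG₂ a).unique hb hc
  rw [← Finset.card_image_of_injOn hinj]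
  apply le_Mnum
  · intro G hG
    obtain ⟨G', hG', rfl⟩ := Finset.mem_image.1 hG
    exact hpm G' hG'
  · intro G₁ hG₁ G₂ hG₂ hne
    obtain ⟨G₁', hG₁', rfl⟩ := Finset.mem_image.1 hG₁
    obtain ⟨G₂', hG₂', rfl⟩ := Finset.mem_image.1 hG₂
    exact hcyc _ hG₁' _ hG₂' (fun h => hne (by rw [h]))

lemma family_bound {n k t : ℕ} (hk : 2 ≤ k) (hn : n = k * t) (F : Finset (SimpleGraph (Fin n)))
    (hham : ∀ G ∈ F, IsHamPathGraph G)
    (hF : ∀ G₁ ∈ F, ∀ G₂ ∈ F, G₁ ≠ G₂ → ContainsCycleLen (G₁ ⊔ G₂) (2 * k)) :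
    F.card ≤ Mnum (2 * t) (2 * k) * n ^ (n - t) * (3 * k) ^ n := by
  classical
  have hs' : ∀ G : SimpleGraph (Fin n), ∃ σ : Equiv.Perm (Fin n), G ∈ F →
      ∀ a b, G.Adj a b ↔ (pathGraph n).Adj (σ a) (σ b) := by
    intro G
    by_cases hG : G ∈ F
    · obtain ⟨σ, hσ⟩ := hham G hG
      exact ⟨σ, fun _ => hσ⟩
    · exact ⟨1, fun h => absurd h hG⟩
  choose s hs using hs'
  let key1 : SimpleGraph (Fin n) → (Fin n → Fin (3 * k)) := fun G v =>
    ⟨(s G v).val % (3 * k), Nat.mod_lt _ (by omega)⟩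
  have hcard1 : (Finset.univ : Finset (Fin n → Fin (3 * k))).card = (3 * k) ^ n := by simp
  rw [← hcard1]
  refine Finset.card_le_mul_card_image_of_maps_to (f := key1) (fun _ _ => Finset.mem_univ _) _ ?_
  intro φ _
  rcases (F.filter (fun G => key1 G = φ)).eq_empty_or_nonempty with h0 | ⟨G₀, hG₀⟩
  · rw [h0]; simp
  let key2 : SimpleGraph (Fin n) → ({v : Fin n // ¬ k ∣ (s G₀ v).val + 1} → Fin n) := fun G v =>
    rotP (s G) v
  have hcard2 : (Finset.univ : Finset ({v : Fin n // ¬ k ∣ (s G₀ v).val + 1} → Fin n)).card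
      = n ^ (n - t) := by
    rw [Finset.card_univ, Fintype.card_fun, Fintype.card_subtype_compl, Fintype.card_fin,
      Fintype.card_subtype, card_ends hk hn]
  rw [← hcard2]
  refine Finset.card_le_mul_card_image_of_maps_to (f := key2) (fun _ _ => Finset.mem_univ _) _ ?_
  intro ψ _
  rcases ((F.filter (fun G => key1 G = φ)).filter (fun G => key2 G = ψ)).eq_empty_or_nonempty
    with h0 | ⟨G₁, hG₁⟩
  · rw [h0]; simp
  simp only [Finset.mem_filter] at hG₀ hG₁
  have hk1 : ∀ G G', key1 G = φ → key1 G' = φ →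
      ∀ v, (s G v).val % (3 * k) = (s G' v).val % (3 * k) := by
    intro G G' h h' v
    have := congrFun (h.trans h'.symm) v
    exact congrArg Fin.val this
  refine fiber_bound hk hn s _ ?_ ?_ (s G₁) ?_ ?_
  · intro G hG
    simp only [Finset.mem_filter] at hG
    exact hs G hG.1.1
  · intro A hA B hB
    simp only [Finset.mem_filter] at hA hB
    exact hF _ hA.1.1 _ hB.1.1
  · intro G hG
    simp only [Finset.mem_filter] at hG
    exact hk1 _ _ hG.1.2 hG₁.1.2
  · intro G hG v hv
    simp only [Finset.mem_filter] at hG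
    have hv' : ¬ k ∣ (s G₀ v).val + 1 := by
      rwa [dvd_of_mod_eq (hk1 _ _ hG₀.2 hG₁.1.2 v) 1]
    exact congrFun (hG.2.trans hG₁.2.symm) ⟨v, hv'⟩

lemma Hnum_bound {n k t : ℕ} (hk : 2 ≤ k) (hn : n = k * t) :
    Hnum n (2 * k) ≤ Mnum (2 * t) (2 * k) * n ^ (n - t) * (3 * k) ^ n := by
  apply csSup_le
  · exact ⟨0, ∅, by simp⟩
  · rintro _ ⟨F, rfl, h1, h2⟩
    exact family_bound hk hn F h1 h2

/-- Lemma relating `H(n,2k)` and `M(2n/k,2k)`: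
`n^(-(1 - 1/k)n - o(n)) H(n,2k) ≤ M(2n/k, 2k)`. -/
theorem stmt_9 (k : ℕ) (hk : 2 ≤ k) (ε : ℝ) (hε : 0 < ε) :
    ∃ N : ℕ, ∀ n : ℕ, N ≤ n → ∀ m : ℕ, 2 * n = k * m → Even m →
      (Hnum n (2 * k) : ℝ) ≤
        (n : ℝ) ^ ((1 - 1 / (k : ℝ) + ε) * n) * (Mnum m (2 * k) : ℝ) := by
  obtain ⟨N, hN⟩ : ∃ N : ℕ, ∀ n : ℕ, N ≤ n → ((3 * k : ℕ) : ℝ) ≤ (n : ℝ) ^ ε := by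
    have h := (tendsto_rpow_atTop hε).comp (tendsto_natCast_atTop_atTop (R := ℝ))
    have h2 := h.eventually_ge_atTop ((3 * k : ℕ) : ℝ)
    exact Filter.eventually_atTop.1 h2
  refine ⟨N + 1, ?_⟩
  intro n hn m hm hev
  obtain ⟨t, rfl⟩ := hev
  have hnt : n = k * t := by nlinarith
  have hb := Hnum_bound hk hnt
  have hnpos : (0 : ℝ) < n := by exact_mod_cast (by omega : 0 < n)
  have hkpos : (0 : ℝ) < k := by exact_mod_cast (by omega : 0 < k)
  have htn : t ≤ n := by rw [hnt]; exact Nat.le_mul_of_pos_left _ (by omega)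
  rw [← two_mul]
  have e1 : (n : ℝ) ^ ((1 - 1 / (k : ℝ) + ε) * n) = (n : ℝ) ^ (n - t) * ((n : ℝ) ^ ε) ^ n := by
    have : (1 - 1 / (k : ℝ) + ε) * n = ((n - t : ℕ) : ℝ) + ε * (n : ℕ) := by
      rw [Nat.cast_sub htn]
      have : (n : ℝ) = k * t := by exact_mod_cast hnt
      have h3 : 1 / (k : ℝ) * n = t := by rw [this]; field_simp
      linear_combination -h3
    rw [this, Real.rpow_add hnpos, Real.rpow_natCast, Real.rpow_mul hnpos.le, Real.rpow_natCast]
  rw [e1]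
  calc (Hnum n (2 * k) : ℝ)
      ≤ (Mnum (2 * t) (2 * k) : ℝ) * (n : ℝ) ^ (n - t) * ((3 * k : ℕ) : ℝ) ^ n := by
        exact_mod_cast hb
    _ ≤ (Mnum (2 * t) (2 * k) : ℝ) * (n : ℝ) ^ (n - t) * ((n : ℝ) ^ ε) ^ n := by
        gcongr
        exact hN n (by omega)
    _ = _ := by ring
end

section
/- Let G be a bipartite simple graph whose two parts each have size m ≥ 1, and suppose G is r-regular with 1 ≤ r ≤ m. Then the number of perfect matchings of G is at least (r^m · m!)/m^m. -/
open SimpleGraph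

structure VdW.Good {n : ℕ} (p : MvPolynomial (Fin n) ℝ) : Prop where
  hom : p.IsHomogeneous n
  nonneg : ∀ d, 0 ≤ p.coeff d
  stable : ∀ z : Fin n → ℂ, (∀ j, 0 < (z j).re) → MvPolynomial.aeval z p ≠ 0

namespace VdW

open MvPolynomial

lemma aeval_smul_hom {n m : ℕ} {p : MvPolynomial (Fin n) ℝ} (hp : p.IsHomogeneous m)
    (c : ℂ) (z : Fin n → ℂ) :
    aeval (fun j => c * z j) p = c ^ m * aeval z p := by
  rw [aeval_def, aeval_def, eval₂_eq', eval₂_eq', Finset.mul_sum]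
  refine Finset.sum_congr rfl fun d hd => ?_
  have h := hp.degree_eq_sum_deg_support hd
  have h2 : ∑ i, d i = m := by
    rw [h]
    symm
    apply Finset.sum_subset (Finset.subset_univ _)
    intro x _ hx
    simpa using hx
  simp only [mul_pow, Finset.prod_mul_distrib, Finset.prod_pow_eq_pow_sum, h2]
  ring

lemma aeval_cons {S : Type*} [CommRing S] [Algebra ℝ S] {n : ℕ}
    (p : MvPolynomial (Fin (n + 1)) ℝ) (t : S) (y : Fin n → S) :
    aeval (Fin.cons t y : Fin (n + 1) → S) p =
      ((finSuccEquiv ℝ n p).map (aeval y : MvPolynomial (Fin n) ℝ →ₐ[ℝ] S).toRingHom).eval t := by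
  induction p using MvPolynomial.induction_on with
  | C a => simp [finSuccEquiv_apply]
  | add p q hp hq => simp [hp, hq]
  | mul_X p i hp =>
    rw [map_mul, hp, map_mul, Polynomial.map_mul, Polynomial.eval_mul]
    congr 1
    refine Fin.cases ?_ (fun j => ?_) i
    · simp [finSuccEquiv_X_zero]
    · simp [finSuccEquiv_X_succ]

lemma aeval_ofReal {n : ℕ} (p : MvPolynomial (Fin n) ℝ) (x : Fin n → ℝ) :
    aeval (fun j => (x j : ℂ)) p = ((eval x p : ℝ) : ℂ) := by
  have := MvPolynomial.aeval_algebraMap_apply (A := ℝ) ℂ x p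
  exact this

lemma eval_nonneg' {n : ℕ} {p : MvPolynomial (Fin n) ℝ} (hp : ∀ d, 0 ≤ p.coeff d)
    (x : Fin n → ℝ) (hx : ∀ j, 0 < x j) : 0 ≤ eval x p := by
  rw [eval_eq']
  exact Finset.sum_nonneg fun d _ => mul_nonneg (hp d)
    (Finset.prod_nonneg fun i _ => pow_nonneg (hx i).le _)

lemma eval_pos' {n : ℕ} {p : MvPolynomial (Fin n) ℝ} (hp : ∀ d, 0 ≤ p.coeff d) (h0 : p ≠ 0)
    (x : Fin n → ℝ) (hx : ∀ j, 0 < x j) : 0 < eval x p := by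
  rw [eval_eq']
  refine Finset.sum_pos (fun d hd => mul_pos (lt_of_le_of_ne (hp d) ?_)
    (Finset.prod_pos fun i _ => pow_pos (hx i) _)) ?_
  · exact (mem_support_iff.1 hd).symm
  · simpa using h0

/-- Roots rotated into the half-plane are impossible. -/
lemma Good.rot {n : ℕ} {p : MvPolynomial (Fin n) ℝ} (hp : Good p) (z : Fin n → ℂ) (c : ℂ)
    (h : ∀ j, 0 < (c * z j).re) : aeval z p ≠ 0 := by
  intro h0
  apply hp.stable _ h
  rw [aeval_smul_hom hp.hom, h0, mul_zero]

lemma Good.abs_ge {n : ℕ} {p : MvPolynomial (Fin n) ℝ} (hp : Good p) (z : Fin n → ℂ)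
    (hz : ∀ j, 0 < (z j).re) : eval (fun j => (z j).re) p ≤ ‖aeval z p‖ := by
  let h : Polynomial ℂ := aeval (fun j => Polynomial.C ((z j).re : ℂ) +
    Polynomial.X * Polynomial.C ((z j).im : ℂ)) p
  have hev : ∀ s : ℂ, h.eval s = aeval (fun j => ((z j).re : ℂ) + s * ((z j).im : ℂ)) p := by
    intro s
    have e : ((Polynomial.aeval s).restrictScalars ℝ : Polynomial ℂ →ₐ[ℝ] ℂ) h = h.eval s := by
      simp [Polynomial.aeval_def, Polynomial.eval₂_eq_eval_map]
    rw [← e, ← AlgHom.comp_apply]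
    congr 1
    apply MvPolynomial.algHom_ext
    intro i
    simp only [AlgHom.comp_apply, aeval_X]
    simp
    ring
  have hroots : ∀ s ∈ h.roots, s.im = 0 := by
    intro s hs
    by_contra him
    have h0 : h.eval s = 0 := Polynomial.isRoot_of_mem_roots hs
    rw [hev] at h0
    refine hp.rot _ (Complex.I * (starRingEnd ℂ s) / (s.im : ℂ)) ?_ h0
    intro j
    have : (Complex.I * (starRingEnd ℂ s) / (s.im : ℂ) * (((z j).re : ℂ) + s * ((z j).im : ℂ))).re
        = (z j).re := by
      rw [div_mul_eq_mul_div, Complex.div_ofReal_re]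
      simp
      field_simp
      ring
    rw [this]
    exact hz j
  have e1 : aeval z p = h.eval Complex.I := by
    rw [hev]; congr 2; funext j
    apply Complex.ext <;> simp
  have e0 : ((eval (fun j => (z j).re) p : ℝ) : ℂ) = h.eval 0 := by
    rw [hev, ← aeval_ofReal]; simp
  have e0' : eval (fun j => (z j).re) p = ‖h.eval 0‖ := by
    rw [← e0, Complex.norm_real, Real.norm_of_nonneg (eval_nonneg' hp.nonneg _ hz)]
  rw [e0', e1, (IsAlgClosed.splits h).eval_eq_prod_roots, (IsAlgClosed.splits h).eval_eq_prod_roots,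
    norm_mul, norm_mul]
  refine mul_le_mul_of_nonneg_left ?_ (norm_nonneg _)
  generalize h.roots = s at hroots
  induction s using Multiset.induction with
  | empty => simp
  | cons a s ih =>
    simp only [Multiset.map_cons, Multiset.prod_cons, norm_mul]
    refine mul_le_mul ?_ (ih fun x hx => hroots x (Multiset.mem_cons_of_mem hx)) (norm_nonneg _)
      (norm_nonneg _)
    have := hroots a (Multiset.mem_cons_self a s)
    rw [Complex.norm_def, Complex.norm_def]
    apply Real.sqrt_le_sqrt
    simp [Complex.normSq_apply, this]

lemma multiset_bound (k : ℕ) (hk : 1 ≤ k) (t : ℝ) (ht : 0 < t) (s : Multiset ℂ)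
    (hs : ∀ a ∈ s, a.im = 0 ∧ a.re < 0) :
    ‖(s.map fun a => (t : ℂ) - a).prod‖ ≤ ‖(s.map fun a => (0 : ℂ) - a).prod‖ *
      ((((k : ℝ) + 1) / k) ^ (Multiset.card s) *
        Real.exp ((s.map fun a => 1 / ((0 : ℂ) - a)).sum.re * t / (((k : ℝ) + 1) / k)
          - (Multiset.card s) / ((k : ℝ) + 1))) := by
  induction s using Multiset.induction with
  | empty => simp
  | cons a s ih =>
    have ih := ih fun x hx => hs x (Multiset.mem_cons_of_mem hx)
    obtain ⟨h1, h2⟩ := hs a (Multiset.mem_cons_self a s)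
    have hk' : (0 : ℝ) < k := by exact_mod_cast hk
    set K : ℝ := ((k : ℝ) + 1) / k with hK
    have hKpos : 0 < K := by positivity
    obtain ⟨b, hb, rfl⟩ : ∃ b : ℝ, 0 < b ∧ a = ((-b : ℝ) : ℂ) :=
      ⟨-a.re, by linarith, by apply Complex.ext <;> simp [h1]⟩
    simp only [Multiset.map_cons, Multiset.prod_cons, norm_mul, Multiset.card_cons,
      Multiset.sum_cons, Complex.add_re]
    have n1 : ‖(t : ℂ) - ((-b : ℝ) : ℂ)‖ = t + b := by
      rw [← Complex.ofReal_sub, Complex.norm_real, Real.norm_of_nonneg (by linarith)]; ring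
    have n2 : ‖(0 : ℂ) - ((-b : ℝ) : ℂ)‖ = b := by
      rw [← Complex.ofReal_zero, ← Complex.ofReal_sub, Complex.norm_real,
        Real.norm_of_nonneg (by linarith)]; ring
    have n3 : (1 / ((0 : ℂ) - ((-b : ℝ) : ℂ))).re = 1 / b := by
      rw [← Complex.ofReal_zero, ← Complex.ofReal_sub, ← Complex.ofReal_one, ← Complex.ofReal_div,
        Complex.ofReal_re]; simp
    rw [n1, n2, n3]
    have key : t + b ≤ b * (K * Real.exp (1 / b * t / K - 1 / ((k : ℝ) + 1))) := by
      have := Real.add_one_le_exp (1 / b * t / K - 1 / ((k : ℝ) + 1))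
      have e : t + b = b * (K * (1 / b * t / K - 1 / ((k : ℝ) + 1) + 1)) := by
        rw [hK]; field_simp; ring
      rw [e]
      gcongr
    calc _ ≤ _ := mul_le_mul key ih (norm_nonneg _) (by positivity)
      _ = _ := by
        rw [show (1 / b + (Multiset.map (fun a => 1 / ((0 : ℂ) - a)) s).sum.re) * t / K -
          ((Multiset.card s + 1 : ℕ) : ℝ) / ((k : ℝ) + 1) = (1 / b * t / K - 1 / ((k : ℝ) + 1)) +
          ((Multiset.map (fun a => 1 / ((0 : ℂ) - a)) s).sum.re * t / K -
            (Multiset.card s : ℝ) / ((k : ℝ) + 1)) by push_cast; ring, Real.exp_add, pow_succ]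
        ring

lemma univ_bound (k : ℕ) (R : Polynomial ℝ) (hdeg : R.natDegree ≤ k + 1) (h0 : 0 ≤ R.coeff 0)
    (hroots : ∀ z : ℂ, (R.map Complex.ofRealHom).eval z = 0 → z = 0 ∨ (z.im = 0 ∧ z.re < 0))
    (A : ℝ) (hA : 0 < A) (hR : ∀ t : ℝ, 0 < t → A * t ≤ R.eval t) :
    A ≤ R.coeff 1 * (((k : ℝ) + 1) / k) ^ k := by
  rcases Nat.eq_zero_or_pos k with rfl | hk
  · -- linear
    simp only [pow_zero, mul_one]
    by_contra hlt
    push Not at hlt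
    have hd : R.natDegree < 2 := by omega
    have := hR ((R.coeff 0 + 1) / (A - R.coeff 1)) (div_pos (by linarith) (by linarith))
    rw [Polynomial.eval_eq_sum_range' hd] at this
    simp only [Finset.sum_range_succ, Finset.sum_range_zero, pow_zero, pow_one] at this
    have h3 : (A - R.coeff 1) * ((R.coeff 0 + 1) / (A - R.coeff 1)) = R.coeff 0 + 1 :=
      mul_div_cancel₀ _ (by linarith)
    nlinarith
  have hk' : (0 : ℝ) < k := by exact_mod_cast hk
  set K : ℝ := ((k : ℝ) + 1) / k with hK
  have hKpos : 0 < K := by positivity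
  have hK1 : 1 ≤ K := by rw [hK, le_div_iff₀ hk']; linarith
  rcases h0.eq_or_lt with h0 | h0
  · -- zero constant coefficient
    have hA1 : A ≤ R.coeff 1 := by
      have hX : R = Polynomial.X * R.divX := by
        conv_lhs => rw [← Polynomial.X_mul_divX_add R, ← h0]
        simp
      have hc : R.coeff 1 = R.divX.eval 0 := by
        rw [← Polynomial.coeff_zero_eq_eval_zero, Polynomial.coeff_divX]
      rw [hc]
      have ht : Filter.Tendsto (fun t => R.divX.eval t) (nhdsWithin 0 (Set.Ioi 0))
          (nhds (R.divX.eval 0)) :=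
        (R.divX.continuous.tendsto 0).mono_left nhdsWithin_le_nhds
      refine ge_of_tendsto ht ?_
      filter_upwards [self_mem_nhdsWithin] with t ht
      have ht : 0 < t := ht
      have := hR t ht
      rw [hX, Polynomial.eval_mul, Polynomial.eval_X] at this
      nlinarith
    calc A ≤ R.coeff 1 := hA1
      _ ≤ _ := le_mul_of_one_le_right (by linarith) (one_le_pow₀ hK1)
  set f := R.map Complex.ofRealHom with hf
  have hf0 : f.eval 0 = (R.coeff 0 : ℂ) := by
    rw [← Polynomial.coeff_zero_eq_eval_zero, hf, Polynomial.coeff_map]; rfl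
  have hfne : f.eval 0 ≠ 0 := by rw [hf0]; exact_mod_cast h0.ne'
  have hft : ∀ t : ℝ, f.eval (t : ℂ) = ((R.eval t : ℝ) : ℂ) := by
    intro t
    rw [hf]
    exact Polynomial.eval_map_apply (f := Complex.ofRealHom) (p := R) t
  have hf' : f.derivative.eval 0 = (R.coeff 1 : ℂ) := by
    rw [← Polynomial.coeff_zero_eq_eval_zero, Polynomial.coeff_derivative, hf, Polynomial.coeff_map]
    simp
  have hsum := (IsAlgClosed.splits f).eval_derivative_div_eval_of_ne_zero hfne
  rw [hf', hf0, ← Complex.ofReal_div] at hsum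
  have hr : ∀ a ∈ f.roots, a.im = 0 ∧ a.re < 0 := by
    intro a ha
    have ha0 : f.eval a = 0 := Polynomial.isRoot_of_mem_roots ha
    rcases hroots a ha0 with rfl | h
    · exact absurd ha0 hfne
    · exact h
  set S := R.coeff 1 / R.coeff 0 with hS
  have hbound : ∀ t : ℝ, 0 < t → R.eval t ≤ R.coeff 0 *
      (K ^ (Multiset.card f.roots) * Real.exp (S * t / K - (Multiset.card f.roots) / ((k : ℝ) + 1))) := by
    intro t ht
    have hb := multiset_bound k hk t ht f.roots hr
    rw [← hsum, Complex.ofReal_re] at hb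
    have e1 : ‖f.eval (t : ℂ)‖ = R.eval t := by
      rw [hft, Complex.norm_real, Real.norm_of_nonneg]
      exact le_trans (by positivity) (hR t ht)
    have e2 : ‖f.eval 0‖ = R.coeff 0 := by
      rw [hf0, Complex.norm_real, Real.norm_of_nonneg h0.le]
    rw [← e1, ← e2, (IsAlgClosed.splits f).eval_eq_prod_roots, (IsAlgClosed.splits f).eval_eq_prod_roots,
      norm_mul, norm_mul, mul_assoc]
    exact mul_le_mul_of_nonneg_left hb (norm_nonneg _)
  have hcard : Multiset.card f.roots ≤ k + 1 :=
    (Polynomial.card_roots' f).trans (Polynomial.natDegree_map_le.trans hdeg)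
  set d := Multiset.card f.roots with hd
  have hSpos : 0 < S := by
    by_contra hneg
    push Not at hneg
    set B := R.coeff 0 * (K ^ d * Real.exp 0) with hB
    have hBpos : 0 < B := by positivity
    have h1 := hR ((B + 1) / A) (by positivity)
    have h2 := hbound ((B + 1) / A) (by positivity)
    rw [mul_div_cancel₀ _ hA.ne'] at h1
    have h3 : R.coeff 0 * (K ^ d * Real.exp (S * ((B + 1) / A) / K - d / ((k : ℝ) + 1))) ≤ B := by
      rw [hB]
      gcongr
      rw [← hB]
      have : S * ((B + 1) / A) / K ≤ 0 :=
        div_nonpos_of_nonpos_of_nonneg (mul_nonpos_of_nonpos_of_nonneg hneg (by positivity)) hKpos.le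
      have : 0 ≤ (d : ℝ) / ((k : ℝ) + 1) := by positivity
      linarith
    linarith
  have h1 := hR (K / S) (by positivity)
  have h2 := hbound (K / S) (by positivity)
  have e3 : S * (K / S) / K - d / ((k : ℝ) + 1) = ((k + 1 - d : ℕ) : ℝ) * (1 / ((k : ℝ) + 1)) := by
    rw [Nat.cast_sub hcard]
    field_simp
    push_cast; ring
  have e4 : Real.exp (1 / ((k : ℝ) + 1)) ≤ K := by
    have h := Real.add_one_le_exp (-(1 / ((k : ℝ) + 1)))
    rw [Real.exp_neg] at h
    have h' : -(1 / ((k : ℝ) + 1)) + 1 = K⁻¹ := by rw [hK]; field_simp; ring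
    rw [h'] at h
    exact (inv_le_inv₀ hKpos (Real.exp_pos _)).1 h
  rw [e3, Real.exp_nat_mul] at h2
  have h5 : K ^ d * Real.exp (1 / ((k : ℝ) + 1)) ^ (k + 1 - d) ≤ K ^ (k + 1) := by
    calc _ ≤ K ^ d * K ^ (k + 1 - d) := by gcongr
      _ = _ := by rw [← pow_add]; congr 1; omega
  have h6 : A * (K / S) ≤ R.coeff 0 * K ^ (k + 1) :=
    h1.trans (h2.trans (mul_le_mul_of_nonneg_left h5 h0.le))
  have h7 : R.coeff 1 = S * R.coeff 0 := by rw [hS]; field_simp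
  rw [h7]
  have h8 : A * K ≤ R.coeff 0 * K ^ (k + 1) * S := by
    rw [← mul_div_assoc, div_le_iff₀ hSpos] at h6; exact h6
  rw [pow_succ] at h8
  nlinarith

lemma map_coeff {S : Type*} [CommRing S] [Algebra ℝ S] {n : ℕ}
    (p : MvPolynomial (Fin (n + 1)) ℝ) (y : Fin n → S) (i : ℕ) :
    ((finSuccEquiv ℝ n p).map (aeval y : MvPolynomial (Fin n) ℝ →ₐ[ℝ] S).toRingHom).coeff i
      = aeval y ((finSuccEquiv ℝ n p).coeff i) := by
  rw [Polynomial.coeff_map]; rfl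

lemma coeff_nonneg {n : ℕ} {p : MvPolynomial (Fin (n + 1)) ℝ} (hp : Good p) (i : ℕ) (d) :
    0 ≤ ((finSuccEquiv ℝ n p).coeff i).coeff d := by
  rw [finSuccEquiv_coeff_coeff]; exact hp.nonneg _

lemma linear_le {n : ℕ} {p : MvPolynomial (Fin (n + 1)) ℝ} (hp : Good p) (x : Fin n → ℝ)
    (hx : ∀ j, 0 < x j) (t : ℝ) (ht : 0 < t) :
    eval x ((finSuccEquiv ℝ n p).coeff 1) * t ≤ eval (Fin.cons t x : Fin (n + 1) → ℝ) p := by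
  have h := aeval_cons p t x
  rw [MvPolynomial.aeval_eq_eval] at h
  change eval (Fin.cons t x : Fin (n + 1) → ℝ) p = _ at h
  rw [h, Polynomial.eval_eq_sum_range' (n := (Polynomial.natDegree ((finSuccEquiv ℝ n p).map
    (aeval x : MvPolynomial (Fin n) ℝ →ₐ[ℝ] ℝ).toRingHom)) + 2) (by omega)]
  have hnn : ∀ i, 0 ≤ aeval x ((finSuccEquiv ℝ n p).coeff i) := fun i =>
    eval_nonneg' (coeff_nonneg hp i) x hx
  have := Finset.single_le_sum (f := fun i => ((finSuccEquiv ℝ n p).map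
    (aeval x : MvPolynomial (Fin n) ℝ →ₐ[ℝ] ℝ).toRingHom).coeff i * t ^ i)
    (s := Finset.range (Polynomial.natDegree ((finSuccEquiv ℝ n p).map
    (aeval x : MvPolynomial (Fin n) ℝ →ₐ[ℝ] ℝ).toRingHom) + 2)) (a := 1) (fun i _ => by
      rw [map_coeff]; exact mul_nonneg (hnn i) (pow_nonneg ht.le _)) (by simp)
  refine le_trans (le_of_eq ?_) this
  simp only [pow_one]
  rw [map_coeff]; rfl

lemma Good.step {n : ℕ} {p : MvPolynomial (Fin (n + 1)) ℝ} (hp : Good p)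
    (hq : (finSuccEquiv ℝ n p).coeff 1 ≠ 0) : Good ((finSuccEquiv ℝ n p).coeff 1) := by
  refine ⟨hp.hom.finSuccEquiv_coeff_isHomogeneous 1 n (by omega), coeff_nonneg hp 1, ?_⟩
  intro y hy hy0
  set f := (finSuccEquiv ℝ n p).map (aeval y : MvPolynomial (Fin n) ℝ →ₐ[ℝ] ℂ).toRingHom with hf
  have hf1 : f.coeff 1 = 0 := by rw [hf, map_coeff, hy0]
  set δ := eval (fun j => (y j).re) ((finSuccEquiv ℝ n p).coeff 1) with hδ
  have hδpos : 0 < δ := eval_pos' (coeff_nonneg hp 1) hq _ hy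
  have hfev : ∀ t : ℂ, f.eval t = aeval (Fin.cons t y : Fin (n + 1) → ℂ) p :=
    fun t => (aeval_cons p t y).symm
  have hlow : ∀ t : ℝ, 0 < t → δ * t ≤ ‖f.eval (t : ℂ)‖ := by
    intro t ht
    rw [hfev]
    refine le_trans (linear_le hp _ hy t ht) (le_trans (le_of_eq ?_) (hp.abs_ge _ ?_))
    · congr 2
      funext j
      refine Fin.cases ?_ (fun i => ?_) j <;> simp
    · intro j
      refine Fin.cases ?_ (fun i => ?_) j
      · simpa using ht
      · simpa using hy i
  by_cases h0 : f.eval 0 = 0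
  · have hX : f = Polynomial.X * (Polynomial.X * f.divX.divX) := by
      have h1 := Polynomial.X_mul_divX_add f
      have h2 := Polynomial.X_mul_divX_add f.divX
      rw [Polynomial.coeff_zero_eq_eval_zero, h0] at h1
      rw [Polynomial.coeff_divX, zero_add, hf1] at h2
      simp only [map_zero, add_zero] at h1 h2
      rw [h2, h1]
    set g := f.divX.divX
    have hc : Continuous fun t : ℝ => t * ‖g.eval (t : ℂ)‖ :=
      continuous_id.mul ((g.continuous.comp Complex.continuous_ofReal).norm)
    have ht : Filter.Tendsto (fun t : ℝ => t * ‖g.eval (t : ℂ)‖) (nhdsWithin 0 (Set.Ioi 0))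
        (nhds (0 * ‖g.eval ((0 : ℝ) : ℂ)‖)) :=
      (hc.tendsto 0).mono_left nhdsWithin_le_nhds
    have : δ ≤ 0 * ‖g.eval ((0 : ℝ) : ℂ)‖ := by
      refine ge_of_tendsto ht ?_
      filter_upwards [self_mem_nhdsWithin] with t ht
      have ht : 0 < t := ht
      have h := hlow t ht
      rw [hX] at h
      simp only [Polynomial.eval_mul, Polynomial.eval_X, norm_mul, Complex.norm_real,
        Real.norm_of_nonneg ht.le] at h
      nlinarith
    linarith
  · have hr : ∀ a ∈ f.roots, a.re < 0 := by
      intro a ha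
      have ha0 : f.eval a = 0 := Polynomial.isRoot_of_mem_roots ha
      by_contra hre
      push Not at hre
      have hane : a ≠ 0 := by rintro rfl; exact h0 ha0
      have hev : ∀ᶠ ε : ℝ in nhdsWithin 0 (Set.Ioi 0), ∀ j, 0 < (y j).re + ε * a.im * (y j).im := by
        rw [Filter.eventually_all]
        intro j
        have hc : Continuous fun ε : ℝ => (y j).re + ε * a.im * (y j).im := by fun_prop
        have := (hc.tendsto 0).mono_left (nhdsWithin_le_nhds (s := Set.Ioi 0))
        exact this.eventually (lt_mem_nhds (by simpa using hy j))
      obtain ⟨ε, hε, hεpos⟩ := (hev.and self_mem_nhdsWithin).exists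
      have hεpos : 0 < ε := hεpos
      rw [hfev] at ha0
      refine hp.rot _ (1 - Complex.I * ((ε * a.im : ℝ) : ℂ)) ?_ ha0
      intro j
      refine Fin.cases ?_ (fun i => ?_) j
      · have : ((1 - Complex.I * ((ε * a.im : ℝ) : ℂ)) * a).re = a.re + ε * (a.im * a.im) := by
          simp; ring
        rw [Fin.cons_zero, this]
        by_cases him : a.im = 0
        · have : a.re ≠ 0 := fun h => hane (Complex.ext h him)
          have : 0 < a.re := lt_of_le_of_ne hre this.symm
          simpa [him] using this
        · have : 0 < a.im * a.im := mul_self_pos.2 him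
          positivity
      · have : ((1 - Complex.I * ((ε * a.im : ℝ) : ℂ)) * y i).re
            = (y i).re + ε * a.im * (y i).im := by
          simp
        rw [Fin.cons_succ, this]
        exact hε i
    have hsum := (IsAlgClosed.splits f).eval_derivative_div_eval_of_ne_zero h0
    have hd0 : f.derivative.eval 0 = 0 := by
      rw [← Polynomial.coeff_zero_eq_eval_zero, Polynomial.coeff_derivative]
      simp [hf1]
    rw [hd0, zero_div] at hsum
    have hempty : f.roots = 0 := by
      have key : ∀ s : Multiset ℂ, (∀ a ∈ s, a.re < 0) →
          0 ≤ (s.map fun z => 1 / ((0 : ℂ) - z)).sum.re ∧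
          (s ≠ 0 → 0 < (s.map fun z => 1 / ((0 : ℂ) - z)).sum.re) := by
        intro s
        induction s using Multiset.induction with
        | empty => simp
        | cons a s ih =>
          intro hs
          have ih := (ih fun x hx => hs x (Multiset.mem_cons_of_mem hx)).1
          have ha := hs a (Multiset.mem_cons_self a s)
          have hpos : 0 < (1 / ((0 : ℂ) - a)).re := by
            have hane : a ≠ 0 := by rintro rfl; simp at ha
            rw [one_div, Complex.inv_re]
            refine div_pos (by simpa using ha) (Complex.normSq_pos.2 (by simpa using hane))
          rw [Multiset.map_cons, Multiset.sum_cons, Complex.add_re]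
          exact ⟨by linarith, fun _ => by linarith⟩
      by_contra hne
      have := (key f.roots hr).2 hne
      rw [← hsum] at this
      simp at this
    have hdeg : f.natDegree = 0 := by
      rw [(IsAlgClosed.splits f).natDegree_eq_card_roots, hempty]; rfl
    have h := hlow ((‖f.eval 0‖ + 1) / δ) (by positivity)
    rw [mul_div_cancel₀ _ hδpos.ne', Polynomial.eq_C_of_natDegree_eq_zero hdeg] at h
    simp only [Polynomial.eval_C] at h
    linarith

lemma Good.cap_step {n : ℕ} {p : MvPolynomial (Fin (n + 1)) ℝ} (hp : Good p) (x : Fin n → ℝ)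
    (hx : ∀ j, 0 < x j) (A : ℝ) (hA : 0 < A)
    (h : ∀ t : ℝ, 0 < t → A * t ≤ eval (Fin.cons t x : Fin (n + 1) → ℝ) p) :
    A ≤ eval x ((finSuccEquiv ℝ n p).coeff 1) * (((n : ℝ) + 1) / n) ^ n := by
  set R := (finSuccEquiv ℝ n p).map (aeval x : MvPolynomial (Fin n) ℝ →ₐ[ℝ] ℝ).toRingHom with hR
  have hco : ∀ i, R.coeff i = eval x ((finSuccEquiv ℝ n p).coeff i) := fun i => by
    rw [hR, map_coeff]; rfl
  have hmap : R.map Complex.ofRealHom = (finSuccEquiv ℝ n p).map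
      (aeval (fun j => (x j : ℂ)) : MvPolynomial (Fin n) ℝ →ₐ[ℝ] ℂ).toRingHom := by
    rw [hR, Polynomial.map_map]
    congr 1
    apply RingHom.ext
    intro q
    exact (aeval_ofReal q x).symm
  rw [← hco]
  refine univ_bound n R ?_ ?_ ?_ A hA ?_
  · refine Polynomial.natDegree_map_le.trans ?_
    rw [natDegree_finSuccEquiv]
    exact (degreeOf_le_totalDegree _ _).trans hp.hom.totalDegree_le
  · rw [hco]; exact eval_nonneg' (coeff_nonneg hp 0) x hx
  · intro z hz
    rw [hmap, ← aeval_cons] at hz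
    by_contra hcon
    push Not at hcon
    obtain ⟨hz0, hz1⟩ := hcon
    by_cases him : z.im = 0
    · have h1 := hz1 him
      have : z.re ≠ 0 := fun h => hz0 (Complex.ext h him)
      have : 0 < z.re := lt_of_le_of_ne h1 this.symm
      refine hp.stable _ ?_ hz
      intro j
      refine Fin.cases ?_ (fun i => ?_) j
      · simpa using this
      · simpa using hx i
    · refine hp.rot _ (1 + Complex.I * (((z.re - 1) / z.im : ℝ) : ℂ)) ?_ hz
      intro j
      refine Fin.cases ?_ (fun i => ?_) j
      · have : ((1 + Complex.I * (((z.re - 1) / z.im : ℝ) : ℂ)) * z).re = 1 := by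
          rw [Complex.mul_re, Complex.add_re, Complex.add_im, Complex.re_mul_ofReal,
            Complex.im_mul_ofReal]
          simp
          field_simp
          ring
        rw [Fin.cons_zero, this]; exact one_pos
      · have : ((1 + Complex.I * (((z.re - 1) / z.im : ℝ) : ℂ)) * (x i : ℂ)).re = x i := by
          rw [Complex.re_mul_ofReal, Complex.add_re, Complex.re_mul_ofReal]; simp
        rw [Fin.cons_succ, this]; exact hx i
  · intro t ht
    have h2 := aeval_cons p t x
    rw [hR, ← h2]
    exact h t ht

lemma gurvits : ∀ (n : ℕ) (p : MvPolynomial (Fin n) ℝ) (_ : Good p) (C : ℝ) (_ : 0 < C)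
    (_ : ∀ x : Fin n → ℝ, (∀ j, 0 < x j) → C * ∏ j, x j ≤ eval x p),
    C * ((n.factorial : ℝ) / (n : ℝ) ^ n) ≤ p.coeff (Finsupp.equivFunOnFinite.symm fun _ => 1) := by
  intro n
  induction n with
  | zero =>
    intro p hp C hC h
    have := h (fun _ => 1) (by simp)
    rw [eq_C_of_isEmpty p] at this ⊢
    simp at this ⊢
    rwa [if_pos (Subsingleton.elim _ _)]
  | succ n ih =>
    intro p hp C hC h
    set q := (finSuccEquiv ℝ n p).coeff 1 with hq
    set K : ℝ := (((n : ℝ) + 1) / n) ^ n with hK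
    have hKpos : 0 < K := by
      rcases Nat.eq_zero_or_pos n with rfl | hn
      · simp [hK]
      · have : (0 : ℝ) < n := by exact_mod_cast hn
        positivity
    have hcap : ∀ x : Fin n → ℝ, (∀ j, 0 < x j) → C / K * ∏ j, x j ≤ eval x q := by
      intro x hx
      have := hp.cap_step x hx (C * ∏ j, x j) (mul_pos hC (Finset.prod_pos fun j _ => hx j)) (by
        intro t ht
        have := h (Fin.cons t x) (by
          intro j
          refine Fin.cases ?_ (fun i => ?_) j
          · simpa using ht
          · simpa using hx i)
        rw [Fin.prod_univ_succ] at this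
        simp only [Fin.cons_zero, Fin.cons_succ] at this
        linarith)
      rw [div_mul_eq_mul_div, div_le_iff₀ hKpos]
      exact this
    have hq0 : q ≠ 0 := by
      intro h0
      have := hcap (fun _ => 1) (by simp)
      rw [h0] at this
      simp at this
      have : 0 < C / K := by positivity
      linarith
    have := ih q (hp.step hq0) (C / K) (by positivity) hcap
    rw [hq, finSuccEquiv_coeff_coeff] at this
    have e : Finsupp.cons 1 (Finsupp.equivFunOnFinite.symm fun _ : Fin n => 1) =
        (Finsupp.equivFunOnFinite.symm fun _ : Fin (n + 1) => 1) := by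
      ext j
      refine Fin.cases ?_ (fun i => ?_) j <;> simp
    rw [e] at this
    refine le_trans (le_of_eq ?_) this
    have e2 : (((n + 1).factorial : ℕ) : ℝ) / ((n + 1 : ℕ) : ℝ) ^ (n + 1) * K =
        (n.factorial : ℝ) / (n : ℝ) ^ n := by
      rw [hK, Nat.factorial_succ, div_pow]
      rcases Nat.eq_zero_or_pos n with rfl | hn
      · simp
      · have : (0 : ℝ) < n := by exact_mod_cast hn
        push_cast
        field_simp
        ring
    rw [← e2]
    field_simp

lemma coeff_prod_nonneg {n : ℕ} {ι : Type*} (s : Finset ι) (f : ι → MvPolynomial (Fin n) ℝ)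
    (h : ∀ i ∈ s, ∀ d, 0 ≤ (f i).coeff d) : ∀ d, 0 ≤ (∏ i ∈ s, f i).coeff d := by
  classical
  induction s using Finset.induction_on with
  | empty =>
    intro d
    rw [Finset.prod_empty, coeff_one]
    split_ifs <;> norm_num
  | insert a s ha ih =>
    intro d
    rw [Finset.prod_insert ha, coeff_mul]
    exact Finset.sum_nonneg fun x _ => mul_nonneg (h a (Finset.mem_insert_self _ _) _)
      (ih (fun i hi => h i (Finset.mem_insert_of_mem hi)) _)

lemma good_prod {n : ℕ} (B : Fin n → Fin n → ℝ) (hB : ∀ i j, 0 ≤ B i j)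
    (hrow : ∀ i, 0 < ∑ j, B i j) : Good (∏ i, ∑ j, C (B i j) * X j) := by
  refine ⟨?_, ?_, ?_⟩
  · have := IsHomogeneous.prod Finset.univ (fun i : Fin n => ∑ j, C (B i j) * X j) (fun _ => 1)
      (fun i _ => IsHomogeneous.sum _ _ _ fun j _ => isHomogeneous_C_mul_X _ _)
    simpa using this
  · apply coeff_prod_nonneg
    intro i _ d
    rw [coeff_sum]
    refine Finset.sum_nonneg fun j _ => ?_
    rw [coeff_C_mul, coeff_X]
    split_ifs <;> simp [hB]
  · intro z hz
    rw [map_prod, Finset.prod_ne_zero_iff]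
    intro i _ h0
    have h1 : (∑ j, B i j * (z j).re) = 0 := by
      have := congrArg Complex.re h0
      simpa using this
    have h2 := (Finset.sum_eq_zero_iff_of_nonneg
      (fun j _ => mul_nonneg (hB i j) (hz j).le)).1 h1
    have : ∑ j, B i j = 0 := Finset.sum_eq_zero fun j hj => by
      rcases mul_eq_zero.1 (h2 j hj) with h | h
      · exact h
      · exact absurd h (hz j).ne'
    exact (hrow i).ne' this

lemma cap_prod {n : ℕ} (B : Fin n → Fin n → ℝ) (hB : ∀ i j, 0 ≤ B i j) (r : ℝ) (hr : 0 < r)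
    (hrow : ∀ i, ∑ j, B i j = r) (hcol : ∀ j, ∑ i, B i j = r) (x : Fin n → ℝ)
    (hx : ∀ j, 0 < x j) :
    r ^ n * ∏ j, x j ≤ eval x (∏ i, ∑ j, C (B i j) * X j) := by
  have h1 : ∀ i, ∏ j, x j ^ (B i j / r) ≤ ∑ j, B i j / r * x j := fun i =>
    Real.geom_mean_le_arith_mean_weighted Finset.univ (fun j => B i j / r) x
      (fun j _ => div_nonneg (hB i j) hr.le) (by rw [← Finset.sum_div, hrow, div_self hr.ne'])
      (fun j _ => (hx j).le)
  have h2 : ∏ j, x j = ∏ i, ∏ j, x j ^ (B i j / r) := by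
    rw [Finset.prod_comm]
    refine Finset.prod_congr rfl fun j _ => ?_
    rw [← Real.rpow_sum_of_pos (hx j), ← Finset.sum_div, hcol, div_self hr.ne', Real.rpow_one]
  have h3 : eval x (∏ i, ∑ j, C (B i j) * X j) = r ^ n * ∏ i, ∑ j, B i j / r * x j := by
    have : r ^ n = ∏ _i : Fin n, r := by simp
    rw [this, ← Finset.prod_mul_distrib, map_prod]
    refine Finset.prod_congr rfl fun i _ => ?_
    rw [map_sum, Finset.mul_sum]
    refine Finset.sum_congr rfl fun j _ => ?_
    simp
    field_simp
  rw [h3, h2]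
  refine mul_le_mul_of_nonneg_left ?_ (by positivity)
  exact Finset.prod_le_prod (fun i _ => Finset.prod_nonneg fun j _ =>
    Real.rpow_nonneg (hx j).le _) (fun i _ => h1 i)

lemma coeff_le_card {n : ℕ} (Adj : Fin n → Fin n → Prop) [∀ i j, Decidable (Adj i j)]
    [DecidablePred fun f : Fin n → Fin n => Function.Bijective f ∧ ∀ i, Adj i (f i)] :
    (∏ i, ∑ j, C (if Adj i j then (1 : ℝ) else 0) * X j :
      MvPolynomial (Fin n) ℝ).coeff (Finsupp.equivFunOnFinite.symm fun _ => 1) ≤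
    ((Finset.univ.filter fun f : Fin n → Fin n =>
      Function.Bijective f ∧ ∀ i, Adj i (f i)).card : ℝ) := by
  classical
  rw [Finset.prod_univ_sum, Fintype.piFinset_univ, coeff_sum, Finset.card_filter]
  push_cast
  refine Finset.sum_le_sum fun f _ => ?_
  have e : (∏ i, (C (if Adj i (f i) then (1 : ℝ) else 0) * X (f i)) : MvPolynomial (Fin n) ℝ) =
      monomial (∑ i, Finsupp.single (f i) 1) (∏ i, if Adj i (f i) then (1 : ℝ) else 0) := by
    rw [monomial_sum_index, map_prod, ← Finset.prod_mul_distrib]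
    rfl
  rw [e, coeff_monomial]
  by_cases h : Function.Bijective f ∧ ∀ i, Adj i (f i)
  · rw [if_pos h]
    split_ifs with h1
    · exact Finset.prod_le_one (fun i _ => by split_ifs <;> norm_num)
        (fun i _ => by split_ifs <;> norm_num)
    · norm_num
  · rw [if_neg h]
    split_ifs with h1
    · have hs : Function.Surjective f := by
        intro j
        by_contra hj
        push Not at hj
        have := DFunLike.congr_fun h1 j
        rw [Finsupp.finsetSum_apply, Finset.sum_eq_zero (fun i _ =>
          Finsupp.single_eq_of_ne' (hj i))] at this
        simp at this
      have hb : Function.Bijective f := Finite.surjective_iff_bijective.1 hs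
      have : ∃ i, ¬ Adj i (f i) := by
        by_contra hc
        push Not at hc
        exact h ⟨hb, hc⟩
      obtain ⟨i, hi⟩ := this
      exact le_of_eq (Finset.prod_eq_zero (Finset.mem_univ i) (if_neg hi))
    · exact le_rfl

/-- The matching graph of a map. -/
def matchGraph {m : ℕ} (f : Fin m → Fin m) : SimpleGraph (Fin m ⊕ Fin m) where
  Adj
    | Sum.inl i, Sum.inr j => f i = j
    | Sum.inr j, Sum.inl i => f i = j
    | _, _ => False
  symm := ⟨by rintro (a | a) (b | b) h <;> simpa using h⟩
  loopless := ⟨by rintro (a | a) h <;> simp at h⟩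

lemma matchGraph_pm {m : ℕ} (f : Fin m → Fin m) (hf : Function.Bijective f) :
    IsPMGraph (matchGraph f) := by
  rintro (i | j)
  · refine ⟨Sum.inr (f i), rfl, ?_⟩
    rintro (a | a) h
    · exact h.elim
    · exact congrArg _ (Eq.symm h)
  · obtain ⟨i, rfl⟩ := hf.2 j
    refine ⟨Sum.inl i, rfl, ?_⟩
    rintro (a | a) h
    · exact congrArg _ (hf.1 h)
    · exact h.elim

end VdW

/-- Consequence of the van der Waerden conjecture (Gyires–Egorychev–Falikman):
an `r`-regular bipartite graph with parts of size `m` has at least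
`r^m * m! / m^m` perfect matchings. -/
theorem stmt_13 (m r : ℕ) (hm : 1 ≤ m) (hr : 1 ≤ r) (hrm : r ≤ m)
    (G : SimpleGraph (Fin m ⊕ Fin m))
    (hbipL : ∀ i j, ¬G.Adj (Sum.inl i) (Sum.inl j))
    (hbipR : ∀ i j, ¬G.Adj (Sum.inr i) (Sum.inr j))
    (hreg : ∀ v, (G.neighborSet v).ncard = r) :
    ((r : ℝ) ^ m * (m.factorial : ℝ)) / (m : ℝ) ^ m ≤
      ({M : SimpleGraph (Fin m ⊕ Fin m) | M ≤ G ∧ IsPMGraph M}.ncard : ℝ) := by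
  classical
  have hr0 : (0 : ℝ) < r := by exact_mod_cast hr
  set B : Fin m → Fin m → ℝ := fun i j => if G.Adj (Sum.inl i) (Sum.inr j) then (1 : ℝ) else 0
    with hBdef
  have hB : ∀ i j, 0 ≤ B i j := fun i j => by simp only [hBdef]; split_ifs <;> norm_num
  have hrow : ∀ i, ∑ j, B i j = r := by
    intro i
    have h := hreg (Sum.inl i)
    have e : G.neighborSet (Sum.inl i) = ((Finset.univ.filter fun j : Fin m =>
        G.Adj (Sum.inl i) (Sum.inr j)).image Sum.inr : Finset (Fin m ⊕ Fin m)) := by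
      ext (a | a)
      · simp [hbipL]
      · simp
    rw [e, Set.ncard_coe_finset, Finset.card_image_of_injective _ Sum.inr_injective] at h
    simp only [hBdef]
    rw [Finset.sum_boole, h]
  have hcol : ∀ j, ∑ i, B i j = r := by
    intro j
    have h := hreg (Sum.inr j)
    have e : G.neighborSet (Sum.inr j) = ((Finset.univ.filter fun i : Fin m =>
        G.Adj (Sum.inl i) (Sum.inr j)).image Sum.inl : Finset (Fin m ⊕ Fin m)) := by
      ext (a | a)
      · simp [G.adj_comm (Sum.inr j)]
      · simp [hbipR]
    rw [e, Set.ncard_coe_finset, Finset.card_image_of_injective _ Sum.inl_injective] at h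
    simp only [hBdef]
    rw [Finset.sum_boole, h]
  have h1 := VdW.gurvits m _ (VdW.good_prod B hB (fun i => by rw [hrow]; exact hr0)) ((r : ℝ) ^ m)
    (by positivity) (VdW.cap_prod B hB r hr0 hrow hcol)
  have h2 := h1.trans (VdW.coeff_le_card fun i j => G.Adj (Sum.inl i) (Sum.inr j))
  rw [← mul_div_assoc] at h2
  refine h2.trans ?_
  rw [Nat.cast_le, ← Set.ncard_coe_finset]
  refine Set.ncard_le_ncard_of_injOn VdW.matchGraph ?_ ?_ (Set.toFinite _)
  · intro f hf
    simp only [Finset.coe_filter, Finset.mem_univ, true_and, Set.mem_ofPred_eq] at hf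
    refine ⟨?_, VdW.matchGraph_pm f hf.1⟩
    rintro (a | a) (b | b) h
    · exact h.elim
    · have h : f a = b := h
      rw [← h]; exact hf.2 a
    · have h : f b = a := h
      rw [← h]; exact (hf.2 b).symm
    · exact h.elim
  · intro f _ g _ hfg
    funext i
    have h : (VdW.matchGraph f).Adj (Sum.inl i) (Sum.inr (f i)) := rfl
    rw [hfg] at h
    exact Eq.symm h
end

section
/- For every ε > 0 there exists N such that for all even n ≥ N, M(n,4) ≤ n^{(1/4 + ε)n}. -/
open SimpleGraph

namespace CFour

section Core
variable {α β : Type} [Fintype α] [Fintype β] [DecidableEq α] [DecidableEq β]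

/-- Two bijections seen as bipartite perfect matchings whose union has a 4-cycle. -/
def Crossing (f g : α ≃ β) : Prop := ∃ i j, i ≠ j ∧ f i = g j ∧ f j = g i

open Classical in
theorem fam_bound (E : α → β → Prop)
    (hE : ∀ i j b c, i ≠ j → b ≠ c → E i b → E i c → E j b → E j c → False)
    (H : Finset (α ≃ β)) (hH : ∀ f ∈ H, ∀ g ∈ H, f ≠ g → Crossing f g) (W : Finset α) :
    H.card * (Finset.univ.filter (fun f : α ≃ β => ∀ i, i ∉ W → E i (f i))).card
      ≤ (Fintype.card β).factorial * (Fintype.card β) ^ W.card := by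
  rw [← Finset.card_product]
  have h1 : (Finset.univ : Finset (Equiv.Perm β × (W → β))).card
      = (Fintype.card β).factorial * (Fintype.card β) ^ W.card := by
    rw [Finset.card_univ, Fintype.card_prod, Fintype.card_perm, Fintype.card_fun,
      Fintype.card_coe]
  rw [← h1]
  apply Finset.card_le_card_of_injOn
    (fun q : (α ≃ β) × (α ≃ β) => ((q.1.symm.trans q.2 : Equiv.Perm β), fun i : W => q.2 i))
  · intro x _
    simp
  · rintro ⟨f1, g1⟩ hx ⟨f2, g2⟩ hy hxy
    simp only [Finset.coe_product, Set.mem_prod, Finset.mem_coe, Finset.mem_filter,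
      Finset.mem_univ, true_and] at hx hy
    simp only [Prod.mk.injEq] at hxy
    obtain ⟨ht, hw⟩ := hxy
    have hw' : ∀ i ∈ W, g1 i = g2 i := fun i hi => congrFun hw ⟨i, hi⟩
    have ht' : ∀ i j, f1 i = f2 j → g1 i = g2 j := by
      intro i j hij
      have := Equiv.congr_fun ht (f1 i)
      rw [Equiv.trans_apply, Equiv.trans_apply, Equiv.symm_apply_apply, hij,
        Equiv.symm_apply_apply] at this
      exact this
    by_cases hf : f1 = f2
    · subst hf
      have : g1 = g2 := Equiv.ext fun i => ht' i i rfl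
      rw [this]
    · exfalso
      obtain ⟨i, j, hne, h12, h21⟩ := hH f1 hx.1 f2 hy.1 hf
      have a1 := ht' i j h12
      have a2 := ht' j i h21
      have hg : g1 i ≠ g1 j := fun h => hne (g1.injective h)
      have hi : i ∉ W := fun hi => hg (by rw [hw' i hi, a2])
      have hj : j ∉ W := fun hj => hg (by rw [hw' j hj, a1])
      exact hE i j (g1 i) (g1 j) hne hg (hx.2 i hi) (a2 ▸ hy.2 i hi) (a1 ▸ hy.2 j hj) (hx.2 j hj)

open Classical in
theorem greedy (E : α → β → Prop) (s : ℕ) (D : ℝ) (hD : 0 ≤ D)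
    (hcard : Fintype.card α = Fintype.card β)
    (hgood : ∀ (T : Finset α) (S : Finset β), T.card = S.card → s ≤ T.card →
      ∃ i ∈ T, D ≤ ((S.filter (fun b => E i b)).card : ℝ)) (d : ℕ) :
    ∀ (U : Finset α) (f0 : α ≃ β), U.card + d + s = Fintype.card α → (∀ i ∈ U, E i (f0 i)) →
      D ^ d ≤ ((Finset.univ.filter (fun f : α ≃ β => (∀ i ∈ U, f i = f0 i) ∧
        ∃ W : Finset α, W.card = s ∧ ∀ i, i ∉ W → E i (f i))).card : ℝ) := by
  induction d with
  | zero =>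
    intro U f0 hU hf
    rw [pow_zero, Nat.one_le_cast, Nat.one_le_iff_ne_zero, Finset.card_ne_zero]
    refine ⟨f0, ?_⟩
    simp only [Finset.mem_filter, Finset.mem_univ, true_and]
    refine ⟨fun _ _ => trivial, Uᶜ, ?_, ?_⟩
    · rw [Finset.card_compl]; omega
    · intro i hi
      exact hf i (by simpa using hi)
  | succ d ih =>
    intro U f0 hU hf
    have hS : (U.map f0.toEmbedding)ᶜ.card = Uᶜ.card := by
      rw [Finset.card_compl, Finset.card_compl, Finset.card_map, hcard]
    obtain ⟨i, hi, hDi⟩ := hgood Uᶜ (U.map f0.toEmbedding)ᶜ hS.symm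
      (by rw [Finset.card_compl]; omega)
    have hiU : i ∉ U := by simpa using hi
    set B := ((U.map f0.toEmbedding)ᶜ).filter (fun b => E i b) with hB
    let g : β → (α ≃ β) := fun b => f0.trans (Equiv.swap (f0 i) b)
    let C : β → Finset (α ≃ β) := fun b =>
      Finset.univ.filter (fun f : α ≃ β => (∀ j ∈ insert i U, f j = g b j) ∧
        ∃ W : Finset α, W.card = s ∧ ∀ i, i ∉ W → E i (f i))
    have hgi : ∀ b, g b i = b := by
      intro b; simp [g]
    have hgU : ∀ b ∈ B, ∀ j ∈ U, g b j = f0 j := by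
      intro b hb j hj
      have hb' : ∀ j ∈ U, f0 j ≠ b := by
        simp only [hB, Finset.mem_filter, Finset.mem_compl, Finset.mem_map] at hb
        intro j hj h
        exact hb.1 ⟨j, hj, h⟩
      simp only [g, Equiv.trans_apply]
      apply Equiv.swap_apply_of_ne_of_ne
      · intro h
        exact hiU (f0.injective h ▸ hj)
      · exact hb' j hj
    have hC : ∀ b ∈ B, D ^ d ≤ ((C b).card : ℝ) := by
      intro b hb
      apply ih (insert i U) (g b)
      · rw [Finset.card_insert_of_notMem hiU]; omega
      · intro j hj
        rcases Finset.mem_insert.1 hj with rfl | hj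
        · rw [hgi]
          exact (Finset.mem_filter.1 hb).2
        · rw [hgU b hb j hj]
          exact hf j hj
    have hdisj : Set.PairwiseDisjoint (B : Set β) C := by
      intro b _ c _ hbc
      rw [Function.onFun, Finset.disjoint_left]
      intro f h1 h2
      simp only [C, Finset.mem_filter] at h1 h2
      have e1 := h1.2.1 i (Finset.mem_insert_self _ _)
      have e2 := h2.2.1 i (Finset.mem_insert_self _ _)
      rw [hgi] at e1 e2
      exact hbc (e1.symm.trans e2)
    have hsub : B.biUnion C ⊆ Finset.univ.filter (fun f : α ≃ β => (∀ i ∈ U, f i = f0 i) ∧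
        ∃ W : Finset α, W.card = s ∧ ∀ i, i ∉ W → E i (f i)) := by
      intro f hf'
      obtain ⟨b, hb, hfb⟩ := Finset.mem_biUnion.1 hf'
      simp only [C, Finset.mem_filter] at hfb
      simp only [Finset.mem_filter, Finset.mem_univ, true_and]
      refine ⟨fun j hj => ?_, hfb.2.2⟩
      rw [hfb.2.1 j (Finset.mem_insert_of_mem hj), hgU b hb j hj]
    calc D ^ (d + 1) = D * D ^ d := by ring
      _ ≤ (B.card : ℝ) * D ^ d := by gcongr
      _ = ∑ b ∈ B, D ^ d := by simp
      _ ≤ ∑ b ∈ B, ((C b).card : ℝ) := Finset.sum_le_sum hC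
      _ = ((B.biUnion C).card : ℝ) := by
        rw [Finset.card_biUnion hdisj]; push_cast; rfl
      _ ≤ _ := by exact_mod_cast Finset.card_le_card hsub

open Classical in
theorem core (E : α → β → Prop)
    (hE : ∀ i j b c, i ≠ j → b ≠ c → E i b → E i c → E j b → E j c → False)
    (H : Finset (α ≃ β)) (hH : ∀ f ∈ H, ∀ g ∈ H, f ≠ g → Crossing f g)
    (m s : ℕ) (D : ℝ) (hD : 0 ≤ D) (ha : Fintype.card α = m) (hb : Fintype.card β = m)
    (hs : s ≤ m)
    (hgood : ∀ (T : Finset α) (S : Finset β), T.card = S.card → s ≤ T.card →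
      ∃ i ∈ T, D ≤ ((S.filter (fun b => E i b)).card : ℝ)) :
    (H.card : ℝ) * D ^ (m - s) ≤ 2 ^ m * (m.factorial * (m : ℝ) ^ s) := by
  obtain ⟨f0⟩ : Nonempty (α ≃ β) := Fintype.card_eq.1 (ha.trans hb.symm)
  have h1 := greedy E s D hD (ha.trans hb.symm) hgood (m - s) ∅ f0
    (by rw [ha, Finset.card_empty]; omega) (by simp)
  let G : Finset α → Finset (α ≃ β) := fun W =>
    Finset.univ.filter (fun f : α ≃ β => ∀ i, i ∉ W → E i (f i))
  let P := (Finset.univ : Finset (Finset α)).filter (fun W => W.card = s)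
  have h2 : (Finset.univ.filter (fun f : α ≃ β => (∀ i ∈ (∅ : Finset α), f i = f0 i) ∧
        ∃ W : Finset α, W.card = s ∧ ∀ i, i ∉ W → E i (f i))) ⊆ P.biUnion G := by
    intro f hf
    simp only [Finset.mem_filter, Finset.mem_univ, true_and] at hf
    obtain ⟨-, W, hW, hW'⟩ := hf
    simp only [P, G, Finset.mem_biUnion, Finset.mem_filter, Finset.mem_univ, true_and]
    exact ⟨W, hW, hW'⟩
  have h3 : (D : ℝ) ^ (m - s) ≤ ((∑ W ∈ P, (G W).card : ℕ) : ℝ) :=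
    h1.trans (by exact_mod_cast (Finset.card_le_card h2).trans Finset.card_biUnion_le)
  have h4 : H.card * ∑ W ∈ P, (G W).card ≤ 2 ^ m * (m.factorial * m ^ s) := by
    rw [Finset.mul_sum]
    calc ∑ W ∈ P, H.card * (G W).card ≤ ∑ W ∈ P, (m.factorial * m ^ s) := by
          apply Finset.sum_le_sum
          intro W hW
          have := fam_bound E hE H hH W
          rw [hb, (Finset.mem_filter.1 hW).2] at this
          exact this
      _ = P.card * (m.factorial * m ^ s) := by simp
      _ ≤ _ := by
          gcongr
          calc P.card ≤ (Finset.univ : Finset (Finset α)).card := Finset.card_filter_le _ _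
            _ = 2 ^ m := by rw [Finset.card_univ, Fintype.card_finset, ha]
  calc (H.card : ℝ) * D ^ (m - s) ≤ H.card * ((∑ W ∈ P, (G W).card : ℕ) : ℝ) := by gcongr
    _ ≤ _ := by exact_mod_cast h4

end Core

section Plane
variable {p : ℕ} [Fact p.Prime]

/-- The point `b` lies on the line `l`. -/
def Inc (l b : ZMod p × ZMod p) : Prop := b.2 = l.1 * b.1 + l.2

theorem inc_free (i j b c : ZMod p × ZMod p) (hij : i ≠ j) (hbc : b ≠ c)
    (h1 : Inc i b) (h2 : Inc i c) (h3 : Inc j b) (h4 : Inc j c) : False := by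
  unfold Inc at *
  have h : (i.1 - j.1) * (b.1 - c.1) = 0 := by linear_combination h2 - h1 + h3 - h4
  rcases mul_eq_zero.1 h with h | h
  · have h5 : i.1 = j.1 := sub_eq_zero.1 h
    apply hij
    refine Prod.ext h5 ?_
    rw [h5] at h1
    linear_combination h3 - h1
  · have h5 : b.1 = c.1 := sub_eq_zero.1 h
    apply hbc
    refine Prod.ext h5 ?_
    rw [h1, h2, h5]

open Classical in
theorem deg_sum (S : Finset (ZMod p × ZMod p)) :
    ∑ l : ZMod p × ZMod p, (S.filter (fun b => Inc l b)).card = p * S.card := by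
  simp_rw [Finset.card_filter]
  rw [Finset.sum_comm]
  have : ∀ b ∈ S, ∑ l : ZMod p × ZMod p, (if Inc l b then 1 else 0) = p := by
    intro b _
    rw [Fintype.sum_prod_type]
    have : ∀ a : ZMod p, ∑ c : ZMod p, (if Inc (a, c) b then 1 else 0) = 1 := by
      intro a
      rw [Finset.sum_eq_single (b.2 - a * b.1)]
      · simp [Inc]
      · intro c _ hc
        rw [if_neg]
        intro h
        apply hc
        unfold Inc at h
        rw [h]; ring
      · simp
    simp [this, ZMod.card]
  rw [Finset.sum_congr rfl this]
  simp [mul_comm]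

open Classical in
theorem deg_sq_sum (S : Finset (ZMod p × ZMod p)) :
    ∑ l : ZMod p × ZMod p, (S.filter (fun b => Inc l b)).card ^ 2
      ≤ p * S.card + S.card ^ 2 := by
  have h0 : ∀ l : ZMod p × ZMod p, (S.filter (fun b => Inc l b)).card ^ 2
      = ∑ b ∈ S, ∑ c ∈ S, (if Inc l b ∧ Inc l c then 1 else 0) := by
    intro l
    rw [sq, Finset.card_filter, Finset.sum_mul_sum]
    refine Finset.sum_congr rfl fun b _ => Finset.sum_congr rfl fun c _ => ?_
    by_cases h1 : Inc l b <;> by_cases h2 : Inc l c <;> simp [h1, h2]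
  simp_rw [h0]
  rw [Finset.sum_comm]
  have h1 : ∀ b ∈ S, ∑ l : ZMod p × ZMod p, ∑ c ∈ S, (if Inc l b ∧ Inc l c then 1 else 0)
      ≤ p + S.card := by
    intro b hb
    rw [Finset.sum_comm]
    have h2 : ∀ c ∈ S, ∑ l : ZMod p × ZMod p, (if Inc l b ∧ Inc l c then 1 else 0)
        ≤ (if b = c then p else 0) + 1 := by
      intro c _
      split_ifs with hbc
      · subst hbc
        have := deg_sum ({b} : Finset (ZMod p × ZMod p))
        simp only [Finset.card_filter, Finset.sum_singleton, Finset.card_singleton, mul_one]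
          at this
        simp only [and_self]
        omega
      · rw [← Finset.card_filter, zero_add, Finset.card_le_one]
        intro i hi j hj
        simp only [Finset.mem_filter, Finset.mem_univ, true_and] at hi hj
        by_contra hij
        exact inc_free i j b c hij hbc hi.1 hi.2 hj.1 hj.2
    refine (Finset.sum_le_sum h2).trans ?_
    rw [Finset.sum_add_distrib]
    simp [hb]
  refine (Finset.sum_le_sum h1).trans ?_
  simp
  apply le_of_eq
  ring

open Classical in
theorem mixing (S T : Finset (ZMod p × ZMod p)) (hpos : 0 < S.card)
    (h : 4 * p ^ 3 < T.card * S.card) :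
    ∃ i ∈ T, (S.card : ℝ) / (2 * p) ≤ ((S.filter (fun b => Inc i b)).card : ℝ) := by
  by_contra hcon
  push Not at hcon
  have hp : (0 : ℝ) < p := by exact_mod_cast (Fact.out : p.Prime).pos
  let dg : ZMod p × ZMod p → ℝ := fun l => ((S.filter (fun b => Inc l b)).card : ℝ)
  have h1 : ∑ l, dg l = p * S.card := by
    simp only [dg]; exact_mod_cast deg_sum S
  have h2 : ∑ l, dg l ^ 2 ≤ p * S.card + (S.card : ℝ) ^ 2 := by
    simp only [dg]; exact_mod_cast deg_sq_sum S
  have h3 : ∑ l, (p * dg l - S.card) ^ 2 ≤ (p : ℝ) ^ 3 * S.card := by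
    have e : ∀ l, (p * dg l - S.card) ^ 2
        = (p : ℝ) ^ 2 * dg l ^ 2 - 2 * p * S.card * dg l + (S.card : ℝ) ^ 2 := by
      intro l; ring
    simp_rw [e]
    rw [Finset.sum_add_distrib, Finset.sum_sub_distrib, ← Finset.mul_sum, ← Finset.mul_sum, h1]
    simp only [Finset.sum_const, Finset.card_univ, Fintype.card_prod, ZMod.card, nsmul_eq_mul]
    push_cast
    nlinarith [mul_le_mul_of_nonneg_left h2 (sq_nonneg (p : ℝ))]
  have h4 : (T.card : ℝ) * ((S.card : ℝ) ^ 2 / 4) ≤ ∑ l, (p * dg l - S.card) ^ 2 := by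
    calc (T.card : ℝ) * ((S.card : ℝ) ^ 2 / 4) = ∑ l ∈ T, ((S.card : ℝ) ^ 2 / 4) := by simp
      _ ≤ ∑ l ∈ T, (p * dg l - S.card) ^ 2 := by
        apply Finset.sum_le_sum
        intro l hl
        have := hcon l hl
        rw [lt_div_iff₀ (by positivity)] at this
        change dg l * (2 * p) < S.card at this
        have h0 : 0 ≤ (S.card : ℝ) := by positivity
        nlinarith
      _ ≤ _ := Finset.sum_le_sum_of_subset_of_nonneg (Finset.subset_univ _)
        (fun _ _ _ => sq_nonneg _)
  have h5 : (4 * p ^ 3 : ℝ) < T.card * S.card := by exact_mod_cast h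
  have h6 : (0 : ℝ) < S.card := by exact_mod_cast hpos
  nlinarith [mul_lt_mul_of_pos_right h5 h6]

end Plane

theorem bip_bound {α β : Type} [Fintype α] [Fintype β] [DecidableEq α] [DecidableEq β]
    (H : Finset (α ≃ β)) (hH : ∀ f ∈ H, ∀ g ∈ H, f ≠ g → Crossing f g)
    (m s p : ℕ) (hp : p.Prime) (ha : Fintype.card α = m) (hb : Fintype.card β = m)
    (hs : s ≤ m) (hmp : m ≤ p ^ 2) (hsp : 4 * p ^ 3 < s ^ 2) :
    (H.card : ℝ) * ((s : ℝ) / (2 * p)) ^ (m - s) ≤ 2 ^ m * (m.factorial * (m : ℝ) ^ s) := by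
  classical
  have : Fact p.Prime := ⟨hp⟩
  have hc : Fintype.card (ZMod p × ZMod p) = p ^ 2 := by
    rw [Fintype.card_prod, ZMod.card, sq]
  obtain ⟨ea⟩ : Nonempty (α ↪ ZMod p × ZMod p) :=
    Function.Embedding.nonempty_of_card_le (by rw [hc, ha]; exact hmp)
  obtain ⟨eb⟩ : Nonempty (β ↪ ZMod p × ZMod p) :=
    Function.Embedding.nonempty_of_card_le (by rw [hc, hb]; exact hmp)
  have hs0 : 0 < s := by
    rcases Nat.eq_zero_or_pos s with h | h
    · subst h; simp at hsp
    · exact h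
  apply core (fun i b => Inc (ea i) (eb b)) _ H hH m s _ (by positivity) ha hb hs
  · intro T S hTS hsT
    obtain ⟨i, hi, h⟩ := mixing (S.map eb) (T.map ea) (by rw [Finset.card_map]; omega) (by
      rw [Finset.card_map, Finset.card_map, ← hTS]
      nlinarith)
    obtain ⟨j, hj, rfl⟩ := Finset.mem_map.1 hi
    refine ⟨j, hj, ?_⟩
    rw [Finset.filter_map, Finset.card_map, Finset.card_map] at h
    refine le_trans ?_ h
    rw [← hTS]
    gcongr
  · intro i j b c hij hbc
    exact inc_free _ _ _ _ (ea.injective.ne hij) (eb.injective.ne hbc)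

theorem c4_vertices {V : Type*} {G : SimpleGraph V} (h : ContainsCycleLen G 4) :
    ∃ u a b c : V, G.Adj u a ∧ G.Adj a b ∧ G.Adj b c ∧ G.Adj c u ∧ u ≠ b ∧ a ≠ c := by
  obtain ⟨u, w, hw, hl⟩ := h
  match w, hw, hl with
  | .cons h1 (.cons h2 (.cons h3 (.cons h4 .nil))), hw, _ =>
    refine ⟨_, _, _, _, h1, h2, h3, h4, ?_, ?_⟩
    · have := hw.support_nodup
      simp at this
      intro h
      subst h
      simp_all
    · have := hw.support_nodup
      simp at this
      intro h
      subst h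
      simp_all

theorem c4_alternating {V : Type*} {G₁ G₂ : SimpleGraph V} (h1 : IsPMGraph G₁)
    (h2 : IsPMGraph G₂) (h : ContainsCycleLen (G₁ ⊔ G₂) 4) :
    ∃ u a b c : V, G₁.Adj u a ∧ G₂.Adj a b ∧ G₁.Adj b c ∧ G₂.Adj c u ∧ u ≠ b ∧ a ≠ c := by
  obtain ⟨u, a, b, c, hua, hab, hbc, hcu, hub, hac⟩ := c4_vertices h
  have u1 : ∀ x y z, G₁.Adj x y → G₁.Adj x z → y = z := fun x y z hy hz => (h1 x).unique hy hz
  have u2 : ∀ x y z, G₂.Adj x y → G₂.Adj x z → y = z := fun x y z hy hz => (h2 x).unique hy hz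
  simp only [SimpleGraph.sup_adj] at hua hab hbc hcu
  rcases hua with hua | hua
  · have hab' : G₂.Adj a b := hab.resolve_left fun h => hub (u1 a u b hua.symm h)
    have hbc' : G₁.Adj b c := hbc.resolve_right fun h => hac (u2 b a c hab'.symm h)
    have hcu' : G₂.Adj c u := hcu.resolve_left fun h => hub (u1 c u b h hbc'.symm)
    exact ⟨u, a, b, c, hua, hab', hbc', hcu', hub, hac⟩
  · have hab' : G₁.Adj a b := hab.resolve_right fun h => hub (u2 a u b hua.symm h)
    have hbc' : G₂.Adj b c := hbc.resolve_left fun h => hac (u1 b a c hab'.symm h)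
    have hcu' : G₁.Adj c u := hcu.resolve_right fun h => hub (u2 c u b h hbc'.symm)
    exact ⟨a, b, c, u, hab', hbc', hcu', hua, hac, hub.symm⟩

theorem crossing_of_c4 {V : Type} [DecidableEq V] {G₁ G₂ : SimpleGraph V} (h1 : IsPMGraph G₁)
    (h2 : IsPMGraph G₂) (h : ContainsCycleLen (G₁ ⊔ G₂) 4) (A : Finset V)
    (e₁ e₂ : {v // v ∈ A} ≃ {v // v ∉ A}) (he₁ : ∀ a : {v // v ∈ A}, G₁.Adj a (e₁ a))
    (he₂ : ∀ a : {v // v ∈ A}, G₂.Adj a (e₂ a)) : Crossing e₁ e₂ := by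
  have key : ∀ (G : SimpleGraph V) (_ : IsPMGraph G) (e : {v // v ∈ A} ≃ {v // v ∉ A})
      (_ : ∀ a : {v // v ∈ A}, G.Adj a (e a)), (∀ x y, G.Adj x y → ∀ hx : x ∈ A, y = e ⟨x, hx⟩) ∧
        (∀ x y, G.Adj x y → x ∉ A → y ∈ A) := by
    intro G hG e he
    refine ⟨fun x y hxy hx => (hG x).unique hxy (he ⟨x, hx⟩), fun x y hxy hx => ?_⟩
    have h1 := he (e.symm ⟨x, hx⟩)
    rw [Equiv.apply_symm_apply] at h1
    rw [(hG x).unique hxy h1.symm]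
    exact (e.symm ⟨x, hx⟩).2
  obtain ⟨k1, k1'⟩ := key G₁ h1 e₁ he₁
  obtain ⟨k2, k2'⟩ := key G₂ h2 e₂ he₂
  obtain ⟨u, a, b, c, hua, hab, hbc, hcu, hub, hac⟩ := c4_alternating h1 h2 h
  by_cases hu : u ∈ A
  · have ha := k1 u a hua hu
    have ha' : a ∉ A := ha ▸ (e₁ ⟨u, hu⟩).2
    have hb : b ∈ A := k2' a b hab ha'
    refine ⟨⟨u, hu⟩, ⟨b, hb⟩, fun h => hub (congrArg Subtype.val h), ?_, ?_⟩
    · exact Subtype.ext (ha.symm.trans (k2 b a hab.symm hb))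
    · exact Subtype.ext ((k1 b c hbc hb).symm.trans (k2 u c hcu.symm hu))
  · have ha : a ∈ A := k1' u a hua hu
    have hc : c ∈ A := k2' u c hcu.symm hu
    refine ⟨⟨a, ha⟩, ⟨c, hc⟩, fun h => hac (congrArg Subtype.val h), ?_, ?_⟩
    · exact Subtype.ext ((k1 a u hua.symm ha).symm.trans (k2 c u hcu hc))
    · exact Subtype.ext ((k1 c b hbc.symm hc).symm.trans (k2 a b hab ha))

theorem exists_split {n : ℕ} (G : SimpleGraph (Fin n)) (hG : IsPMGraph G) :
    ∃ A : Finset (Fin n), ∃ e : {v // v ∈ A} ≃ {v // v ∉ A}, ∀ a : {v // v ∈ A}, G.Adj a (e a) := by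
  classical
  choose f hf huniq using hG
  have hff : ∀ v, f (f v) = v := fun v => (huniq (f v) v (hf v).symm).symm
  have hne : ∀ v, v ≠ f v := fun v => (hf v).ne
  refine ⟨Finset.univ.filter (fun v => v < f v),
    ⟨fun a => ⟨f a, ?_⟩, fun b => ⟨f b, ?_⟩, ?_, ?_⟩, ?_⟩
  · have := a.2
    simp only [Finset.mem_filter, Finset.mem_univ, true_and] at this ⊢
    rw [hff]
    exact not_lt.2 this.le
  · have := b.2
    simp only [Finset.mem_filter, Finset.mem_univ, true_and] at this ⊢
    rw [hff]
    exact lt_of_le_of_ne (not_lt.1 this) (hne _).symm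
  · intro a
    exact Subtype.ext (hff _)
  · intro a
    exact Subtype.ext (hff _)
  · intro a
    exact hf a

theorem family_bound (m s p : ℕ) (hp : p.Prime) (hs : s ≤ m) (hmp : m ≤ p ^ 2)
    (hsp : 4 * p ^ 3 < s ^ 2) (F : Finset (SimpleGraph (Fin (m + m))))
    (hF : ∀ G ∈ F, IsPMGraph G)
    (hF' : ∀ G₁ ∈ F, ∀ G₂ ∈ F, G₁ ≠ G₂ → ContainsCycleLen (G₁ ⊔ G₂) 4) :
    (F.card : ℝ) * ((s : ℝ) / (2 * p)) ^ (m - s)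
      ≤ 2 ^ (m + m) * (2 ^ m * (m.factorial * (m : ℝ) ^ s)) := by
  classical
  set R : ℝ := 2 ^ m * (m.factorial * (m : ℝ) ^ s) with hR
  let P : Finset (Fin (m + m)) → SimpleGraph (Fin (m + m)) → Prop := fun A G =>
    ∃ e : {v // v ∈ A} ≃ {v // v ∉ A}, ∀ a : {v // v ∈ A}, G.Adj a (e a)
  let FA : Finset (Fin (m + m)) → Finset (SimpleGraph (Fin (m + m))) := fun A => F.filter (P A)
  have hsub : F ⊆ Finset.univ.biUnion FA := by
    intro G hG
    obtain ⟨A, h⟩ := exists_split G (hF G hG)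
    exact Finset.mem_biUnion.2 ⟨A, Finset.mem_univ _, Finset.mem_filter.2 ⟨hG, h⟩⟩
  have hcard : (F.card : ℝ) ≤ ∑ A, ((FA A).card : ℝ) := by
    exact_mod_cast (Finset.card_le_card hsub).trans Finset.card_biUnion_le
  have hA : ∀ A, ((FA A).card : ℝ) * ((s : ℝ) / (2 * p)) ^ (m - s) ≤ R := by
    intro A
    rcases (FA A).eq_empty_or_nonempty with h0 | ⟨G0, hG0⟩
    · rw [h0]
      simp only [Finset.card_empty, Nat.cast_zero, zero_mul]
      positivity
    · obtain ⟨e0, -⟩ := (Finset.mem_filter.1 hG0).2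
      have c1 : Fintype.card {v // v ∈ A} = Fintype.card {v // v ∉ A} := Fintype.card_congr e0
      have c2 := Fintype.card_subtype_compl (fun v => v ∈ A)
      have c4 := Fintype.card_subtype_le (fun v => v ∈ A)
      rw [Fintype.card_fin] at c2 c4
      have c3 : Fintype.card {v // v ∈ A} = m := by omega
      choose e he using fun G : {G // G ∈ FA A} => (Finset.mem_filter.1 G.2).2
      have hcr : ∀ G₁ G₂ : {G // G ∈ FA A}, G₁ ≠ G₂ → Crossing (e G₁) (e G₂) := by
        intro G₁ G₂ hne
        have m1 := (Finset.mem_filter.1 G₁.2).1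
        have m2 := (Finset.mem_filter.1 G₂.2).1
        exact crossing_of_c4 (hF _ m1) (hF _ m2)
          (hF' _ m1 _ m2 fun h => hne (Subtype.ext h)) A _ _ (he G₁) (he G₂)
      have hinj : Function.Injective e := by
        intro G₁ G₂ h
        by_contra hne
        obtain ⟨i, j, hij, h1, -⟩ := hcr G₁ G₂ hne
        rw [h] at h1
        exact hij ((e G₂).injective h1)
      have := bip_bound (Finset.univ.image e) (by
        intro f hf g hg hfg
        obtain ⟨G₁, -, rfl⟩ := Finset.mem_image.1 hf
        obtain ⟨G₂, -, rfl⟩ := Finset.mem_image.1 hg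
        exact hcr G₁ G₂ fun h => hfg (by rw [h])) m s p hp c3 (c1.symm.trans c3) hs hmp hsp
      rw [Finset.card_image_of_injective _ hinj, Finset.card_univ, Fintype.card_coe] at this
      exact this
  calc (F.card : ℝ) * ((s : ℝ) / (2 * p)) ^ (m - s)
      ≤ (∑ A, ((FA A).card : ℝ)) * ((s : ℝ) / (2 * p)) ^ (m - s) := by gcongr
    _ = ∑ A, ((FA A).card : ℝ) * ((s : ℝ) / (2 * p)) ^ (m - s) := by rw [Finset.sum_mul]
    _ ≤ ∑ A : Finset (Fin (m + m)), R := Finset.sum_le_sum fun A _ => hA A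
    _ = 2 ^ (m + m) * R := by simp

theorem analytic (ε : ℝ) (hε : 0 < ε) : ∃ M : ℕ, ∀ m : ℕ, M ≤ m →
    ∀ F : Finset (SimpleGraph (Fin (m + m))), (∀ G ∈ F, IsPMGraph G) →
    (∀ G₁ ∈ F, ∀ G₂ ∈ F, G₁ ≠ G₂ → ContainsCycleLen (G₁ ⊔ G₂) 4) →
    (F.card : ℝ) ≤ ((m + m : ℕ) : ℝ) ^ ((1 / 4 + ε) * ((m + m : ℕ) : ℝ)) := by
  obtain ⟨δ, hδ0, hδε, hδ1⟩ : ∃ δ : ℝ, 0 < δ ∧ δ ≤ ε / 2 ∧ δ ≤ 1 / 2 :=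
    ⟨min (ε / 2) (1 / 2), by positivity, min_le_left _ _, min_le_right _ _⟩
  set K := Real.log (8 / δ) with hK
  have hK0 : 0 ≤ K := Real.log_nonneg (by rw [le_div_iff₀ hδ0]; linarith)
  have t1 : Filter.Tendsto (fun m : ℕ => Real.log (m : ℝ)) Filter.atTop Filter.atTop :=
    Real.tendsto_log_atTop.comp tendsto_natCast_atTop_atTop
  have t2 : Filter.Tendsto (fun m : ℕ => Real.sqrt (m : ℝ)) Filter.atTop Filter.atTop :=
    Real.tendsto_sqrt_atTop.comp tendsto_natCast_atTop_atTop
  have ev := ((t1.eventually_ge_atTop (2 * (3 * Real.log 2 + K) / ε)).and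
    (t2.eventually_gt_atTop (256 / δ ^ 2))).and
    ((tendsto_natCast_atTop_atTop (R := ℝ)).eventually_ge_atTop (1 / δ))
  obtain ⟨M, hM⟩ := Filter.eventually_atTop.1 ev
  refine ⟨M, fun m hm F hF hF' => ?_⟩
  obtain ⟨⟨hlog, hsq⟩, hmδ⟩ := hM m hm
  rw [div_le_iff₀ hε] at hlog
  rw [div_lt_iff₀ (by positivity)] at hsq
  rw [div_le_iff₀ hδ0] at hmδ
  have hm2 : (2 : ℝ) ≤ m := by nlinarith [(Nat.cast_nonneg m : (0 : ℝ) ≤ m)]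
  have hm0 : (0 : ℝ) < m := by linarith
  set q := Real.sqrt (m : ℝ) with hq
  have hqq : q * q = m := Real.mul_self_sqrt hm0.le
  have hq1 : 1 ≤ q := by rw [hq, Real.one_le_sqrt]; linarith
  obtain ⟨p, hp, hrp, hpr⟩ := Nat.exists_prime_lt_and_le_two_mul (Nat.sqrt m + 1) (by omega)
  have hp4 : (p : ℝ) ≤ 4 * q := by
    have h1 : (Nat.sqrt m : ℝ) ≤ q := Real.nat_sqrt_le_real_sqrt
    have h2 : (p : ℝ) ≤ 2 * (Nat.sqrt m + 1) := by exact_mod_cast hpr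
    linarith
  have hp0 : (0 : ℝ) < p := by exact_mod_cast hp.pos
  have hmp : m ≤ p ^ 2 := by
    have := Nat.lt_succ_sqrt m
    simp only [Nat.succ_eq_add_one] at this
    nlinarith
  set s := ⌈δ * m⌉₊ with hs
  have hs1 : δ * m ≤ s := Nat.le_ceil _
  have hs2 : (s : ℝ) ≤ 2 * δ * m := by
    have := Nat.ceil_lt_add_one (show 0 ≤ δ * m by positivity)
    linarith
  have hsm : s ≤ m := by
    have : (s : ℝ) ≤ m := by nlinarith
    exact_mod_cast this
  have hsp : 4 * p ^ 3 < s ^ 2 := by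
    have : (4 * p ^ 3 : ℝ) < s ^ 2 := by
      calc (4 * p ^ 3 : ℝ) ≤ 4 * (4 * q) ^ 3 := by gcongr
        _ = 256 * q ^ 3 := by ring
        _ < (q * δ ^ 2) * q ^ 3 := by
          apply mul_lt_mul_of_pos_right hsq
          positivity
        _ = (δ * m) ^ 2 := by rw [← hqq]; ring
        _ ≤ s ^ 2 := by gcongr
    exact_mod_cast this
  have hfb := family_bound m s p hp hsm hmp hsp F hF hF'
  have hD : δ * q / 8 ≤ (s : ℝ) / (2 * p) := by
    rw [div_le_div_iff₀ (by norm_num) (by positivity)]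
    calc δ * q * (2 * p) ≤ δ * q * (2 * (4 * q)) := by gcongr
      _ = δ * m * 8 := by rw [← hqq]; ring
      _ ≤ s * 8 := by gcongr
  rcases Nat.eq_zero_or_pos F.card with h0 | hpos
  · rw [h0]; simp only [Nat.cast_zero]; positivity
  have hposR : (0 : ℝ) < F.card := by exact_mod_cast hpos
  have hD0 : 0 < δ * q / 8 := by positivity
  have hb : (F.card : ℝ) * (δ * q / 8) ^ (m - s)
      ≤ 2 ^ (m + m) * (2 ^ m * ((m : ℝ) ^ m * (m : ℝ) ^ s)) := by
    calc _ ≤ (F.card : ℝ) * ((s : ℝ) / (2 * p)) ^ (m - s) := by gcongr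
      _ ≤ _ := hfb
      _ ≤ _ := by
        gcongr
        exact_mod_cast Nat.factorial_le_pow m
  have hl := Real.log_le_log (by positivity) hb
  have hlD : Real.log (δ * q / 8) = Real.log m / 2 - K := by
    have e1 : δ * q / 8 = q / (8 / δ) := by field_simp
    rw [e1, Real.log_div (by positivity) (by positivity), hq, Real.log_sqrt hm0.le]
  rw [Real.log_mul (by positivity) (by positivity), Real.log_mul (by positivity) (by positivity),
    Real.log_mul (by positivity) (by positivity), Real.log_mul (by positivity) (by positivity),
    Real.log_pow, Real.log_pow, Real.log_pow, Real.log_pow, Real.log_pow, hlD,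
    Nat.cast_sub hsm] at hl
  have hL0 : 0 ≤ Real.log m := Real.log_nonneg (by linarith)
  have hmm : (0 : ℝ) < ((m + m : ℕ) : ℝ) := by push_cast; linarith
  rw [Real.rpow_def_of_pos hmm, ← Real.log_le_iff_le_exp hposR]
  have hLL : Real.log m ≤ Real.log ((m + m : ℕ) : ℝ) :=
    Real.log_le_log hm0 (by push_cast; linarith)
  set L := Real.log m
  have hfin : L * ((1 / 4 + ε) * ((m + m : ℕ) : ℝ))
      ≤ Real.log ((m + m : ℕ) : ℝ) * ((1 / 4 + ε) * ((m + m : ℕ) : ℝ)) := by gcongr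
  refine le_trans ?_ hfin
  push_cast at hl ⊢
  have i1 : (s : ℝ) * L ≤ 2 * δ * m * L := by gcongr
  have i2 : δ * (m * L) ≤ ε / 2 * (m * L) := by gcongr
  have i3 : (m : ℝ) * (2 * (3 * Real.log 2 + K)) ≤ m * (L * ε) := by gcongr
  have i4 : 0 ≤ (s : ℝ) * K := by positivity
  nlinarith

end CFour

/-- `M(n,4) ≤ n^((1/4)n - o(n))`. -/
theorem stmt_14 :
    ∀ ε : ℝ, 0 < ε → ∃ N : ℕ, ∀ n : ℕ, N ≤ n → Even n →
      (Mnum n 4 : ℝ) ≤ (n : ℝ) ^ ((1 / 4 + ε) * n) := by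
  intro ε hε
  obtain ⟨M, hM⟩ := CFour.analytic ε hε
  refine ⟨M + M, fun n hn he => ?_⟩
  obtain ⟨m, rfl⟩ := he
  have h : Mnum (m + m) 4 ≤ ⌊((m + m : ℕ) : ℝ) ^ ((1 / 4 + ε) * ((m + m : ℕ) : ℝ))⌋₊ := by
    apply csSup_le
    · exact ⟨0, ∅, by simp⟩
    · rintro b ⟨F, rfl, h1, h2⟩
      exact Nat.le_floor (hM m (by omega) F h1 h2)
  exact (Nat.cast_le.2 h).trans (Nat.floor_le (by positivity))
end

section
/- For every integer k ≥ 2, M(n,2k) ≤ n^{(1/2 − 1/(3k−2))n − o(n)}; precisely, for every ε > 0 there exists N such that for all even n ≥ N, M(n,2k) ≤ n^{(1/2 − 1/(3k−2) + ε)n}. -/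
open SimpleGraph

/-- No closed non-backtracking alternating sequence of `2k` edges. -/
def NoCyc (k : ℕ) {E ι κ : Type} (l : E → ι) (r : E → κ) : Prop :=
  ∀ e f : ℕ → E, (∀ j, r (e j) = r (f j) ∧ e j ≠ f j ∧ l (f j) = l (e (j+1)) ∧ f j ≠ e (j+1)) →
    e k ≠ e 0

section AlgPart
open Polynomial

section Alg
variable (F : Type) [Field F]

abbrev SLP := Matrix.SpecialLinearGroup (Fin 2) F[X]

theorem SLP_det (g : SLP F) : g.1 0 0 * g.1 1 1 - g.1 0 1 * g.1 1 0 = 1 := by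
  have := g.2
  rwa [Matrix.det_fin_two] at this

theorem SLP_mul (g h : SLP F) (i j : Fin 2) :
    (g * h).1 i j = g.1 i 0 * h.1 0 j + g.1 i 1 * h.1 1 j := by
  rw [Matrix.SpecialLinearGroup.coe_mul, Matrix.mul_apply, Fin.sum_univ_two]

theorem SLP_inv (g : SLP F) :
    (g⁻¹).1 0 0 = g.1 1 1 ∧ (g⁻¹).1 0 1 = - g.1 0 1 ∧ (g⁻¹).1 1 0 = - g.1 1 0 ∧
    (g⁻¹).1 1 1 = g.1 0 0 := by
  rw [Matrix.SpecialLinearGroup.SL2_inv_expl]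
  simp

/-- Iwahori-type unipotent group. -/
def UU : Subgroup (SLP F) where
  carrier := {g | X ∣ g.1 0 0 - 1 ∧ X ∣ g.1 1 0 ∧ X ∣ g.1 1 1 - 1}
  one_mem' := by simp
  mul_mem' := by
    rintro g h ⟨⟨a, ha⟩, ⟨c, hc⟩, ⟨d, hd⟩⟩ ⟨⟨a', ha'⟩, ⟨c', hc'⟩, ⟨d', hd'⟩⟩
    simp only [Set.mem_ofPred_eq, SLP_mul]
    rw [sub_eq_iff_eq_add] at ha hd ha' hd'
    refine ⟨⟨X * a * a' + a + a' + g.1 0 1 * c', ?_⟩, ⟨c * h.1 0 0 + g.1 1 1 * c', ?_⟩,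
      ⟨c * h.1 0 1 + X * d * d' + d + d', ?_⟩⟩
    · rw [ha, ha', hc']; ring
    · rw [hc, hc']; ring
    · rw [hc, hd, hd']; ring
  inv_mem' := by
    rintro g ⟨ha, hc, hd⟩
    obtain ⟨h1, h2, h3, h4⟩ := SLP_inv F g
    simp only [Set.mem_ofPred_eq, h1, h3, h4]
    exact ⟨hd, (dvd_neg).2 hc, ha⟩

/-- The congruence-type kernel. -/
def KK (b i : ℕ) (_hb : b ≤ i) (_hi : i ≤ b + 1) : Subgroup (UU F) where
  carrier := {g | X ^ i ∣ g.1.1 0 0 - 1 ∧ X ^ b ∣ g.1.1 0 1 ∧ X ^ i ∣ g.1.1 1 0 ∧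
    X ^ i ∣ g.1.1 1 1 - 1}
  one_mem' := by simp
  mul_mem' := by
    rintro g h ⟨ha, hB, hc, hd⟩ ⟨ha', hB', hc', hd'⟩
    have hc'' : X ∣ h.1.1 1 0 := h.2.2.1
    have hgc : X ∣ g.1.1 1 0 := g.2.2.1
    simp only [Set.mem_ofPred_eq, Subgroup.coe_mul, SLP_mul]
    refine ⟨?_, ?_, ?_, ?_⟩
    · have : g.1.1 0 0 * h.1.1 0 0 + g.1.1 0 1 * h.1.1 1 0 - 1 =
        (g.1.1 0 0 - 1) * h.1.1 0 0 + (h.1.1 0 0 - 1) + g.1.1 0 1 * h.1.1 1 0 := by ring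
      rw [this]
      exact dvd_add (dvd_add (ha.mul_right _) ha') (hc'.mul_left _)
    · exact dvd_add (hB'.mul_left _) (hB.mul_right _)
    · exact dvd_add (hc.mul_right _) (hc'.mul_left _)
    · have : g.1.1 1 0 * h.1.1 0 1 + g.1.1 1 1 * h.1.1 1 1 - 1 =
        (g.1.1 1 1 - 1) * h.1.1 1 1 + (h.1.1 1 1 - 1) + g.1.1 1 0 * h.1.1 0 1 := by ring
      rw [this]
      exact dvd_add (dvd_add (hd.mul_right _) hd') (hc.mul_right _)
  inv_mem' := by
    rintro g ⟨ha, hb, hc, hd⟩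
    obtain ⟨h1, h2, h3, h4⟩ := SLP_inv F g.1
    simp only [Set.mem_ofPred_eq, Subgroup.coe_inv, h1, h2, h3, h4]
    exact ⟨hd, (dvd_neg).2 hb, (dvd_neg).2 hc, ha⟩

theorem KK_normal (b i : ℕ) (hb : b ≤ i) (hi : i ≤ b + 1) : (KK F b i hb hi).Normal := by
  constructor
  rintro n ⟨hA, hB, hC, hD⟩ g
  have hgc : X ∣ g.1.1 1 0 := g.2.2.1
  obtain ⟨h1, h2, h3, h4⟩ := SLP_inv F g.1
  have hdet := SLP_det F g.1
  have hCB : X ^ i ∣ g.1.1 1 0 * n.1.1 0 1 := by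
    refine (pow_dvd_pow X hi).trans ?_
    rw [pow_succ']
    exact mul_dvd_mul hgc hB
  have hbA := (pow_dvd_pow (X : F[X]) hb).trans hA
  have hbC := (pow_dvd_pow (X : F[X]) hb).trans hC
  have hbD := (pow_dvd_pow (X : F[X]) hb).trans hD
  show X ^ i ∣ _ ∧ X ^ b ∣ _ ∧ X ^ i ∣ _ ∧ X ^ i ∣ _
  simp only [Subgroup.coe_mul, SLP_mul, Subgroup.coe_inv, h1, h2, h3, h4]
  generalize g.1.1 0 0 = a at *
  generalize g.1.1 0 1 = b' at *
  generalize g.1.1 1 0 = c at *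
  generalize g.1.1 1 1 = d at *
  generalize n.1.1 0 0 = A at *
  generalize n.1.1 0 1 = B at *
  generalize n.1.1 1 0 = C at *
  generalize n.1.1 1 1 = D at *
  refine ⟨?_, ?_, ?_, ?_⟩
  · have : (a * A + b' * C) * d + (a * B + b' * D) * -c - 1 =
      (A - 1) * (a * d) + C * (b' * d) - (c * B) * a - (D - 1) * (b' * c) := by
      linear_combination hdet
    rw [this]
    exact ((((hA.mul_right _).add (hC.mul_right _)).sub (hCB.mul_right _)).sub (hD.mul_right _))
  · have : (a * A + b' * C) * -b' + (a * B + b' * D) * a =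
      (A - 1) * (-a * b') + C * (- b' * b') + B * (a * a) + (D - 1) * (a * b') := by
      ring
    rw [this]
    exact ((((hbA.mul_right _).add (hbC.mul_right _)).add (hB.mul_right _)).add (hbD.mul_right _))
  · have : (c * A + d * C) * d + (c * B + d * D) * -c =
      (A - 1) * (c * d) + C * (d * d) - (c * B) * c - (D - 1) * (c * d) := by
      ring
    rw [this]
    exact ((((hA.mul_right _).add (hC.mul_right _)).sub (hCB.mul_right _)).sub (hD.mul_right _))
  · have : (c * A + d * C) * -b' + (c * B + d * D) * a - 1 =
      (A - 1) * (- c * b') + C * (- d * b') + (c * B) * a + (D - 1) * (a * d) := by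
      linear_combination hdet
    rw [this]
    exact ((((hA.mul_right _).add (hC.mul_right _)).add (hCB.mul_right _)).add (hD.mul_right _))

/-- trace argument -/
theorem KK_trace (b i k : ℕ) (hb : b ≤ i) (hi : i ≤ b + 1) (h1 : k + 1 ≤ 2 * i)
    (h2 : k + 1 ≤ b + i) (g : UU F) (hg : g ∈ KK F b i hb hi) :
    X ^ (k + 1) ∣ g.1.1 0 0 + g.1.1 1 1 - 2 := by
  obtain ⟨⟨A, hA⟩, ⟨B, hB⟩, ⟨C, hC⟩, ⟨D, hD⟩⟩ := hg
  have hdet := SLP_det F g.1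
  rw [sub_eq_iff_eq_add] at hA hD
  rw [hA, hB, hC, hD] at hdet
  rw [hA, hD]
  have : X ^ i * A + 1 + (X ^ i * D + 1) - 2 = X ^ (b + i) * (B * C) - X ^ (2 * i) * (A * D) := by
    linear_combination hdet
  rw [this]
  exact ((pow_dvd_pow X h2).mul_right _).sub ((pow_dvd_pow X h1).mul_right _)

/-- the data injection -/
theorem KK_rel (b i : ℕ) (hb : b ≤ i) (hi : i ≤ b + 1) (g h : UU F)
    (ha : X ^ i ∣ h.1.1 0 0 - g.1.1 0 0) (hB : X ^ b ∣ h.1.1 0 1 - g.1.1 0 1)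
    (hC : X ^ i ∣ h.1.1 1 0 - g.1.1 1 0) : g⁻¹ * h ∈ KK F b i hb hi := by
  obtain ⟨h1, h2, h3, h4⟩ := SLP_inv F g.1
  have hdet := SLP_det F g.1
  have hdet' := SLP_det F h.1
  have hgc : X ∣ h.1.1 1 0 := h.2.2.1
  have hg0 : X ∣ g.1.1 0 0 - 1 := g.2.1
  show X ^ i ∣ _ ∧ X ^ b ∣ _ ∧ X ^ i ∣ _ ∧ X ^ i ∣ _
  simp only [Subgroup.coe_mul, SLP_mul, Subgroup.coe_inv, h1, h2, h3, h4]
  generalize g.1.1 0 0 = a at *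
  generalize g.1.1 0 1 = b' at *
  generalize g.1.1 1 0 = c at *
  generalize g.1.1 1 1 = d at *
  generalize h.1.1 0 0 = A at *
  generalize h.1.1 0 1 = B at *
  generalize h.1.1 1 0 = C at *
  generalize h.1.1 1 1 = D at *
  have hCB : X ^ i ∣ C * (B - b') := by
    refine (pow_dvd_pow X hi).trans ?_
    rw [pow_succ']
    exact mul_dvd_mul hgc hB
  have hDd : X ^ i ∣ D - d := by
    have : X ^ i ∣ a * (D - d) := by
      have : a * (D - d) = C * (B - b') + b' * (C - c) - (A - a) * D := by
        linear_combination hdet' - hdet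
      rw [this]
      exact (hCB.add (hC.mul_left _)).sub (ha.mul_right _)
    refine IsCoprime.dvd_of_dvd_mul_left ?_ this
    apply IsCoprime.pow_left
    obtain ⟨u, hu⟩ := hg0
    exact ⟨-u, 1, by linear_combination hu⟩
  have hbD := (pow_dvd_pow (X : F[X]) hb).trans hDd
  refine ⟨?_, ?_, ?_, ?_⟩
  · have : d * A + -b' * C - 1 = (A - a) * d - b' * (C - c) := by linear_combination hdet
    rw [this]
    exact (ha.mul_right _).sub (hC.mul_left _)
  · have : d * B + -b' * D = d * (B - b') - b' * (D - d) := by ring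
    rw [this]
    exact (hB.mul_left _).sub (hbD.mul_left _)
  · have : -c * A + a * C = a * (C - c) - c * (A - a) := by ring
    rw [this]
    exact (hC.mul_left _).sub (ha.mul_left _)
  · have : -c * B + a * D - 1 = a * (D - d) - C * (B - b') + (C - c) * (B - b') := by
      linear_combination hdet
    rw [this]
    exact ((hDd.mul_left _).sub hCB).add (hC.mul_right _)

/-- root subgroups -/
noncomputable def x1 (a : F) : UU F :=
  ⟨⟨!![1, C a; 0, 1], by simp⟩, by show _ ∧ _ ∧ _; simp⟩
noncomputable def x2 (a : F) : UU F :=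
  ⟨⟨!![1, 0; C a * X, 1], by simp⟩, by show _ ∧ _ ∧ _; simp⟩


theorem x1_add (a b : F) : x1 F (a + b) = x1 F a * x1 F b := by
  apply Subtype.ext; apply Subtype.ext
  refine Matrix.ext fun i j => ?_
  show (!![1, C (a+b); 0, 1] : Matrix (Fin 2) (Fin 2) F[X]) i j = (!![1, C a; 0, 1] * !![1, C b; 0, 1]) i j
  fin_cases i <;> fin_cases j <;> simp [Matrix.mul_apply, Fin.sum_univ_two, add_comm]

theorem x2_add (a b : F) : x2 F (a + b) = x2 F a * x2 F b := by
  apply Subtype.ext; apply Subtype.ext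
  refine Matrix.ext fun i j => ?_
  show (!![1, 0; C (a+b) * X, 1] : Matrix (Fin 2) (Fin 2) F[X]) i j
    = (!![1, 0; C a * X, 1] * !![1, 0; C b * X, 1] : Matrix (Fin 2) (Fin 2) F[X]) i j
  fin_cases i <;> fin_cases j <;> simp [Matrix.mul_apply, Fin.sum_univ_two, add_mul]

noncomputable def x1h : Multiplicative F →* UU F :=
  MonoidHom.mk' (fun a => x1 F a.toAdd) (fun a b => x1_add F a.toAdd b.toAdd)

noncomputable def x2h : Multiplicative F →* UU F :=
  MonoidHom.mk' (fun a => x2 F a.toAdd) (fun a b => x2_add F a.toAdd b.toAdd)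

/-- alternating product -/
noncomputable def PP (a b : ℕ → F) : ℕ → UU F
  | 0 => 1
  | j + 1 => PP a b j * (x2 F (b j) * x1 F (a j))

theorem PP_succ (a b : ℕ → F) (j : ℕ) (i : Fin 2) :
    (PP F a b (j+1)).1.1 i 0 = (PP F a b j).1.1 i 0 + (PP F a b j).1.1 i 1 * (C (b j) * X) ∧
    (PP F a b (j+1)).1.1 i 1 = (PP F a b j).1.1 i 0 * C (a j) +
      (PP F a b j).1.1 i 1 * (C (b j) * X * C (a j) + 1) := by
  have h1 : (PP F a b (j+1)) = PP F a b j * (x2 F (b j) * x1 F (a j)) := rfl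
  rw [h1]
  simp only [Subgroup.coe_mul, SLP_mul]
  simp [x1, x2]

theorem PP_deg (a b : ℕ → F) (ha : ∀ j, a j ≠ 0) (hb : ∀ j, b j ≠ 0) (j : ℕ) :
    (∀ m, j + 1 ≤ m → ((PP F a b (j+1)).1.1 0 0).coeff m = 0) ∧
    (∀ m, j + 1 ≤ m → ((PP F a b (j+1)).1.1 0 1).coeff m = 0) ∧
    (∀ m, j + 2 ≤ m → ((PP F a b (j+1)).1.1 1 0).coeff m = 0) ∧
    (∀ m, j + 2 ≤ m → ((PP F a b (j+1)).1.1 1 1).coeff m = 0) ∧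
    ((PP F a b (j+1)).1.1 1 0).coeff (j+1) ≠ 0 ∧
    ((PP F a b (j+1)).1.1 1 1).coeff (j+1) ≠ 0 := by
  induction j with
  | zero =>
    obtain ⟨h00, h01⟩ := PP_succ F a b 0 0
    obtain ⟨h10, h11⟩ := PP_succ F a b 0 1
    rw [h00, h01, h10, h11]
    have h0 : PP F a b 0 = 1 := rfl
    rw [h0]
    have e1 : ∀ m, 1 ≤ m → (1 : F[X]).coeff m = 0 := fun m hm => by
      rw [coeff_one, if_neg (by omega)]
    have e2 : ∀ m, 2 ≤ m → (X : F[X]).coeff m = 0 := fun m hm => by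
      rw [coeff_X, if_neg (by omega)]
    have e3 : ∀ m, 1 ≤ m → (C (a 0) : F[X]).coeff m = 0 := fun m hm => by
      rw [coeff_C, if_neg (by omega)]
    refine ⟨?_, ?_, ?_, ?_, ?_, ?_⟩
    · intro m hm; simp [e1 m (by omega)]
    · intro m hm; simp [e3 m (by omega)]
    · intro m hm; simp [e2 m (by omega)]
    · intro m hm; simp [e2 m (by omega), e1 m (by omega)]
    · simp [hb]
    · simp [hb, ha, e1]
  | succ j ih =>
    obtain ⟨h00, h01⟩ := PP_succ F a b (j+1) 0
    obtain ⟨h10, h11⟩ := PP_succ F a b (j+1) 1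
    rw [h00, h01, h10, h11]
    obtain ⟨i1, i2, i3, i4, i5, i6⟩ := ih
    have key : ∀ (p : F[X]) (u v : F) (m : ℕ), (p * (C u * X * C v + 1)).coeff (m+1)
        = p.coeff m * (u * v) + p.coeff (m+1) := by
      intro p u v m
      have : p * (C u * X * C v + 1) = p * X * C (u * v) + p := by rw [C_mul]; ring
      rw [this, coeff_add, coeff_mul_C, coeff_mul_X]
    have key2 : ∀ (p : F[X]) (u : F) (m : ℕ), (p * (C u * X)).coeff (m+1)
        = p.coeff m * u := by
      intro p u m
      have : p * (C u * X) = p * X * C u := by ring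
      rw [this, coeff_mul_C, coeff_mul_X]
    refine ⟨?_, ?_, ?_, ?_, ?_, ?_⟩
    · intro m hm
      obtain ⟨m, rfl⟩ : ∃ m', m = m' + 1 := ⟨m - 1, by omega⟩
      rw [coeff_add, key2, i1 _ (by omega), i2 _ (by omega)]; simp
    · intro m hm
      obtain ⟨m, rfl⟩ : ∃ m', m = m' + 1 := ⟨m - 1, by omega⟩
      rw [coeff_add, key, coeff_mul_C, i1 _ (by omega), i2 _ (by omega), i2 _ (by omega)]; simp
    · intro m hm
      obtain ⟨m, rfl⟩ : ∃ m', m = m' + 1 := ⟨m - 1, by omega⟩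
      rw [coeff_add, key2, i3 _ (by omega), i4 _ (by omega)]; simp
    · intro m hm
      obtain ⟨m, rfl⟩ : ∃ m', m = m' + 1 := ⟨m - 1, by omega⟩
      rw [coeff_add, key, coeff_mul_C, i3 _ (by omega), i4 _ (by omega), i4 _ (by omega)]; simp
    · rw [coeff_add, key2, i3 _ (by omega), zero_add]
      exact mul_ne_zero i6 (hb _)
    · rw [coeff_add, key, coeff_mul_C, i3 _ (by omega), i4 (j+1+1) (by omega), zero_mul, zero_add,
        add_zero]
      exact mul_ne_zero i6 (mul_ne_zero (hb _) (ha _))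

theorem PP_not_mem (a b : ℕ → F) (ha : ∀ j, a j ≠ 0) (hb : ∀ j, b j ≠ 0)
    (b' i k : ℕ) (hbi : b' ≤ i) (hi : i ≤ b' + 1) (h1 : k + 1 ≤ 2 * i)
    (h2 : k + 1 ≤ b' + i) (hk : 1 ≤ k) : PP F a b k ∉ KK F b' i hbi hi := by
  intro hmem
  have ht := KK_trace F b' i k hbi hi h1 h2 _ hmem
  obtain ⟨j, rfl⟩ : ∃ j, k = j + 1 := ⟨k - 1, by omega⟩
  obtain ⟨i1, -, -, -, -, i6⟩ := PP_deg F a b ha hb j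
  rw [X_pow_dvd_iff] at ht
  have := ht (j+1) (by omega)
  have h2' : (2 : F[X]) = C 2 := (map_ofNat C 2).symm
  rw [coeff_sub, coeff_add, i1 _ le_rfl, h2', coeff_C, if_neg (by omega), zero_add, sub_zero] at this
  exact i6 this

theorem alg_main (F : Type) [Field F] [Fintype F] (k : ℕ) (hk : 2 ≤ k) :
    ∃ (E ι κ : Type) (_ : Fintype E) (_ : Fintype ι) (_ : Fintype κ) (l : E → ι) (r : E → κ),
      Nonempty E ∧ (∀ v, Nat.card {e // l e = v} = Fintype.card F) ∧
      (∀ w, Nat.card {e // r e = w} = Fintype.card F) ∧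
      (∀ e f, l e = l f → r e = r f → e = f) ∧ NoCyc k l r ∧
      Fintype.card E ≤ Fintype.card F ^ (2 * (k / 2) + (k + 1) / 2) := by
  classical
  set b := (k + 1) / 2 with hbdef
  set i := k / 2 + 1 with hidef
  have hb : b ≤ i := by omega
  have hi : i ≤ b + 1 := by omega
  let K := KK F b i hb hi
  have : K.Normal := KK_normal F b i hb hi
  let Γ := UU F ⧸ K
  let D := (Fin (k/2) → F) × (Fin b → F) × (Fin (k/2) → F)
  let φ : Γ → D := fun γ =>
    (fun m => (γ.out.1.1 0 0).coeff (m+1), fun m => (γ.out.1.1 0 1).coeff m,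
      fun m => (γ.out.1.1 1 0).coeff (m+1))
  have hφ : Function.Injective φ := by
    intro γ γ' h
    rw [← QuotientGroup.out_eq' γ, ← QuotientGroup.out_eq' γ', QuotientGroup.eq]
    have hA := congrArg Prod.fst h
    have hB := congrArg (fun z : D => z.2.1) h
    have hC := congrArg (fun z : D => z.2.2) h
    simp only [φ] at hA hB hC
    have hX : ∀ p q : F[X], X ∣ p - q → (fun m : Fin (k/2) => p.coeff (m+1)) =
      (fun m : Fin (k/2) => q.coeff (m+1)) → X ^ i ∣ q - p := by
      intro p q h0 h1
      rw [X_pow_dvd_iff]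
      intro d hd
      rcases d with _ | d
      · rw [X_dvd_iff, coeff_sub] at h0
        rw [coeff_sub]; linear_combination - h0
      · have := congrFun h1 ⟨d, by omega⟩
        rw [coeff_sub]; simp only at this; rw [this]; simp
    apply KK_rel
    · apply hX _ _ _ hA
      have h1 := γ.out.2.1
      have h2 := γ'.out.2.1
      have := dvd_sub h1 h2
      simpa using this
    · rw [X_pow_dvd_iff]
      intro d hd
      have := congrFun hB ⟨d, hd⟩
      rw [coeff_sub]; simp only at this; rw [this]; simp
    · exact hX _ _ (dvd_sub γ.out.2.2.1 γ'.out.2.2.1) hC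
  have : Finite Γ := Finite.of_injective φ hφ
  let g1 : Multiplicative F →* Γ := (QuotientGroup.mk' K).comp (x1h F)
  let g2 : Multiplicative F →* Γ := (QuotientGroup.mk' K).comp (x2h F)
  have hinj : ∀ u v : F, (x1 F u)⁻¹ * x2 F v ∈ K → u = 0 := by
    intro u v h
    obtain ⟨-, hB, -⟩ := h
    obtain ⟨e1, e2, e3, e4⟩ := SLP_inv F (x1 F u).1
    simp only [Subgroup.coe_mul, SLP_mul, Subgroup.coe_inv, e1, e2] at hB
    simp [x1, x2] at hB
    rw [X_pow_dvd_iff] at hB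
    simpa using hB 0 (by omega)
  have hinj2 : ∀ v : F, x2 F v ∈ K → v = 0 := by
    intro v h
    obtain ⟨-, -, hC, -⟩ := h
    rw [X_pow_dvd_iff] at hC
    simpa [x2] using hC 1 (by omega)
  have x1z : x1 F 0 = 1 := (x1h F).map_one
  have x2z : x2 F 0 = 1 := (x2h F).map_one
  have g1inj : Function.Injective g1 := by
    rw [injective_iff_map_eq_one]
    intro a ha
    have h : x1 F a.toAdd ∈ K := (QuotientGroup.eq_one_iff _).1 ha
    have := hinj a.toAdd 0 (by rw [x2z, mul_one]; exact K.inv_mem h)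
    exact this
  have g2inj : Function.Injective g2 := by
    rw [injective_iff_map_eq_one]
    intro a ha
    have h : x2 F a.toAdd ∈ K := (QuotientGroup.eq_one_iff _).1 ha
    exact hinj2 a.toAdd h
  have hcard : ∀ g : Multiplicative F →* Γ, Function.Injective g → ∀ v : Γ ⧸ g.range,
      Nat.card {e : Γ // (QuotientGroup.mk e : Γ ⧸ g.range) = v} = Fintype.card F := by
    intro g hg v
    have := QuotientGroup.card_preimage_mk g.range {v}
    rw [Nat.card_unique (α := ({v} : Set (Γ ⧸ g.range))), mul_one] at this
    rw [← Nat.card_eq_fintype_card]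
    have h2 : Nat.card g.range = Nat.card F :=
      (Nat.card_congr (Equiv.ofInjective g hg)).symm
    rw [← h2, ← this]
    rfl
  refine ⟨Γ, Γ ⧸ g1.range, Γ ⧸ g2.range, Fintype.ofFinite _, Fintype.ofFinite _,
    Fintype.ofFinite _, QuotientGroup.mk, QuotientGroup.mk, ⟨1⟩, hcard g1 g1inj, hcard g2 g2inj,
    ?_, ?_, ?_⟩
  · intro e f h1 h2
    rw [QuotientGroup.eq] at h1 h2
    obtain ⟨u, hu⟩ := h1
    obtain ⟨v, hv⟩ := h2
    have h : (x1 F u.toAdd)⁻¹ * x2 F v.toAdd ∈ K := by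
      rw [← QuotientGroup.eq]
      exact hu.trans hv.symm
    have h0 := hinj _ _ h
    have : u = 1 := h0
    rw [this, map_one] at hu
    exact inv_mul_eq_one.1 hu.symm
  · intro e f h hek
    have hA : ∀ j, ∃ a : F, a ≠ 0 ∧ e (j+1) = f j * QuotientGroup.mk (x1 F a) := by
      intro j
      obtain ⟨-, -, h3, h4⟩ := h j
      rw [QuotientGroup.eq] at h3
      obtain ⟨u, hu⟩ := h3
      refine ⟨u.toAdd, ?_, ?_⟩
      · intro h0
        have : u = 1 := h0
        rw [this, map_one] at hu
        exact h4 (inv_mul_eq_one.1 hu.symm)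
      · rw [eq_comm, ← eq_inv_mul_iff_mul_eq]; exact hu
    have hB : ∀ j, ∃ a : F, a ≠ 0 ∧ f j = e j * QuotientGroup.mk (x2 F a) := by
      intro j
      obtain ⟨h3, h4, -, -⟩ := h j
      rw [QuotientGroup.eq] at h3
      obtain ⟨u, hu⟩ := h3
      refine ⟨u.toAdd, ?_, ?_⟩
      · intro h0
        have : u = 1 := h0
        rw [this, map_one] at hu
        exact h4 (inv_mul_eq_one.1 hu.symm)
      · rw [eq_comm, ← eq_inv_mul_iff_mul_eq]; exact hu
    choose a ha ha' using hA
    choose c hc hc' using hB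
    have hP : ∀ j, e j = e 0 * QuotientGroup.mk (PP F a c j) := by
      intro j
      induction j with
      | zero => simp [PP]
      | succ j ih =>
        rw [ha', hc', ih]
        simp only [PP, QuotientGroup.mk_mul, mul_assoc]
    have := hP k
    rw [hek, eq_comm, mul_eq_left, QuotientGroup.eq_one_iff] at this
    exact PP_not_mem F a c ha hc b i k hb hi (by omega) (by omega) (by omega) this
  · refine (@Nat.card_eq_fintype_card Γ (Fintype.ofFinite _)).symm.trans_le ?_
    calc Nat.card Γ ≤ Nat.card D := Nat.card_le_card_of_injective φ hφ
      _ = _ := by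
        rw [Nat.card_eq_fintype_card]
        simp only [D, Fintype.card_prod, Fintype.card_fun, Fintype.card_fin]
        rw [← pow_add, ← pow_add]
        congr 1
        omega

end Alg

end AlgPart


section Count
open Finset
variable {E ι κ : Type} [Fintype E] [Fintype ι] [Fintype κ]
  [DecidableEq E] [DecidableEq ι] [DecidableEq κ]

theorem count_fix {Z : Type} [Fintype Z] [DecidableEq Z] (t : Z → Finset E) (q : ℕ)
    (ht : ∀ z, #(t z) = q) (C : Finset Z) (g : Z → E) :
    #{H ∈ Fintype.piFinset t | ∀ z ∈ C, H z = g z} * q ^ #C ≤ q ^ Fintype.card Z := by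
  have hsub : {H ∈ Fintype.piFinset t | ∀ z ∈ C, H z = g z} ⊆
      Fintype.piFinset (fun z => if z ∈ C then {g z} else t z) := by
    intro H hH
    simp only [mem_filter, Fintype.mem_piFinset] at hH ⊢
    intro z
    by_cases hz : z ∈ C
    · simp [hz, hH.2 z hz]
    · simp [hz, hH.1 z]
  calc _ ≤ (∏ z, (if z ∈ C then 1 else q)) * q ^ #C := by
        refine Nat.mul_le_mul_right _ ((card_le_card hsub).trans ?_)
        rw [Fintype.card_piFinset]
        apply le_of_eq
        apply prod_congr rfl
        intro z _
        by_cases hz : z ∈ C <;> simp [hz, ht]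
    _ = (∏ z, (if z ∈ C then 1 else q)) * ∏ z, (if z ∈ C then q else 1) := by
        congr 1
        rw [prod_ite_mem, univ_inter, prod_const]
    _ = ∏ z : Z, q := by
        rw [← prod_mul_distrib]
        apply prod_congr rfl
        intro z _
        by_cases hz : z ∈ C <;> simp [hz]
    _ = _ := by simp

/-- Hall with deficiency. -/
theorem hall_def (t : ι → Finset κ) (D : ℕ) (h : ∀ s : Finset ι, #s ≤ #(s.biUnion t) + D) :
    ∃ f : ι → κ ⊕ Fin D, Function.Injective f ∧ ∀ v w, f v = Sum.inl w → w ∈ t v := by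
  classical
  have := (Finset.all_card_le_biUnion_card_iff_exists_injective
    (fun v => (t v).disjSum (univ : Finset (Fin D)))).1 (by
      intro s
      rcases s.eq_empty_or_nonempty with rfl | ⟨v, hv⟩
      · simp
      have : (s.biUnion t).disjSum (univ : Finset (Fin D)) ⊆
        s.biUnion (fun v => (t v).disjSum (univ : Finset (Fin D))) := by
        intro x hx
        rcases x with x | x
        · simp at hx ⊢; exact hx
        · simp; exact ⟨v, hv⟩
      have h2 := card_le_card this
      rw [card_disjSum, card_univ, Fintype.card_fin] at h2
      exact (h s).trans h2)
  obtain ⟨f, hf, hf'⟩ := this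
  refine ⟨f, hf, fun v w hv => ?_⟩
  have := hf' v
  rw [hv] at this
  simpa using this

/-- in-degree -/
def indeg {Z : Type} [Fintype Z] (r : E → κ) (H : Z → E) (w : κ) : ℕ := #{x : Z | r (H x) = w}

theorem second_moment (l : E → ι) (r : E → κ) (q d : ℕ)
    (hl : ∀ v, #{e | l e = v} = q) (hr : ∀ w, #{e | r e = w} = q) :
    ∑ H ∈ Fintype.piFinset (fun x : Fin d × ι => ({e | l e = x.2} : Finset E)),
      ∑ w, (indeg r H w) ^ 2 ≤
      q ^ (d * Fintype.card ι) * (d * Fintype.card ι + d ^ 2 * Fintype.card κ) := by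
  set t : Fin d × ι → Finset E := fun x => ({e | l e = x.2} : Finset E) with ht
  set Ω := Fintype.piFinset t with hΩ
  have htc : ∀ x, #(t x) = q := fun x => hl x.2
  have hΩc : #Ω = q ^ (d * Fintype.card ι) := by
    rw [hΩ, Fintype.card_piFinset]; simp [htc]
  rcases Nat.eq_zero_or_pos q with rfl | hq
  · -- q = 0 : Ω empty or index empty
    by_cases hi : IsEmpty (Fin d × ι)
    · apply le_of_eq_of_le _ (Nat.zero_le _)
      apply sum_eq_zero; intro H _
      apply sum_eq_zero; intro w _
      simp [indeg]
    · rw [not_isEmpty_iff] at hi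
      have : d * Fintype.card ι ≠ 0 := by
        have := Fintype.card_ne_zero (α := Fin d × ι)
        simpa using this
      rw [zero_pow this, card_eq_zero] at hΩc
      rw [hΩc]; simp
  have h1 : ∀ H : Fin d × ι → E, ∑ w, (indeg r H w) ^ 2 =
      ∑ x, ∑ y, if r (H x) = r (H y) then 1 else 0 := by
    intro H
    simp only [indeg, card_filter, sq, sum_mul_sum]
    rw [sum_comm]
    apply sum_congr rfl; intro x _
    rw [sum_comm]
    apply sum_congr rfl; intro y _
    simp only [ite_mul, one_mul, zero_mul]
    rw [sum_ite_eq]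
    simp [eq_comm]
  simp only [h1]
  rw [sum_comm]
  have h2 : ∀ x y : Fin d × ι, (∑ H ∈ Ω, if r (H x) = r (H y) then 1 else 0) * q ^ 2 ≤
      (if x = y then #Ω * q ^ 2 else 0) +
      q ^ (d * Fintype.card ι) * #{p ∈ t x ×ˢ t y | r p.1 = r p.2} := by
    intro x y
    by_cases hxy : x = y
    · subst hxy
      simp
    rw [if_neg hxy, zero_add, ← card_filter]
    have hs : {H ∈ Ω | r (H x) = r (H y)} ⊆
      ({p ∈ t x ×ˢ t y | r p.1 = r p.2}).biUnion (fun p => {H ∈ Ω | ∀ z ∈ ({x, y} : Finset _),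
        H z = if z = x then p.1 else p.2}) := by
      intro H hH
      simp only [mem_filter, mem_biUnion, mem_product] at hH ⊢
      have hm := hH.1
      rw [hΩ, Fintype.mem_piFinset] at hm
      refine ⟨(H x, H y), ⟨⟨hm x, hm y⟩, hH.2⟩, hH.1, ?_⟩
      intro z hz
      simp only [mem_insert, mem_singleton] at hz
      rcases hz with rfl | rfl
      · simp
      · simp [Ne.symm hxy]
    calc _ ≤ (∑ p ∈ ({p ∈ t x ×ˢ t y | r p.1 = r p.2}), #{H ∈ Ω | ∀ z ∈ ({x, y} : Finset _),
        H z = if z = x then p.1 else p.2}) * q ^ 2 :=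
          Nat.mul_le_mul_right _ ((card_le_card hs).trans card_biUnion_le)
      _ = (∑ p ∈ ({p ∈ t x ×ˢ t y | r p.1 = r p.2}), #{H ∈ Ω | ∀ z ∈ ({x, y} : Finset _),
        H z = if z = x then p.1 else p.2} * q ^ 2) := sum_mul _ _ _
      _ ≤ (∑ p ∈ ({p ∈ t x ×ˢ t y | r p.1 = r p.2}), q ^ (d * Fintype.card ι)) := by
          apply sum_le_sum
          intro p _
          have := count_fix t q htc {x, y} (fun z => if z = x then p.1 else p.2)
          rw [card_pair hxy] at this
          simpa using this
      _ = _ := by rw [sum_const, smul_eq_mul, mul_comm]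
  have h3 : ∑ x, ∑ y, #{p ∈ t x ×ˢ t y | r p.1 = r p.2} = d ^ 2 * Fintype.card κ * q ^ 2 := by
    have e1 : ∀ x y, #{p ∈ t x ×ˢ t y | r p.1 = r p.2} =
        ∑ e, ∑ f, (if l e = x.2 then 1 else 0) * ((if l f = y.2 then 1 else 0) *
          if r e = r f then 1 else 0) := by
      intro x y
      rw [card_filter, sum_product]
      simp only [t, sum_filter]
      apply sum_congr rfl; intro e _
      split_ifs with he
      · apply sum_congr rfl; intro f _
        split_ifs <;> simp
      · simp
    have e0 : ∀ v : ι, ∑ x : Fin d × ι, (if v = x.2 then 1 else 0) = d := by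
      intro v
      rw [Fintype.sum_prod_type]
      simp
    have e2 : ∑ x : Fin d × ι, ∑ y : Fin d × ι, ∑ e, ∑ f, (if l e = x.2 then 1 else 0) *
          ((if l f = y.2 then 1 else 0) * if r e = r f then 1 else 0) =
          d ^ 2 * ∑ e, ∑ f, if r e = r f then 1 else 0 := by
      rw [sum_congr rfl (fun x _ => sum_comm), sum_comm, mul_sum]
      apply sum_congr rfl; intro e _
      rw [sum_congr rfl (fun x _ => sum_comm), sum_comm, mul_sum]
      apply sum_congr rfl; intro f _
      rw [sum_congr rfl (fun x _ => (mul_sum _ _ _).symm), ← sum_mul, ← sum_mul, e0, e0]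
      ring
    have e3 : ∑ e, ∑ f, (if r e = r f then 1 else 0) = Fintype.card κ * q ^ 2 := by
      have : ∀ e, ∑ f, (if r e = r f then 1 else 0) = q := by
        intro e
        rw [← card_filter, ← hr (r e)]
        congr 1; ext f; simp [eq_comm]
      simp only [this, sum_const, smul_eq_mul]
      have hE : #(univ : Finset E) = Fintype.card κ * q := by
        rw [card_eq_sum_card_fiberwise (f := r) (t := univ) (by simp)]
        simp [hr]
      rw [hE]; ring
    simp only [e1]
    rw [e2, e3]; ring
  have h4 : (∑ x, ∑ H ∈ Ω, ∑ y, if r (H x) = r (H y) then 1 else 0) * q ^ 2 ≤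
      (q ^ (d * Fintype.card ι) * (d * Fintype.card ι + d ^ 2 * Fintype.card κ)) * q ^ 2 := by
    calc _ = ∑ x, ∑ y, (∑ H ∈ Ω, if r (H x) = r (H y) then 1 else 0) * q ^ 2 := by
          rw [sum_mul]
          apply sum_congr rfl; intro x _
          rw [sum_comm, sum_mul]
      _ ≤ ∑ x, ∑ y, ((if x = y then #Ω * q ^ 2 else 0) +
          q ^ (d * Fintype.card ι) * #{p ∈ t x ×ˢ t y | r p.1 = r p.2}) :=
          sum_le_sum fun x _ => sum_le_sum fun y _ => h2 x y
      _ = _ := by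
          simp only [sum_add_distrib, ← mul_sum, h3]
          simp [hΩc]
          ring
  exact Nat.le_of_mul_le_mul_right h4 (by positivity)


theorem good_matching (l : E → ι) (r : E → κ) (s D N : ℕ) (hs : 0 < s)
    (hι : Fintype.card ι = N) (hκ : Fintype.card κ = N) (hD : 2 * N ≤ s * D)
    (H : Fin (s ^ 2) × ι → E) (hH : ∀ x, l (H x) = x.2)
    (hgood : ∑ w, (indeg r H w) ^ 2 ≤ 2 * s ^ 2 * N + (s ^ 2) ^ 2 * N) :
    ∃ S : Finset E, Set.InjOn l S ∧ Set.InjOn r S ∧ N ≤ #S + D ∧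
      ∀ e ∈ S, ∃ j, H (j, l e) = e := by
  have hdev : ∑ w, |(indeg r H w : ℝ) - s ^ 2| ≤ s ^ 2 * D := by
    have hsum : ∑ w, (indeg r H w) = s ^ 2 * N := by
      have := card_eq_sum_card_fiberwise (f := fun x => r (H x)) (s := univ) (t := univ) (by simp)
      simp only [indeg]
      rw [← this]; simp [hι]
    have hsumR : ∑ w, (indeg r H w : ℝ) = s ^ 2 * N := by exact_mod_cast hsum
    have hgR : ∑ w, (indeg r H w : ℝ) ^ 2 ≤ 2 * s ^ 2 * N + (s ^ 2) ^ 2 * N := by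
      exact_mod_cast hgood
    have hsR : (0 : ℝ) < s := by exact_mod_cast hs
    have hDR : (2 : ℝ) * N ≤ s * D := by exact_mod_cast hD
    have hpt : ∀ w, 2 * s * |(indeg r H w : ℝ) - s ^ 2| ≤
        (indeg r H w : ℝ) ^ 2 - 2 * s ^ 2 * (indeg r H w : ℝ) + ((s:ℝ) ^ 4 + s ^ 2) := by
      intro w
      nlinarith [sq_nonneg (|(indeg r H w : ℝ) - s ^ 2| - s), sq_abs ((indeg r H w : ℝ) - s ^ 2)]
    have := sum_le_sum (fun w (_ : w ∈ univ) => hpt w)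
    rw [← mul_sum, sum_add_distrib, sum_sub_distrib, ← mul_sum, hsumR, sum_const, card_univ, hκ,
      nsmul_eq_mul] at this
    have h2 : 2 * s * ∑ w, |(indeg r H w : ℝ) - s ^ 2| ≤ 2 * s * (s ^ 2 * D) := by
      have h3 : 2 * s * ∑ w, |(indeg r H w : ℝ) - s ^ 2| ≤ 3 * s ^ 2 * N := by
        nlinarith
      refine h3.trans ?_
      have : (s:ℝ)^2 * (2 * N) ≤ s ^ 2 * (s * D) := by gcongr
      nlinarith [show (0:ℝ) ≤ s^2 * N by positivity]
    exact le_of_mul_le_mul_left h2 (by positivity)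
  let t : ι → Finset κ := fun v => univ.image (fun j => r (H (j, v)))
  obtain ⟨f, hf, hf'⟩ := hall_def t D (by
    intro A
    have h1 : s ^ 2 * #A ≤ ∑ w ∈ A.biUnion t, indeg r H w := by
      have := card_eq_sum_card_fiberwise (f := fun x => r (H x))
        (s := (univ : Finset (Fin (s^2))) ×ˢ A) (t := A.biUnion t) (by
          rintro ⟨j, v⟩ hx
          simp only [coe_product, Set.mem_prod, mem_coe] at hx
          simp only [coe_biUnion, Set.mem_iUnion, mem_coe, t, mem_image]
          exact ⟨v, hx.2, j, mem_univ _, rfl⟩)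
      rw [card_product, card_univ, Fintype.card_fin] at this
      rw [this]
      apply sum_le_sum
      intro w _
      apply card_le_card
      intro x; simp
    have h1R : (s:ℝ) ^ 2 * #A ≤ ∑ w ∈ A.biUnion t, (indeg r H w : ℝ) := by exact_mod_cast h1
    have h2 : ∑ w ∈ A.biUnion t, (indeg r H w : ℝ) ≤ s ^ 2 * #(A.biUnion t) + s ^ 2 * D := by
      calc _ ≤ ∑ w ∈ A.biUnion t, ((s:ℝ) ^ 2 + |(indeg r H w : ℝ) - s ^ 2|) := by
            apply sum_le_sum; intro w _
            have := le_abs_self ((indeg r H w : ℝ) - s ^ 2)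
            linarith
        _ ≤ _ := by
            rw [sum_add_distrib, sum_const, nsmul_eq_mul, mul_comm]
            refine add_le_add le_rfl (le_trans ?_ hdev)
            exact sum_le_sum_of_subset_of_nonneg (subset_univ _) (fun _ _ _ => abs_nonneg _)
    have h3 : (s:ℝ)^2 * #A ≤ s ^ 2 * (#(A.biUnion t) + D) := by rw [mul_add]; exact h1R.trans h2
    have hsR : (0 : ℝ) < s ^ 2 := by positivity
    exact_mod_cast le_of_mul_le_mul_left h3 hsR)
  have hch : ∀ v, ∃ e : E, l e = v ∧ (∃ j, H (j, v) = e) ∧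
      ∀ w, f v = Sum.inl w → r e = w := by
    intro v
    rcases hv : f v with w | x
    · have := hf' v w hv
      simp only [t, mem_image, mem_univ, true_and] at this
      obtain ⟨j, hj⟩ := this
      refine ⟨H (j, v), hH _, ⟨j, rfl⟩, ?_⟩
      intro w' hw'
      rw [hj]; exact Sum.inl.inj hw'
    · refine ⟨H (⟨0, by positivity⟩, v), hH _, ⟨_, rfl⟩, ?_⟩
      intro w hw; simp at hw
  choose g hg1 hg2 hg3 using hch
  have ginj : Function.Injective g := fun a b h => by rw [← hg1 a, ← hg1 b, h]
  let V : Finset ι := {v | (f v).isLeft}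
  refine ⟨V.image g, ?_, ?_, ?_, ?_⟩
  · intro a ha b hb h
    simp only [coe_image, Set.mem_image, mem_coe] at ha hb
    obtain ⟨v, -, rfl⟩ := ha
    obtain ⟨w, -, rfl⟩ := hb
    rw [hg1, hg1] at h; rw [h]
  · intro a ha b hb h
    simp only [coe_image, Set.mem_image, mem_coe, V, mem_filter, mem_univ, true_and,
      Sum.isLeft_iff] at ha hb
    obtain ⟨v, ⟨x, hx⟩, rfl⟩ := ha
    obtain ⟨w, ⟨y, hy⟩, rfl⟩ := hb
    rw [hg3 _ _ hx, hg3 _ _ hy] at h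
    have : v = w := hf (by rw [hx, hy, h])
    rw [this]
  · rw [card_image_of_injective _ ginj, ← hι, ← card_univ,
      ← card_filter_add_card_filter_not (s := (univ : Finset ι)) (fun v => (f v).isLeft = true)]
    refine Nat.add_le_add_left ?_ _
    have := card_le_card_of_injOn (s := ({v | ¬ (f v).isLeft = true} : Finset ι))
      (t := (univ : Finset (Fin D)).map ⟨Sum.inr, Sum.inr_injective⟩) f (by
        intro v hv
        rcases h : f v with w | x <;> simp_all) hf.injOn
    simpa using this
  · intro e he
    rw [mem_image] at he
    obtain ⟨v, -, rfl⟩ := he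
    obtain ⟨j, hj⟩ := hg2 v
    exact ⟨j, by rw [hg1, hj]⟩

theorem count_matchings (l : E → ι) (r : E → κ) (q s D N : ℕ) (hs : 0 < s) (hN : 0 < N)
    (hl : ∀ v, #{e | l e = v} = q) (hr : ∀ w, #{e | r e = w} = q)
    (hι : Fintype.card ι = N) (hκ : Fintype.card κ = N) (hD : 2 * N ≤ s * D) (hq : 0 < q)
    (𝓜 : Finset (Finset E))
    (h𝓜 : ∀ S : Finset E, Set.InjOn l S → Set.InjOn r S → N ≤ #S + D → S ∈ 𝓜)
    (h𝓜' : ∀ S ∈ 𝓜, Set.InjOn l S ∧ N ≤ #S + D) :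
    q ^ N ≤ 2 * (s ^ 2) ^ N * q ^ D * #𝓜 := by
  set t : Fin (s ^ 2) × ι → Finset E := fun x => ({e | l e = x.2} : Finset E) with ht
  set Ω := Fintype.piFinset t with hΩ
  have htc : ∀ x, #(t x) = q := fun x => hl x.2
  have hΩc : #Ω = q ^ (s ^ 2 * N) := by
    rw [hΩ, Fintype.card_piFinset]; simp [htc, hι]
  set T := 2 * s ^ 2 * N + (s ^ 2) ^ 2 * N with hT
  have hlow : ∀ H ∈ Ω, (s ^ 2) ^ 2 * N ≤ ∑ w, (indeg r H w) ^ 2 := by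
    intro H _
    have hsum : ∑ w, (indeg r H w) = s ^ 2 * N := by
      have := card_eq_sum_card_fiberwise (f := fun x => r (H x)) (s := univ) (t := univ) (by simp)
      simp only [indeg]
      rw [← this]; simp [hι]
    have := sq_sum_le_card_mul_sum_sq (s := (univ : Finset κ)) (f := fun w => indeg r H w)
    rw [hsum, card_univ, hκ] at this
    have h2 : N * ((s ^ 2) ^ 2 * N) ≤ N * ∑ w, (indeg r H w) ^ 2 := by
      refine le_trans (le_of_eq ?_) this; ring
    exact Nat.le_of_mul_le_mul_left h2 hN
  have hsm := second_moment l r q (s ^ 2) hl hr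
  rw [hι, hκ] at hsm
  set good := Ω.filter (fun H => ∑ w, (indeg r H w) ^ 2 ≤ T) with hgood
  have hhalf : q ^ (s ^ 2 * N) ≤ 2 * #good := by
    set bad := Ω.filter (fun H => ¬ ∑ w, (indeg r H w) ^ 2 ≤ T)
    have hgb : #good + #bad = #Ω := card_filter_add_card_filter_not _
    have h1 : #good * ((s ^ 2) ^ 2 * N) + #bad * T ≤
        ∑ H ∈ Ω, ∑ w, (indeg r H w) ^ 2 := by
      rw [← sum_filter_add_sum_filter_not Ω (fun H => ∑ w, (indeg r H w) ^ 2 ≤ T)]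
      refine add_le_add ?_ ?_
      · rw [← smul_eq_mul]
        exact card_nsmul_le_sum _ _ _ (fun H hH => hlow H (mem_filter.1 hH).1)
      · rw [← smul_eq_mul]
        exact card_nsmul_le_sum _ _ _ (fun H hH => (not_le.1 (mem_filter.1 hH).2).le)
    have h2 := h1.trans hsm
    rw [← hΩc, ← hgb, hT] at h2
    rw [← hΩc, ← hgb]
    have h3 : s ^ 2 * N * #bad ≤ s ^ 2 * N * #good := by nlinarith
    have := Nat.le_of_mul_le_mul_left h3 (by positivity)
    omega
  have hcov : good ⊆ (𝓜 ×ˢ (univ : Finset (ι → Fin (s ^ 2)))).biUnion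
      (fun p => {H ∈ Ω | ∀ e ∈ p.1, H (p.2 (l e), l e) = e}) := by
    intro H hH
    rw [hgood, mem_filter] at hH
    have hm := hH.1
    rw [hΩ, Fintype.mem_piFinset] at hm
    obtain ⟨S, h1, h2, h3, h4⟩ := good_matching l r s D N hs hι hκ hD H
      (fun x => by simpa [t] using hm x) hH.2
    have : ∀ v, ∃ j, ∀ e ∈ S, l e = v → H (j, v) = e := by
      intro v
      by_cases hv : ∃ e ∈ S, l e = v
      · obtain ⟨e, he, rfl⟩ := hv
        obtain ⟨j, hj⟩ := h4 e he
        refine ⟨j, fun e' he' hl' => ?_⟩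
        rw [hj]; exact h1 he he' hl'.symm
      · exact ⟨⟨0, by positivity⟩, fun e he hl' => absurd ⟨e, he, hl'⟩ hv⟩
    choose i hi using this
    rw [mem_biUnion]
    refine ⟨(S, i), by simp [h𝓜 S h1 h2 h3], ?_⟩
    rw [mem_filter]
    exact ⟨hH.1, fun e he => hi _ e he rfl⟩
  have hone : ∀ p ∈ 𝓜 ×ˢ (univ : Finset (ι → Fin (s ^ 2))),
      #{H ∈ Ω | ∀ e ∈ p.1, H (p.2 (l e), l e) = e} * q ^ N ≤ q ^ (s ^ 2 * N) * q ^ D := by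
    rintro ⟨S, i⟩ hp
    rw [mem_product] at hp
    obtain ⟨hS1, hS2⟩ := h𝓜' S hp.1
    rcases ({H ∈ Ω | ∀ e ∈ S, H (i (l e), l e) = e}).eq_empty_or_nonempty with h0 | ⟨g, hg⟩
    · rw [h0]; simp
    · rw [mem_filter] at hg
      have hc := count_fix t q htc (S.image (fun e => (i (l e), l e))) g
      rw [card_image_of_injOn (by
        intro a ha b hb h
        exact hS1 ha hb (Prod.ext_iff.1 h).2)] at hc
      have hsub : {H ∈ Ω | ∀ e ∈ S, H (i (l e), l e) = e} ⊆
        {H ∈ Fintype.piFinset t | ∀ z ∈ S.image (fun e => (i (l e), l e)), H z = g z} := by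
        intro H hH
        rw [mem_filter] at hH ⊢
        refine ⟨hH.1, ?_⟩
        intro z hz
        rw [mem_image] at hz
        obtain ⟨e, he, rfl⟩ := hz
        rw [hH.2 e he, hg.2 e he]
      calc _ ≤ #{H ∈ Fintype.piFinset t | ∀ z ∈ S.image (fun e => (i (l e), l e)), H z = g z}
            * q ^ (#S + D) := Nat.mul_le_mul (card_le_card hsub) (Nat.pow_le_pow_right hq hS2)
        _ = #{H ∈ Fintype.piFinset t | ∀ z ∈ S.image (fun e => (i (l e), l e)), H z = g z}
            * q ^ #S * q ^ D := by rw [pow_add, mul_assoc]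
        _ ≤ _ := by
          refine Nat.mul_le_mul_right _ (hc.trans (le_of_eq ?_))
          simp [hι]
  have hfin : #good * q ^ N ≤ #𝓜 * (s ^ 2) ^ N * (q ^ (s ^ 2 * N) * q ^ D) := by
    calc _ ≤ (∑ p ∈ 𝓜 ×ˢ (univ : Finset (ι → Fin (s ^ 2))),
          #{H ∈ Ω | ∀ e ∈ p.1, H (p.2 (l e), l e) = e}) * q ^ N :=
          Nat.mul_le_mul_right _ ((card_le_card hcov).trans card_biUnion_le)
      _ ≤ ∑ p ∈ 𝓜 ×ˢ (univ : Finset (ι → Fin (s ^ 2))), q ^ (s ^ 2 * N) * q ^ D := by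
          rw [sum_mul]; exact sum_le_sum hone
      _ = _ := by
          rw [sum_const, card_product, smul_eq_mul]
          simp [hι]
  have hpos : 0 < q ^ (s ^ 2 * N) := by positivity
  refine Nat.le_of_mul_le_mul_left ?_ hpos
  calc q ^ (s ^ 2 * N) * q ^ N ≤ 2 * #good * q ^ N := Nat.mul_le_mul_right _ hhalf
    _ = 2 * (#good * q ^ N) := by ring
    _ ≤ 2 * (#𝓜 * (s ^ 2) ^ N * (q ^ (s ^ 2 * N) * q ^ D)) := Nat.mul_le_mul_left _ hfin
    _ = _ := by ring

end Count

section Coclique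
open Finset

theorem exists_perm_ext {α E : Type} [Fintype α] [DecidableEq α] [DecidableEq E] (l r : E → α) (P Q : Finset α)
    (S : Finset E) (hl : Set.InjOn l S) (hr : Set.InjOn r S) (hP : S.image l = P)
    (hQ : S.image r = Q) (σ₀ : Equiv.Perm α) (h₀ : P.image σ₀ = Q) :
    ∃ σ : Equiv.Perm α, (∀ e ∈ S, σ (l e) = r e) ∧ ∀ a, a ∉ P → σ a = σ₀ a := by
  have hc : ∀ a, ∃ b, (∀ e ∈ S, l e = a → b = r e) ∧ (a ∉ P → b = σ₀ a) := by
    intro a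
    by_cases ha : a ∈ P
    · rw [← hP, mem_image] at ha
      obtain ⟨e, he, rfl⟩ := ha
      refine ⟨r e, fun e' he' h => ?_, fun h => ?_⟩
      · rw [hl he' he h]
      · exact absurd (hP ▸ mem_image_of_mem l he) h
    · refine ⟨σ₀ a, fun e he h => ?_, fun _ => rfl⟩
      exact absurd (hP ▸ h ▸ mem_image_of_mem l he) ha
  choose f hf1 hf2 using hc
  have hfQ : ∀ a ∈ P, ∃ e ∈ S, l e = a ∧ f a = r e := by
    intro a ha
    rw [← hP, mem_image] at ha
    obtain ⟨e, he, rfl⟩ := ha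
    exact ⟨e, he, rfl, hf1 _ e he rfl⟩
  have hmix : ∀ a b, a ∈ P → b ∉ P → f a ≠ f b := by
    intro a b ha hb h
    obtain ⟨e, he, -, h2⟩ := hfQ a ha
    rw [h2, hf2 b hb] at h
    have : r e ∈ Q := hQ ▸ mem_image_of_mem r he
    rw [h, ← h₀, mem_image] at this
    obtain ⟨c, hc, hcb⟩ := this
    exact hb (σ₀.injective hcb ▸ hc)
  have hinj : Function.Injective f := by
    intro a b h
    by_cases ha : a ∈ P <;> by_cases hb : b ∈ P
    · obtain ⟨e, he, h1, h2⟩ := hfQ a ha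
      obtain ⟨e', he', h1', h2'⟩ := hfQ b hb
      rw [h2, h2'] at h
      rw [← h1, ← h1', hr he he' h]
    · exact absurd h (hmix a b ha hb)
    · exact absurd h.symm (hmix b a hb ha)
    · rw [hf2 a ha, hf2 b hb] at h
      exact σ₀.injective h
  refine ⟨Equiv.ofBijective f (Finite.injective_iff_bijective.1 hinj), ?_, ?_⟩
  · intro e he; exact hf1 _ e he rfl
  · intro a ha; exact hf2 a ha

/-- the bad event -/
def BadPair (k : ℕ) {α : Type} (σ τ : Equiv.Perm α) : Prop :=
  ∃ a, ((τ⁻¹ * σ) ^ k) a = a ∧ (τ⁻¹ * σ) a ≠ a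

theorem coclique_class {α E : Type} [Fintype α] [DecidableEq α] [DecidableEq E] (k : ℕ) (l r : E → α)
    (hlr : ∀ e f, l e = l f → r e = r f → e = f) (hnc : NoCyc k l r)
    (P Q : Finset α) (𝓒 : Finset (Finset E))
    (h𝓒 : ∀ S ∈ 𝓒, Set.InjOn l S ∧ Set.InjOn r S ∧ S.image l = P ∧ S.image r = Q) :
    ∃ A : Finset (Equiv.Perm α), #A = #𝓒 ∧ ∀ σ ∈ A, ∀ τ ∈ A, ¬ BadPair k σ τ := by
  rcases 𝓒.eq_empty_or_nonempty with rfl | ⟨S₀, hS₀⟩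
  · exact ⟨∅, by simp⟩
  obtain ⟨a1, a2, a3, a4⟩ := h𝓒 S₀ hS₀
  have hcard : #P = #Q := by
    rw [← a3, ← a4, card_image_of_injOn a1, card_image_of_injOn a2]
  have hσ₀ : ∃ σ₀ : Equiv.Perm α, P.image σ₀ = Q := by
    obtain ⟨e⟩ : Nonempty (P ≃ Q) := Fintype.card_eq.1 (by simpa using hcard)
    refine ⟨Equiv.extendSubtype e, ?_⟩
    apply eq_of_subset_of_card_le
    · intro b hb
      rw [mem_image] at hb
      obtain ⟨a, ha, rfl⟩ := hb
      exact e.extendSubtype_mem a ha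
    · rw [card_image_of_injective _ (Equiv.injective _), hcard]
  obtain ⟨σ₀, h₀⟩ := hσ₀
  have hex : ∀ S, ∃ σ : Equiv.Perm α, S ∈ 𝓒 → (∀ e ∈ S, σ (l e) = r e) ∧ ∀ a, a ∉ P → σ a = σ₀ a := by
    intro S
    by_cases hS : S ∈ 𝓒
    · obtain ⟨b1, b2, b3, b4⟩ := h𝓒 S hS
      obtain ⟨σ, h⟩ := exists_perm_ext l r P Q S b1 b2 b3 b4 σ₀ h₀
      exact ⟨σ, fun _ => h⟩
    · exact ⟨1, fun h => absurd h hS⟩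
  choose F hF using hex
  refine ⟨𝓒.image F, card_image_of_injOn ?_, ?_⟩
  · have key : ∀ S ∈ 𝓒, ∀ T ∈ 𝓒, F S = F T → S ⊆ T := by
      intro S hS T hT h e he
      have hmem : l e ∈ T.image l := by
        rw [(h𝓒 T hT).2.2.1, ← (h𝓒 S hS).2.2.1]; exact mem_image_of_mem l he
      rw [mem_image] at hmem
      obtain ⟨f, hf, hfe⟩ := hmem
      have h1 := (hF S hS).1 e he
      have h2 := (hF T hT).1 f hf
      rw [← h, hfe, h1] at h2
      rwa [hlr e f hfe.symm h2]
    intro S hS T hT h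
    exact subset_antisymm (key S hS T hT h) (key T hT S hS h.symm)
  · intro σ hσ τ hτ
    rw [mem_image] at hσ hτ
    obtain ⟨S, hS, rfl⟩ := hσ
    obtain ⟨T, hT, rfl⟩ := hτ
    rintro ⟨a, ha1, ha2⟩
    set ρ := (F T)⁻¹ * F S with hρ
    let s : ℕ → α := fun j => (ρ ^ j) a
    have hs : ∀ j, F T (s (j+1)) = F S (s j) := by
      intro j
      simp only [s, pow_succ', Equiv.Perm.mul_apply]
      rw [hρ]
      simp
    have hne : ∀ j, s (j+1) ≠ s j := by
      intro j h
      simp only [s, pow_succ] at h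
      rw [Equiv.Perm.mul_apply] at h
      exact ha2 ((ρ ^ j).injective h)
    have hne2 : ∀ j, F S (s j) ≠ F T (s j) := by
      intro j h
      rw [← hs] at h
      exact hne j ((F T).injective h)
    have hP : ∀ j, s j ∈ P := by
      intro j
      by_contra hp
      exact hne2 j (by rw [(hF S hS).2 _ hp, (hF T hT).2 _ hp])
    have hS' : ∀ x, ∃ e, x ∈ P → e ∈ S ∧ l e = x := by
      intro x
      by_cases hx : x ∈ P
      · have hx' := hx
        rw [← (h𝓒 S hS).2.2.1, mem_image] at hx'
        obtain ⟨e, he⟩ := hx'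
        exact ⟨e, fun _ => he⟩
      · have hne : (S₀.image l).Nonempty := a3 ▸ ⟨_, hP 0⟩
        obtain ⟨e, -⟩ := hne.of_image
        exact ⟨e, fun h => absurd h hx⟩
    have hT' : ∀ x, ∃ e, x ∈ P → e ∈ T ∧ l e = x := by
      intro x
      by_cases hx : x ∈ P
      · have hx' := hx
        rw [← (h𝓒 T hT).2.2.1, mem_image] at hx'
        obtain ⟨e, he⟩ := hx'
        exact ⟨e, fun _ => he⟩
      · have hne : (S₀.image l).Nonempty := a3 ▸ ⟨_, hP 0⟩
        obtain ⟨e, -⟩ := hne.of_image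
        exact ⟨e, fun h => absurd h hx⟩
    choose u hu using hS'
    choose v hv using hT'
    have ru : ∀ j, r (u (s j)) = F S (s j) := by
      intro j
      rw [← (hF S hS).1 _ (hu _ (hP j)).1, (hu _ (hP j)).2]
    have rv : ∀ j, r (v (s j)) = F T (s j) := by
      intro j
      rw [← (hF T hT).1 _ (hv _ (hP j)).1, (hv _ (hP j)).2]
    refine hnc (fun j => u (s j)) (fun j => v (s (j+1))) ?_ ?_
    · intro j
      refine ⟨?_, ?_, ?_, ?_⟩
      · rw [ru, rv, hs]
      · intro h
        have := congrArg l h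
        rw [(hu _ (hP j)).2, (hv _ (hP (j+1))).2] at this
        exact hne j this.symm
      · rw [(hv _ (hP (j+1))).2, (hu _ (hP (j+1))).2]
      · intro h
        have := congrArg r h
        rw [ru, rv] at this
        exact hne2 _ this.symm
    · have : s k = s 0 := by simpa [s] using ha1
      show u (s k) = u (s 0)
      rw [this]

theorem coclique_main {α E : Type} [Fintype α] [DecidableEq α] [DecidableEq E] (k : ℕ) (l r : E → α)
    (hlr : ∀ e f, l e = l f → r e = r f → e = f) (hnc : NoCyc k l r)
    (𝓜 : Finset (Finset E)) (h𝓜 : ∀ S ∈ 𝓜, Set.InjOn l S ∧ Set.InjOn r S) :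
    ∃ A : Finset (Equiv.Perm α), #𝓜 ≤ 4 ^ Fintype.card α * #A ∧
      ∀ σ ∈ A, ∀ τ ∈ A, ¬ BadPair k σ τ := by
  let c : Finset E → Finset α × Finset α := fun S => (S.image l, S.image r)
  obtain ⟨⟨P, Q⟩, -, hmax⟩ := exists_max_image (univ : Finset (Finset α × Finset α))
    (fun p => #{S ∈ 𝓜 | c S = p}) ⟨(∅, ∅), mem_univ _⟩
  obtain ⟨A, hA, hA'⟩ := coclique_class k l r hlr hnc P Q {S ∈ 𝓜 | c S = (P, Q)} (by
    intro S hS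
    rw [mem_filter] at hS
    have h1 := congrArg Prod.fst hS.2
    have h2 := congrArg Prod.snd hS.2
    exact ⟨(h𝓜 S hS.1).1, (h𝓜 S hS.1).2, h1, h2⟩)
  refine ⟨A, ?_, hA'⟩
  rw [hA, card_eq_sum_card_fiberwise (f := c) (t := univ) (by simp)]
  refine (sum_le_card_nsmul _ _ _ (fun p hp => hmax p hp)).trans (le_of_eq ?_)
  rw [smul_eq_mul]
  congr 1
  simp only [card_univ, Fintype.card_prod, Fintype.card_finset]
  rw [← mul_pow]; norm_num

/-- partner map of the matching graph given by a permutation -/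
def mm {α : Type} (σ : Equiv.Perm α) : α ⊕ α → α ⊕ α :=
  Sum.elim (fun a => Sum.inr (σ a)) (fun b => Sum.inl (σ⁻¹ b))

theorem mm_mm {α : Type} (σ : Equiv.Perm α) (x : α ⊕ α) : mm σ (mm σ x) = x := by
  rcases x with a | b <;> simp [mm]

def pmG {α : Type} (σ : Equiv.Perm α) : SimpleGraph (α ⊕ α) where
  Adj x y := y = mm σ x
  symm := ⟨by rintro x y rfl; exact (mm_mm σ x).symm⟩
  loopless := ⟨by rintro (a | b) h <;> simp [mm] at h⟩

theorem cycle_alt {V : Type} (G : SimpleGraph V) (m m' : V → V)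
    (hm : ∀ x, m (m x) = x) (hm' : ∀ x, m' (m' x) = x)
    (hG : ∀ x y, G.Adj x y → y = m x ∨ y = m' x) (k : ℕ) (hk : 2 ≤ k) (u : V) (w : G.Walk u u)
    (hw : w.IsCycle) (hlen : w.length = 2 * k) (h1 : w.getVert 1 = m u) :
    ((fun x => m' (m x))^[k]) u = u ∧ m' (m u) ≠ u := by
  have hne : ∀ i, i + 2 ≤ 2 * k → w.getVert (i + 2) ≠ w.getVert i := by
    intro i hi h
    rcases Nat.eq_zero_or_pos i with rfl | hi0
    · have := hw.getVert_injOn' (by simp [hlen]; omega) (by simp) h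
      omega
    · have := hw.getVert_injOn (by simp [hlen]; omega) (by simp [hlen]; omega) h
      omega
  have hstep : ∀ i, i < 2 * k → w.getVert (i+1) = m (w.getVert i) ∨ w.getVert (i+1) = m' (w.getVert i) := by
    intro i hi
    exact hG _ _ (w.adj_getVert_succ (by omega))
  have key : ∀ j, j < k → w.getVert (2*j) = (fun x => m' (m x))^[j] u ∧
      w.getVert (2*j+1) = m (w.getVert (2*j)) ∧ w.getVert (2*j+2) = m' (w.getVert (2*j+1)) := by
    intro j
    induction j with
    | zero =>
      intro _
      have h0 : w.getVert 1 = m (w.getVert 0) := by rw [h1]; simp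
      refine ⟨by simp, h0, ?_⟩
      rcases hstep 1 (by omega) with h | h
      · exfalso
        apply hne 0 (by omega)
        simp only [zero_add]
        rw [h, h0, hm]
      · exact h
    | succ j ih =>
      intro hj
      obtain ⟨i1, i2, i3⟩ := ih (by omega)
      have e1 : w.getVert (2*(j+1)) = m' (w.getVert (2*j+1)) := i3
      have e2 : w.getVert (2*(j+1)+1) = m (w.getVert (2*(j+1))) := by
        rcases hstep (2*(j+1)) (by omega) with h | h
        · exact h
        · exfalso
          apply hne (2*j+1) (by omega)
          have : 2*j+1+2 = 2*(j+1)+1 := by ring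
          rw [this, h, e1, hm']
      refine ⟨?_, e2, ?_⟩
      · rw [e1, i2, i1, Function.iterate_succ_apply']
      · rcases hstep (2*(j+1)+1) (by omega) with h | h
        · exfalso
          apply hne (2*(j+1)) (by omega)
          rw [h, e2, hm]
        · exact h
  constructor
  · obtain ⟨i1, i2, i3⟩ := key (k-1) (by omega)
    have hk' : k = (k - 1) + 1 := by omega
    have : w.getVert (2*(k-1)+2) = u := by
      have : 2*(k-1)+2 = w.length := by omega
      rw [this, SimpleGraph.Walk.getVert_length]
    rw [hk', Function.iterate_succ_apply', ← i1, ← i2, ← i3, this]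
  · obtain ⟨i1, i2, i3⟩ := key 0 (by omega)
    have h2 := hne 0 (by omega)
    simp only [mul_zero, zero_add, SimpleGraph.Walk.getVert_zero] at i2 i3 h2
    rw [← i2, ← i3]; exact h2

theorem bad_of_iter {α : Type} (σ τ : Equiv.Perm α) (k : ℕ) (u : α ⊕ α)
    (h1 : ((fun x => mm τ (mm σ x))^[k]) u = u) (h2 : mm τ (mm σ u) ≠ u) :
    BadPair k σ τ ∨ BadPair k τ σ := by
  rcases u with a | b
  · left
    have : ∀ j, ((fun x => mm τ (mm σ x))^[j]) (Sum.inl a) = Sum.inl (((τ⁻¹ * σ)^j) a) := by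
      intro j
      induction j with
      | zero => simp
      | succ j ih => rw [Function.iterate_succ_apply', ih, pow_succ']; simp [mm]
    rw [this] at h1
    refine ⟨a, Sum.inl.inj h1, ?_⟩
    intro h; apply h2; simpa [mm] using h
  · right
    have : ∀ j, ((fun x => mm τ (mm σ x))^[j]) (Sum.inr b) = Sum.inr (((τ * σ⁻¹)^j) b) := by
      intro j
      induction j with
      | zero => simp
      | succ j ih => rw [Function.iterate_succ_apply', ih, pow_succ']; simp [mm]
    rw [this] at h1
    have h1' := Sum.inr.inj h1
    have hb : (τ * σ⁻¹) b ≠ b := by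
      intro h; apply h2; simpa [mm] using h
    have hconj : σ⁻¹ * τ = σ⁻¹ * (τ * σ⁻¹) * (σ⁻¹)⁻¹ := by group
    refine ⟨σ⁻¹ b, ?_, ?_⟩
    · rw [hconj, conj_pow]
      simp [h1']
    · intro h
      apply hb
      rw [hconj] at h
      have := σ⁻¹.injective (a₁ := (τ * σ⁻¹) b) (a₂ := b) (by simpa using h)
      exact this

theorem bad_of_cycle {α : Type} (σ τ : Equiv.Perm α) (k : ℕ) (hk : 2 ≤ k)
    (h : ContainsCycleLen (pmG σ ⊔ pmG τ) (2 * k)) : BadPair k σ τ ∨ BadPair k τ σ := by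
  obtain ⟨u, w, hw, hlen⟩ := h
  have hG : ∀ x y, (pmG σ ⊔ pmG τ).Adj x y → y = mm σ x ∨ y = mm τ x := by
    intro x y h
    exact h
  have h1 := hG _ _ (w.adj_getVert_succ (i := 0) (by omega))
  simp only [zero_add, SimpleGraph.Walk.getVert_zero] at h1
  rcases h1 with h1 | h1
  · obtain ⟨e1, e2⟩ := cycle_alt _ (mm σ) (mm τ) (mm_mm σ) (mm_mm τ) hG k hk u w hw hlen h1
    exact bad_of_iter σ τ k u e1 e2
  · obtain ⟨e1, e2⟩ := cycle_alt _ (mm τ) (mm σ) (mm_mm τ) (mm_mm σ)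
      (fun x y h => (hG x y h).symm) k hk u w hw hlen h1
    exact (bad_of_iter τ σ k u e1 e2).symm

theorem pm_normal_form {h n : ℕ} (hn : n = 2 * h) (G : SimpleGraph (Fin n)) (hG : IsPMGraph G) :
    ∃ π : (Fin h ⊕ Fin h) ≃ Fin n, ∀ x y, G.Adj (π x) (π y) ↔ y = mm 1 x := by
  classical
  choose m hm hm' using hG
  simp only at hm hm'
  have hmm : ∀ v, m (m v) = v := fun v => (hm' (m v) v (hm v).symm).symm
  have hne : ∀ v, m v ≠ v := fun v h => G.loopless.irrefl v (by have := hm v; rwa [h] at this)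
  have hadj : ∀ v w, G.Adj v w ↔ w = m v := fun v w => ⟨hm' v w, fun h => h ▸ hm v⟩
  let L := {v : Fin n // v < m v}
  let f : L ⊕ L → Fin n := Sum.elim (fun v => v.1) (fun v => m v.1)
  have hf : Function.Bijective f := by
    constructor
    · rintro (⟨a, ha⟩ | ⟨a, ha⟩) (⟨b, hb⟩ | ⟨b, hb⟩) h
      · simp [f] at h; simp [h]
      · simp only [f, Sum.elim_inl, Sum.elim_inr] at h
        rw [h, hmm] at ha; exact absurd ha hb.not_gt
      · simp only [f, Sum.elim_inl, Sum.elim_inr] at h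
        rw [← h, hmm] at hb; exact absurd hb ha.not_gt
      · simp only [f, Sum.elim_inr] at h
        have : a = b := by rw [← hmm a, h, hmm]
        simp [this]
    · intro v
      rcases lt_or_gt_of_ne (hne v) with h | h
      · exact ⟨Sum.inr ⟨m v, by rwa [hmm]⟩, hmm v⟩
      · exact ⟨Sum.inl ⟨v, h⟩, rfl⟩
  have hcard : Fintype.card L = h := by
    have := Fintype.card_of_bijective hf
    simp only [Fintype.card_sum, Fintype.card_fin] at this
    omega
  let e : Fin h ≃ L := (Fintype.equivFinOfCardEq hcard).symm
  refine ⟨(Equiv.sumCongr e e).trans (Equiv.ofBijective f hf), ?_⟩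
  intro x y
  rw [hadj]
  have key : ∀ z : Fin h ⊕ Fin h, m (f (Sum.map e e z)) = f (Sum.map e e (mm 1 z)) := by
    rintro (a | b)
    · simp [f, mm]
    · simp [f, mm, hmm]
  show f (Sum.map e e y) = m (f (Sum.map e e x)) ↔ _
  rw [key, hf.1.eq_iff]
  exact (Sum.map_injective.2 ⟨e.injective, e.injective⟩).eq_iff

theorem clique_coclique {h n k : ℕ} (hn : n = 2 * h) (hk : 2 ≤ k)
    (F : Finset (SimpleGraph (Fin n))) (hF : ∀ G ∈ F, IsPMGraph G)
    (hF' : ∀ G₁ ∈ F, ∀ G₂ ∈ F, G₁ ≠ G₂ → ContainsCycleLen (G₁ ⊔ G₂) (2 * k))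
    (A : Finset (Equiv.Perm (Fin h))) (hA : ∀ σ ∈ A, ∀ τ ∈ A, ¬ BadPair k σ τ) :
    #F * #A ≤ n ^ h := by
  classical
  let B : SimpleGraph (Fin n) × Equiv.Perm (Fin h) → Finset ((Fin h ⊕ Fin h) ≃ Fin n) :=
    fun p => {π | ∀ x y, p.1.Adj (π x) (π y) ↔ (pmG p.2).Adj x y}
  have hB : ∀ p ∈ F ×ˢ A, h.factorial ≤ #(B p) := by
    rintro ⟨G, σ⟩ hp
    rw [mem_product] at hp
    obtain ⟨π, hπ⟩ := pm_normal_form hn G (hF G hp.1)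
    have : #(univ : Finset (Equiv.Perm (Fin h))) ≤ #(B (G, σ)) := by
      apply card_le_card_of_injOn (fun ρ => (Equiv.sumCongr ρ (σ.symm.trans ρ)).trans π)
      · intro ρ _
        simp only [B, coe_filter, mem_univ, true_and, Set.mem_ofPred_eq, Equiv.trans_apply]
        intro x y
        rw [hπ]
        show _ ↔ y = mm σ x
        rcases x with a | a <;> rcases y with b | b <;> simp [mm, Equiv.symm_apply_eq, Equiv.eq_symm_apply]
      · intro ρ _ ρ' _ hρ
        ext1 a
        have := Equiv.congr_fun hρ (Sum.inl a)
        simpa using this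
    simpa [Fintype.card_perm] using this
  have hdisj : ∀ p ∈ F ×ˢ A, ∀ p' ∈ F ×ˢ A, p ≠ p' → Disjoint (B p) (B p') := by
    rintro ⟨G, σ⟩ hp ⟨G', σ'⟩ hp' hne
    rw [mem_product] at hp hp'
    rw [Finset.disjoint_left]
    intro π h1 h2
    simp only [B, mem_filter, mem_univ, true_and] at h1 h2
    by_cases hG : G = G'
    · subst hG
      apply hne
      congr 1
      ext1 a
      have e1 : (pmG σ).Adj (Sum.inl a) (Sum.inr (σ a)) := rfl
      rw [← h1, h2] at e1
      have : (Sum.inr (σ a) : Fin h ⊕ Fin h) = Sum.inr (σ' a) := e1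
      exact Sum.inr.inj this
    · obtain ⟨u, w, hw, hlen⟩ := hF' G hp.1 G' hp'.1 hG
      let φ : (G ⊔ G') →g (pmG σ ⊔ pmG σ') :=
        ⟨π.symm, by
          intro x y hxy
          rcases hxy with hxy | hxy
          · left; rw [← h1]; simpa using hxy
          · right; rw [← h2]; simpa using hxy⟩
      have hcyc : ContainsCycleLen (pmG σ ⊔ pmG σ') (2 * k) :=
        ⟨φ u, w.map φ, hw.map π.symm.injective, by simp [hlen]⟩
      rcases bad_of_cycle σ σ' k hk hcyc with hb | hb
      · exact hA σ hp.2 σ' hp'.2 hb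
      · exact hA σ' hp'.2 σ hp.2 hb
  have hle : #(F ×ˢ A) * h.factorial ≤ n.factorial := by
    calc #(F ×ˢ A) * h.factorial ≤ ∑ p ∈ F ×ˢ A, #(B p) := by
          rw [← smul_eq_mul]; exact card_nsmul_le_sum _ _ _ hB
      _ = #((F ×ˢ A).biUnion B) := (card_biUnion hdisj).symm
      _ ≤ Fintype.card ((Fin h ⊕ Fin h) ≃ Fin n) := card_le_univ _
      _ = n.factorial := by
          rw [Fintype.card_equiv (finSumFinEquiv.trans (finCongr (by omega)))]
          simp [hn, two_mul]
  rw [card_product] at hle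
  have h2 : n.factorial = h.factorial * n.descFactorial h := by
    have := Nat.factorial_mul_descFactorial (n := n) (k := h) (by omega)
    rw [← this]; congr 2; omega
  have h3 := Nat.descFactorial_le_pow n h
  have : h.factorial * (#F * #A) ≤ h.factorial * n ^ h := by
    calc _ = #F * #A * h.factorial := by ring
      _ ≤ _ := hle
      _ = _ := h2
      _ ≤ _ := Nat.mul_le_mul_left _ h3
  exact Nat.le_of_mul_le_mul_left this (Nat.factorial_pos _)

end Coclique

section Assemble
open Finset

theorem noCyc_copies {E ι κ α : Type} {k c : ℕ} {l : E → ι} {r : E → κ} (h : NoCyc k l r)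
    (φ : ι × Fin c → α) (ψ : κ × Fin c → α) (hφ : Function.Injective φ)
    (hψ : Function.Injective ψ) :
    NoCyc k (fun x : E × Fin c => φ (l x.1, x.2)) (fun x : E × Fin c => ψ (r x.1, x.2)) := by
  intro e f hef hk
  refine h (fun j => (e j).1) (fun j => (f j).1) ?_ (congrArg Prod.fst hk)
  intro j
  obtain ⟨h1, h2, h3, h4⟩ := hef j
  have h1' := Prod.mk.inj (hψ h1)
  have h3' := Prod.mk.inj (hφ h3)
  exact ⟨h1'.1, fun h => h2 (Prod.ext h h1'.2), h3'.1, fun h => h4 (Prod.ext h h3'.2)⟩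

theorem card_fiber_copies {E ι : Type} [Fintype E] [DecidableEq E] [DecidableEq ι] {q c : ℕ}
    (l : E → ι) (hl : ∀ v, Nat.card {e // l e = v} = q) (v : ι × Fin c) :
    #{x : E × Fin c | (l x.1, x.2) = v} = q := by
  obtain ⟨v, i⟩ := v
  have h1 : #{e : E | l e = v} = q := by
    rw [← hl v, Nat.card_eq_fintype_card, Fintype.card_subtype]
  rw [← h1]
  symm
  apply card_bij (fun e _ => (e, i))
  · intro e he; simpa using he
  · intro a _ b _ hab; exact (Prod.mk.inj hab).1
  · rintro ⟨e, j⟩ he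
    simp only [mem_filter, mem_univ, true_and, Prod.mk.injEq] at he
    exact ⟨e, by simpa using he.1, by rw [he.2]⟩

theorem card_eq_mul_of_fibers {E ι : Type} [Fintype E] [Fintype ι] {q : ℕ}
    (l : E → ι) (hl : ∀ v, Nat.card {e // l e = v} = q) :
    Fintype.card E = Fintype.card ι * q := by
  classical
  rw [← card_univ, card_eq_sum_card_fiberwise (f := l) (t := univ) (by simp)]
  rw [sum_const_nat (m := q)]
  · simp
  · intro v _
    rw [← hl v, Nat.card_eq_fintype_card, Fintype.card_subtype]

theorem combine (k : ℕ) (hk : 2 ≤ k) (p : ℕ) (hp : p.Prime) :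
    ∃ N : ℕ, 0 < N ∧ N ≤ p ^ (2 * (k / 2) + (k + 1) / 2 - 1) ∧
      ∀ h n s D c : ℕ, n = 2 * h → c * N ≤ h → 0 < c → 0 < s → 2 * (c * N) ≤ s * D →
      ∀ (F : Finset (SimpleGraph (Fin n))), (∀ G ∈ F, IsPMGraph G) →
      (∀ G₁ ∈ F, ∀ G₂ ∈ F, G₁ ≠ G₂ → ContainsCycleLen (G₁ ⊔ G₂) (2 * k)) →
      #F * p ^ (c * N) ≤ 2 * (s ^ 2) ^ (c * N) * p ^ D * 4 ^ h * n ^ h := by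
  classical
  haveI : Fact p.Prime := ⟨hp⟩
  obtain ⟨E, ι, κ, _, _, _, l, r, hne, hl, hr, hlr, hnc, hcard⟩ := alg_main (ZMod p) k hk
  rw [ZMod.card] at hl hr hcard
  have hp0 := hp.pos
  have hEι := card_eq_mul_of_fibers l hl
  have hEκ := card_eq_mul_of_fibers r hr
  have hικ : Fintype.card κ = Fintype.card ι := Nat.eq_of_mul_eq_mul_right hp0 (hEκ.symm.trans hEι)
  have hE0 : 0 < Fintype.card E := Fintype.card_pos
  have hN0 : 0 < Fintype.card ι := by
    rw [hEι] at hE0; exact Nat.pos_of_mul_pos_right hE0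
  refine ⟨Fintype.card ι, hN0, ?_, ?_⟩
  · have : 2 * (k / 2) + (k + 1) / 2 = (2 * (k / 2) + (k + 1) / 2 - 1) + 1 := by omega
    rw [hEι, this, pow_succ] at hcard
    exact Nat.le_of_mul_le_mul_right hcard hp0
  · intro h n s D c hn hc hc0 hs hD F hF hF'
    have hcι : Fintype.card (ι × Fin c) = c * Fintype.card ι := by simp [mul_comm]
    have hcκ : Fintype.card (κ × Fin c) = c * Fintype.card ι := by simp [mul_comm, hικ]
    obtain ⟨φ⟩ : Nonempty ((ι × Fin c) ↪ Fin h) :=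
      Function.Embedding.nonempty_of_card_le (by simpa [hcι] using hc)
    obtain ⟨ψ⟩ : Nonempty ((κ × Fin c) ↪ Fin h) :=
      Function.Embedding.nonempty_of_card_le (by simpa [hcκ] using hc)
    let l' : E × Fin c → ι × Fin c := fun x => (l x.1, x.2)
    let r' : E × Fin c → κ × Fin c := fun x => (r x.1, x.2)
    let 𝓜 : Finset (Finset (E × Fin c)) :=
      {S | Set.InjOn l' S ∧ Set.InjOn r' S ∧ c * Fintype.card ι ≤ #S + D}
    have h1 := count_matchings l' r' p s D (c * Fintype.card ι) hs (Nat.mul_pos hc0 hN0)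
      (card_fiber_copies l hl) (card_fiber_copies r hr) hcι hcκ hD hp0 𝓜
      (by intro S a b d; simp only [𝓜, mem_filter, mem_univ, true_and]; exact ⟨a, b, d⟩)
      (by intro S hS; simp only [𝓜, mem_filter, mem_univ, true_and] at hS; exact ⟨hS.1, hS.2.2⟩)
    obtain ⟨A, hA, hA'⟩ := coclique_main k (fun x : E × Fin c => φ (l x.1, x.2))
      (fun x : E × Fin c => ψ (r x.1, x.2))
      (by
        rintro ⟨e, i⟩ ⟨f, j⟩ h1 h2
        have h1' := Prod.mk.inj (φ.injective h1)
        have h2' := Prod.mk.inj (ψ.injective h2)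
        exact Prod.ext (hlr _ _ h1'.1 h2'.1) h1'.2)
      (noCyc_copies hnc φ ψ φ.injective ψ.injective) 𝓜
      (by
        intro S hS
        simp only [𝓜, mem_filter, mem_univ, true_and] at hS
        refine ⟨fun a ha b hb hab => hS.1 ha hb (φ.injective hab),
          fun a ha b hb hab => hS.2.1 ha hb (ψ.injective hab)⟩)
    rw [Fintype.card_fin] at hA
    have h2 := clique_coclique hn hk F hF hF' A hA'
    calc #F * p ^ (c * Fintype.card ι)
        ≤ #F * (2 * (s ^ 2) ^ (c * Fintype.card ι) * p ^ D * (4 ^ h * #A)) := by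
          gcongr
          exact h1.trans (Nat.mul_le_mul_left _ hA)
      _ = 2 * (s ^ 2) ^ (c * Fintype.card ι) * p ^ D * 4 ^ h * (#F * #A) := by ring
      _ ≤ _ := Nat.mul_le_mul_left _ h2

end Assemble

section Numerics
open Finset Filter

set_option maxHeartbeats 2000000 in
theorem key_bound (k : ℕ) (hk : 2 ≤ k) (ε : ℝ) (hε : 0 < ε) :
    ∃ N₀ : ℕ, ∀ n : ℕ, N₀ ≤ n → Even n →
      ∀ (F : Finset (SimpleGraph (Fin n))), (∀ G ∈ F, IsPMGraph G) →
      (∀ G₁ ∈ F, ∀ G₂ ∈ F, G₁ ≠ G₂ → ContainsCycleLen (G₁ ⊔ G₂) (2 * k)) →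
      (#F : ℝ) ≤ (n : ℝ) ^ ((1 / 2 - 1 / (3 * (k : ℝ) - 2) + ε) * n) := by
  obtain ⟨T, hT⟩ : ∃ T, T = 2 * (k / 2) + (k + 1) / 2 - 1 := ⟨_, rfl⟩
  have hT2 : 2 ≤ T := by omega
  have hTk : 2 * T + 2 ≤ 3 * k := by omega
  obtain ⟨δ, hδ⟩ : ∃ δ : ℝ, δ = min ε 1 / 8 := ⟨_, rfl⟩
  have hδ0 : 0 < δ := by rw [hδ]; positivity
  have hδε : 8 * δ ≤ ε := by rw [hδ]; linarith [min_le_left ε 1]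
  have hδ1 : 8 * δ ≤ 1 := by rw [hδ]; linarith [min_le_right ε 1]
  obtain ⟨s, hs⟩ := exists_nat_ge (2 / δ)
  have hs0R : (0:ℝ) < s := lt_of_lt_of_le (by positivity) hs
  have hs0 : 0 < s := by exact_mod_cast hs0R
  have ev1 : ∀ᶠ n : ℕ in atTop, 2 ^ T / δ ≤ (n : ℝ) ^ δ :=
    ((tendsto_rpow_atTop hδ0).comp tendsto_natCast_atTop_atTop).eventually_ge_atTop _
  have ev2 : ∀ᶠ n : ℕ in atTop, 2 / δ ≤ (n : ℝ) :=
    (tendsto_natCast_atTop_atTop).eventually_ge_atTop _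
  have ev3 : ∀ᶠ n : ℕ in atTop,
      (Real.log (s ^ 2) + Real.log 4 + Real.log 2) / δ ≤ Real.log n :=
    (Real.tendsto_log_atTop.comp tendsto_natCast_atTop_atTop).eventually_ge_atTop _
  obtain ⟨N₀, hN₀⟩ := eventually_atTop.1 (ev1.and (ev2.and ev3))
  refine ⟨N₀, ?_⟩
  intro n hn heven F hF hF'
  obtain ⟨e1, e2, e3⟩ := hN₀ n hn
  rcases Nat.eq_zero_or_pos #F with hF0 | hF0
  · rw [hF0]; simp only [Nat.cast_zero]; positivity
  have hn16 : (16:ℝ) ≤ n := by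
    refine le_trans ?_ e2
    rw [le_div_iff₀ hδ0]; linarith
  have hn0 : (0:ℝ) < n := by linarith
  have hn1 : (1:ℝ) ≤ n := by linarith
  have hTR : (2:ℝ) ≤ T := by exact_mod_cast hT2
  have hT0 : (0:ℝ) < T := by linarith
  obtain ⟨Y, hY⟩ : ∃ Y : ℝ, Y = (n:ℝ) ^ ((1 - δ) / T) := ⟨_, rfl⟩
  have hY1 : 1 ≤ Y := by
    rw [hY]; exact Real.one_le_rpow hn1 (div_nonneg (by linarith) hT0.le)
  obtain ⟨p, hp, hp1, hp2⟩ := Nat.exists_prime_lt_and_le_two_mul ⌊Y⌋₊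
    (by have := Nat.floor_pos.2 hY1; omega)
  have hpY : Y ≤ p := by
    have h1 : Y < ⌊Y⌋₊ + 1 := Nat.lt_floor_add_one Y
    have h2 : ((⌊Y⌋₊ + 1 : ℕ) : ℝ) ≤ p := by exact_mod_cast hp1
    push_cast at h2; linarith
  have hpY2 : (p:ℝ) ≤ 2 * Y := by
    have h1 : (⌊Y⌋₊ : ℝ) ≤ Y := Nat.floor_le (by linarith)
    have h2 : (p:ℝ) ≤ 2 * ⌊Y⌋₊ := by exact_mod_cast hp2
    linarith
  obtain ⟨N, hN0, hNp, hmain⟩ := combine k hk p hp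
  rw [← hT] at hNp
  have hYT : Y ^ T = (n:ℝ) ^ (1 - δ) := by
    rw [hY, ← Real.rpow_natCast, ← Real.rpow_mul hn0.le]
    congr 1; field_simp
  have hNδ : (N:ℝ) ≤ δ * n := by
    have h1 : (N:ℝ) ≤ (p:ℝ) ^ T := by exact_mod_cast hNp
    have h2 : (p:ℝ) ^ T ≤ (2 * Y) ^ T := by gcongr
    rw [mul_pow, hYT] at h2
    have h3 : (2:ℝ) ^ T ≤ δ * (n:ℝ) ^ δ := by
      rw [div_le_iff₀ hδ0] at e1; linarith
    have h4 : (n:ℝ) ^ δ * (n:ℝ) ^ (1 - δ) = n := by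
      rw [← Real.rpow_add hn0]; simp
    have h5 : (2:ℝ) ^ T * (n:ℝ) ^ (1 - δ) ≤ δ * (n:ℝ) ^ δ * (n:ℝ) ^ (1 - δ) := by gcongr
    rw [mul_assoc, h4] at h5
    linarith
  obtain ⟨h, hh⟩ := heven
  have hh' : n = 2 * h := by omega
  have hhR : (n:ℝ) = 2 * h := by exact_mod_cast hh'
  have hNh : N ≤ h := by
    have : (N:ℝ) ≤ h := by nlinarith
    exact_mod_cast this
  obtain ⟨c, hc⟩ : ∃ c, c = h / N := ⟨_, rfl⟩
  have hc0 : 0 < c := by rw [hc]; exact Nat.div_pos hNh hN0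
  have hcN : c * N ≤ h := by rw [hc]; exact Nat.div_mul_le_self h N
  have hcN2 : h ≤ c * N + N := by
    have h1 := Nat.div_add_mod h N
    have h2 := Nat.mod_lt h hN0
    rw [hc]; nlinarith
  obtain ⟨M, hM⟩ : ∃ M, M = c * N := ⟨_, rfl⟩
  obtain ⟨D, hD⟩ : ∃ D, D = 2 * M / s + 1 := ⟨_, rfl⟩
  have hD1 : 2 * M ≤ s * D := by
    have h1 := Nat.div_add_mod (2 * M) s
    have h2 := Nat.mod_lt (2 * M) hs0
    rw [hD]; nlinarith
  have hfin := hmain h n s D c hh' hcN hc0 hs0 (by rw [← hM]; exact hD1) F hF hF'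
  rw [← hM] at hfin hcN hcN2
  have hMh : (M:ℝ) ≤ h := by exact_mod_cast hcN
  have hMh2 : (h:ℝ) ≤ M + N := by exact_mod_cast hcN2
  have hDδ : (D:ℝ) ≤ δ * n := by
    have h1 : (D:ℝ) ≤ 2 * M / s + 1 := by
      rw [hD]; push_cast
      have := @Nat.cast_div_le ℝ _ _ _ (2 * M) s
      push_cast at this; linarith
    have h2 : (2 * M / s : ℝ) ≤ δ / 2 * n := by
      rw [div_le_iff₀ hs0R]
      rw [div_le_iff₀ hδ0] at hs
      have : (n:ℝ) * 2 ≤ n * (s * δ) := by gcongr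
      linarith
    have h3 : 1 ≤ δ / 2 * n := by
      rw [div_le_iff₀ hδ0] at e2; linarith
    linarith
  have hp0 : (0:ℝ) < p := by linarith
  obtain ⟨Λ, hΛ⟩ : ∃ Λ, Λ = Real.log n := ⟨_, rfl⟩
  have hΛ0 : 0 ≤ Λ := by rw [hΛ]; exact Real.log_nonneg hn1
  have hlogp : (1 - δ) / T * Λ ≤ Real.log p := by
    have := Real.log_le_log (by linarith) hpY
    rwa [hY, Real.log_rpow hn0, ← hΛ] at this
  have hFR : (0:ℝ) < #F := by exact_mod_cast hF0
  have hlog : Real.log #F + M * Real.log p ≤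
      Real.log 2 + M * Real.log (s ^ 2) + D * Real.log p + h * Real.log 4 + h * Λ := by
    have h1 : (#F : ℝ) * (p:ℝ) ^ M ≤ 2 * ((s:ℝ) ^ 2) ^ M * p ^ D * 4 ^ h * n ^ h := by
      exact_mod_cast hfin
    have h2 := Real.log_le_log (by positivity) h1
    rw [Real.log_mul (by positivity) (by positivity), Real.log_mul (by positivity) (by positivity),
      Real.log_mul (by positivity) (by positivity), Real.log_mul (by positivity) (by positivity),
      Real.log_mul (by positivity) (by positivity), Real.log_pow (p:ℝ) M,
      Real.log_pow ((s:ℝ)^2) M, Real.log_pow (p:ℝ) D, Real.log_pow (4:ℝ) h,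
      Real.log_pow (n:ℝ) h, ← hΛ] at h2
    exact h2
  have hlogs : 0 ≤ Real.log ((s:ℝ) ^ 2) := by
    apply Real.log_nonneg
    have : (1:ℝ) ≤ s := by exact_mod_cast hs0
    nlinarith
  have hl2 : 0 ≤ Real.log 2 := Real.log_nonneg (by norm_num)
  have hl4 : 0 ≤ Real.log 4 := Real.log_nonneg (by norm_num)
  -- small terms
  have hsmall : Real.log 2 + M * Real.log (s ^ 2) + h * Real.log 4 ≤ δ * Λ * n := by
    rw [div_le_iff₀ hδ0, ← hΛ] at e3
    have a1 : Real.log 2 ≤ n * Real.log 2 := by nlinarith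
    have a2 : M * Real.log ((s:ℝ) ^ 2) ≤ n * Real.log ((s:ℝ) ^ 2) := by
      apply mul_le_mul_of_nonneg_right _ hlogs; linarith
    have a3 : h * Real.log 4 ≤ n * Real.log 4 := by
      apply mul_le_mul_of_nonneg_right _ hl4; linarith
    nlinarith
  have hlogp0 : 0 ≤ Real.log p := Real.log_nonneg (by linarith)
  have hbig : (1 / (2 * T) - 3 * δ) * n * Λ ≤ (M - D) * Real.log p := by
    have b1 : (1 / 2 - 2 * δ) * n ≤ M - D := by linarith
    have b0 : 0 ≤ (1 / 2 - 2 * δ) * n := mul_nonneg (by linarith) hn0.le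
    have b2 : (1 / 2 - 2 * δ) * n * ((1 - δ) / T * Λ) ≤ (M - D) * Real.log p :=
      mul_le_mul b1 hlogp (mul_nonneg (div_nonneg (by linarith) hT0.le) hΛ0) (by linarith)
    refine le_trans ?_ b2
    have b3 : 1 / (2 * (T:ℝ)) - 3 * δ ≤ (1 / 2 - 2 * δ) * ((1 - δ) / T) := by
      have : (1 / 2 - 2 * δ) * ((1 - δ) / T) - (1 / (2 * (T:ℝ)) - 3 * δ)
          = (3 * δ * T - 5 / 2 * δ + 2 * δ ^ 2) / T := by field_simp; ring
      have h2 : 0 ≤ (3 * δ * T - 5 / 2 * δ + 2 * δ ^ 2) / T := by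
        apply div_nonneg _ hT0.le
        nlinarith
      linarith
    calc (1 / (2 * (T:ℝ)) - 3 * δ) * n * Λ = (1 / (2 * (T:ℝ)) - 3 * δ) * (n * Λ) := by ring
      _ ≤ ((1 / 2 - 2 * δ) * ((1 - δ) / T)) * (n * Λ) := by
          apply mul_le_mul_of_nonneg_right b3 (by positivity)
      _ = _ := by ring
  have hTk' : 1 / (3 * (k:ℝ) - 2) ≤ 1 / (2 * (T:ℝ)) := by
    apply one_div_le_one_div_of_le (by linarith)
    have : (2 * T + 2 : ℝ) ≤ 3 * k := by exact_mod_cast hTk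
    linarith
  have hfinal : Real.log #F ≤ (1 / 2 - 1 / (3 * (k : ℝ) - 2) + ε) * n * Λ := by
    have hnΛ : 0 ≤ n * Λ := by positivity
    have c1 : Real.log #F ≤ (1 / 2 - 1 / (2 * (T:ℝ)) + 4 * δ) * (n * Λ) := by
      have : h * Λ = 1 / 2 * (n * Λ) := by rw [hhR]; ring
      nlinarith
    refine c1.trans ?_
    rw [mul_assoc]
    apply mul_le_mul_of_nonneg_right _ hnΛ
    linarith
  rw [Real.rpow_def_of_pos hn0, ← hΛ, ← Real.log_le_iff_le_exp hFR]
  linarith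

end Numerics

/-- `M(n,2k) ≤ n^((1/2 - 1/(3k-2))n - o(n))` for every `k ≥ 2`. -/
theorem stmt_15 (k : ℕ) (hk : 2 ≤ k) :
    ∀ ε : ℝ, 0 < ε → ∃ N : ℕ, ∀ n : ℕ, N ≤ n → Even n →
      (Mnum n (2 * k) : ℝ) ≤
        (n : ℝ) ^ ((1 / 2 - 1 / (3 * (k : ℝ) - 2) + ε) * n) := by
  classical
  intro ε hε
  obtain ⟨N₀, hN₀⟩ := key_bound k hk ε hε
  refine ⟨N₀, fun n hn he => ?_⟩
  have hmem : Mnum n (2 * k) ∈ {m | ∃ F : Finset (SimpleGraph (Fin n)), F.card = m ∧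
      (∀ G ∈ F, IsPMGraph G) ∧
      ∀ G₁ ∈ F, ∀ G₂ ∈ F, G₁ ≠ G₂ → ContainsCycleLen (G₁ ⊔ G₂) (2 * k)} := by
    apply Nat.sSup_mem
    · exact ⟨0, ∅, by simp⟩
    · refine ⟨Fintype.card (SimpleGraph (Fin n)), ?_⟩
      rintro m ⟨F, rfl, -⟩
      exact Finset.card_le_univ F
  obtain ⟨F, hc, hF, hF'⟩ := hmem
  rw [← hc]
  exact hN₀ n hn he F hF hF'
end
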